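/- arXiv:2601.03129 — 13 statements merged into one kernel-verified Lean document; each statement's English description precedes it below -/
import Mathlib

section
/- For every finite simple graph G there exists a fractional orientation φ of G with ρ*(G) = Δ⁻_φ. -/
open scoped Classical

/-- The density `|E(H)|/|V(H)|` of a subgraph `H` of a finite simple graph `G`
(the empty graph has density `0`, via division by zero). -/
noncomputable def SimpleGraph.subDensity {V : Type*} [Fintype V] (G : SimpleGraph V)
    (H : G.Subgraph) : ℚ :=
  (H.edgeSet.ncard : ℚ) / (H.verts.ncard : ℚ)

/-- A fractional orientation of a simple graph `G`: to every edge `{u,v}` it assigns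
nonnegative rationals `toFun u v` (the part of `{u,v}` assigned to `v`) and `toFun v u`
(the part assigned to `u`), summing to `1`. -/
structure SimpleGraph.FracOrientation {V : Type*} (G : SimpleGraph V) where
  toFun : V → V → ℚ
  nonneg : ∀ u v, G.Adj u v → 0 ≤ toFun u v
  sum_eq_one : ∀ u v, G.Adj u v → toFun u v + toFun v u = 1

/-- The `φ`-indegree of a vertex `v`: the total amount of incident edges assigned to `v`. -/
noncomputable def SimpleGraph.FracOrientation.inDeg {V : Type*} [Fintype V] {G : SimpleGraph V}
    (φ : G.FracOrientation) (v : V) : ℚ :=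
  ∑ u ∈ Finset.univ.filter (fun u => G.Adj u v), φ.toFun u v

/-- The maximum `φ`-indegree `Δ⁻_φ` over all vertices. -/
noncomputable def SimpleGraph.FracOrientation.maxInDeg {V : Type*} [Fintype V] [Nonempty V]
    {G : SimpleGraph V} (φ : G.FracOrientation) : ℚ :=
  Finset.univ.sup' Finset.univ_nonempty φ.inDeg


theorem fo_density_le {V : Type*} [Fintype V] [Nonempty V]
    (G : SimpleGraph V) (φ : G.FracOrientation) (H : G.Subgraph) :
    G.subDensity H ≤ φ.maxInDeg := by
  have hin : ∀ v, φ.inDeg v ≤ φ.maxInDeg := fun v =>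
    Finset.le_sup' φ.inDeg (Finset.mem_univ v)
  have hin0 : ∀ v, 0 ≤ φ.inDeg v := fun v =>
    Finset.sum_nonneg (fun u hu => φ.nonneg u v (Finset.mem_filter.1 hu).2)
  have h0 : 0 ≤ φ.maxInDeg := (hin0 (Classical.arbitrary V)).trans (hin _)
  have hcard : (2 * H.edgeSet.ncard : ℚ) = ∑ v, ∑ u, if H.Adj u v then (1 : ℚ) else 0 := by
    have h := H.spanningCoe.sum_degrees_eq_twice_card_edges
    have h2 : H.spanningCoe.edgeFinset.card = H.edgeSet.ncard := by
      rw [← Set.ncard_coe_finset, SimpleGraph.coe_edgeFinset, SimpleGraph.Subgraph.edgeSet_spanningCoe]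
    rw [h2] at h
    have h3 : ((2 * H.edgeSet.ncard : ℕ) : ℚ) = ((∑ v, H.spanningCoe.degree v : ℕ) : ℚ) := by
      rw [h]
    push_cast at h3
    rw [h3]
    refine Finset.sum_congr rfl fun v _ => ?_
    rw [Finset.sum_boole, ← SimpleGraph.card_neighborFinset_eq_degree]
    congr 2
    ext u
    simp [SimpleGraph.Subgraph.adj_comm]
  have hs : (∑ v, ∑ u, if H.Adj u v then (1 : ℚ) else 0)
      = 2 * ∑ v, ∑ u, if H.Adj u v then φ.toFun u v else 0 := by
    have h1 : (∑ v, ∑ u, if H.Adj u v then (1 : ℚ) else 0)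
        = (∑ v, ∑ u, if H.Adj u v then φ.toFun u v else 0)
          + ∑ v, ∑ u, if H.Adj u v then φ.toFun v u else 0 := by
      simp only [← Finset.sum_add_distrib]
      refine Finset.sum_congr rfl fun v _ => Finset.sum_congr rfl fun u _ => ?_
      split_ifs with h
      · exact (φ.sum_eq_one u v h.adj_sub).symm
      · simp
    have h2 : (∑ v, ∑ u, if H.Adj u v then φ.toFun v u else 0)
        = ∑ v, ∑ u, if H.Adj u v then φ.toFun u v else 0 := by
      rw [Finset.sum_comm]
      refine Finset.sum_congr rfl fun v _ => Finset.sum_congr rfl fun u _ => ?_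
      simp [H.adj_comm]
    rw [h1, h2]; ring
  have hle : (∑ v, ∑ u, if H.Adj u v then φ.toFun u v else 0)
      ≤ ∑ v, if v ∈ H.verts then φ.maxInDeg else 0 := by
    refine Finset.sum_le_sum fun v _ => ?_
    split_ifs with hv
    · refine le_trans ?_ (hin v)
      unfold SimpleGraph.FracOrientation.inDeg
      rw [Finset.sum_filter]
      refine Finset.sum_le_sum fun u _ => ?_
      by_cases h : H.Adj u v
      · simp [h, h.adj_sub]
      · simp only [h, if_false]
        split_ifs with h'
        · exact φ.nonneg u v h'
        · exact le_rfl
    · refine (Finset.sum_eq_zero fun u _ => ?_).le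
      rw [if_neg]
      exact fun h => hv h.snd_mem
  have hr : (∑ v, if v ∈ H.verts then φ.maxInDeg else 0) = H.verts.ncard * φ.maxInDeg := by
    rw [← Finset.sum_filter, Finset.sum_const, nsmul_eq_mul, ← Set.ncard_coe_finset]
    simp
  unfold SimpleGraph.subDensity
  refine div_le_of_le_mul₀ (by positivity) h0 ?_
  linarith

theorem fo_exists {V : Type*} [Fintype V] [Nonempty V]
    (G : SimpleGraph V) (p q : ℕ) (hq : 0 < q)
    (hd : ∀ H : G.Subgraph, q * H.edgeSet.ncard ≤ p * H.verts.ncard) :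
    ∃ φ : G.FracOrientation, ∀ v, φ.inDeg v ≤ (p : ℚ) / q := by
  have hall := (Finset.all_card_le_biUnion_card_iff_exists_injective
    (fun x : G.edgeSet × Fin q =>
      (Finset.univ.filter (fun y : V × Fin p => y.1 ∈ x.1.1)))).1 (by
    intro S
    let H : G.Subgraph :=
      { verts := {v | ∃ x ∈ S, v ∈ x.1.1}
        Adj := fun u v => ∃ x ∈ S, x.1.1 = s(u, v)
        adj_sub := by
          rintro u v ⟨x, _, hx⟩
          have := x.1.2
          rw [hx] at this
          exact this
        edge_vert := by
          rintro u v ⟨x, hx, h⟩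
          exact ⟨x, hx, by rw [h]; simp⟩
        symm := ⟨by
          rintro u v ⟨x, hx, h⟩
          exact ⟨x, hx, by rw [h, Sym2.eq_swap]⟩⟩ }
    have hE : H.edgeSet = ((S.image (fun x => x.1.1) : Finset (Sym2 V)) : Set (Sym2 V)) := by
      ext e
      induction e with
      | _ u v => simp [H]
    have h1 : S.card ≤ q * H.edgeSet.ncard := by
      rw [hE, Set.ncard_coe_finset]
      calc S.card ≤ ((S.image (fun x => x.1.1)) ×ˢ (Finset.univ : Finset (Fin q))).card := by
            refine Finset.card_le_card_of_injOn (fun x => (x.1.1, x.2)) ?_ ?_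
            · intro x hx
              simp only [Finset.coe_product, Set.mem_prod]
              exact ⟨Finset.mem_coe.2 (Finset.mem_image_of_mem _ hx), by simp⟩
            · rintro ⟨⟨a, ha⟩, i⟩ _ ⟨⟨b, hb⟩, j⟩ _ h
              simpa using h
        _ = _ := by rw [Finset.card_product, Finset.card_univ, Fintype.card_fin, mul_comm]
    refine h1.trans ((hd H).trans (le_of_eq ?_))
    have h2 : S.biUnion (fun x : G.edgeSet × Fin q =>
      (Finset.univ.filter (fun y : V × Fin p => y.1 ∈ x.1.1)))
        = (Finset.univ.filter (fun v => v ∈ H.verts)) ×ˢ (Finset.univ : Finset (Fin p)) := by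
      ext ⟨v, j⟩
      simp [H]
    rw [h2, Finset.card_product, Finset.card_univ, Fintype.card_fin, mul_comm,
      ← Set.ncard_coe_finset]
    simp)
  obtain ⟨f, hf, hm⟩ := hall
  have hq' : (q : ℚ) ≠ 0 := by positivity
  let P : Sym2 V → Fin q → V → Prop := fun e i v => ∃ h : e ∈ G.edgeSet, (f (⟨e, h⟩, i)).1 = v
  refine ⟨⟨fun u v => ((Finset.univ.filter (fun i => P s(u, v) i v)).card : ℚ) / q,
    fun u v _ => by positivity, ?_⟩, ?_⟩
  · intro u v huv
    have hne := huv.ne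
    rw [Sym2.eq_swap (a := v), ← add_div, div_eq_one_iff_eq hq', ← Nat.cast_add,
      ← Finset.card_union_of_disjoint]
    · have : (Finset.univ.filter (fun i => P s(u, v) i v)) ∪
        (Finset.univ.filter (fun i => P s(u, v) i u)) = Finset.univ := by
        ext i
        have h := hm (⟨s(u, v), huv⟩, i)
        simp only [Finset.mem_filter, Finset.mem_univ, true_and, Sym2.mem_iff] at h
        simp only [Finset.mem_union, Finset.mem_filter, Finset.mem_univ, true_and, iff_true]
        rcases h with h | h
        · exact Or.inr ⟨huv, h⟩
        · exact Or.inl ⟨huv, h⟩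
      rw [this, Finset.card_univ, Fintype.card_fin]
    · rw [Finset.disjoint_left]
      intro i h1 h2
      obtain ⟨_, h1⟩ := (Finset.mem_filter.1 h1).2
      obtain ⟨_, h2⟩ := (Finset.mem_filter.1 h2).2
      exact hne (h2.symm.trans h1)
  · intro v
    unfold SimpleGraph.FracOrientation.inDeg
    simp only
    rw [← Finset.sum_div]
    refine div_le_div_of_nonneg_right ?_ (by positivity)
    rw [← Nat.cast_sum, Nat.cast_le]
    let g : {x : V × Fin q // P s(x.1, v) x.2 v} → Fin p :=
      fun x => (f (⟨s(x.1.1, v), x.2.1⟩, x.1.2)).2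
    have hg : Function.Injective g := by
      intro x y hxy
      have h := hf (Prod.ext (x.2.2.trans y.2.2.symm) hxy)
      obtain ⟨⟨a, i⟩, hx⟩ := x
      obtain ⟨⟨b, j⟩, hy⟩ := y
      simp only [Prod.mk.injEq, Subtype.mk.injEq] at h
      obtain ⟨h1, h2⟩ := h
      have := Sym2.congr_left.1 h1
      subst this
      subst h2
      rfl
    have hc := Fintype.card_le_of_injective g hg
    rw [Fintype.card_fin, Fintype.card_subtype, Finset.card_filter, Fintype.sum_prod_type] at hc
    refine le_trans ?_ hc
    refine (Finset.sum_le_univ_sum_of_nonneg (fun _ => Nat.zero_le _)).trans (le_of_eq ?_)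
    refine Finset.sum_congr rfl fun u _ => ?_
    rw [Finset.card_filter]

/-- For every finite simple graph `G` there exists a fractional orientation `φ` of `G`
with `ρ*(G) = Δ⁻_φ`: the maximum indegree of `φ` is the greatest density of a subgraph. -/
theorem exists_fracOrientation_maxInDeg_eq_maxDensity {V : Type*} [Fintype V] [Nonempty V]
    (G : SimpleGraph V) :
    ∃ φ : G.FracOrientation, IsGreatest (Set.range G.subDensity) φ.maxInDeg := by
  obtain ⟨H, hH⟩ := Finite.exists_max G.subDensity
  have h0 : 0 ≤ G.subDensity H := by unfold SimpleGraph.subDensity; positivity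
  set r := G.subDensity H with hr
  have hrq : ((r.num.toNat : ℕ) : ℚ) / r.den = r := by
    have h1 : ((r.num.toNat : ℕ) : ℤ) = r.num := Int.toNat_of_nonneg (Rat.num_nonneg.2 h0)
    have h2 : ((r.num.toNat : ℕ) : ℚ) = (r.num : ℚ) := by exact_mod_cast congrArg (Int.cast : ℤ → ℚ) h1
    rw [h2, Rat.num_div_den]
  have hden : (0 : ℚ) < r.den := by exact_mod_cast r.den_pos
  obtain ⟨φ, hφ⟩ := fo_exists G r.num.toNat r.den r.den_pos (by
    intro K
    have hK := hH K
    replace hK := hK.trans_eq hrq.symm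
    unfold SimpleGraph.subDensity at hK
    rcases Nat.eq_zero_or_pos K.verts.ncard with hz | hp
    · have : K.edgeSet = ∅ := by
        have hz' : K.verts = ∅ := (Set.ncard_eq_zero (Set.toFinite _)).1 hz
        ext e
        induction e with
        | _ u v =>
          simp only [SimpleGraph.Subgraph.mem_edgeSet, Set.mem_empty_iff_false, iff_false]
          intro h
          have := h.fst_mem
          simp [hz'] at this
      simp [this]
    · have hp' : (0 : ℚ) < K.verts.ncard := by exact_mod_cast hp
      rw [div_le_div_iff₀ hp' hden] at hK
      rw [mul_comm]
      exact_mod_cast hK)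
  rw [hrq] at hφ
  have hmax : φ.maxInDeg = r :=
    le_antisymm (Finset.sup'_le _ _ fun v _ => hφ v) (fo_density_le G φ H)
  refine ⟨φ, ?_⟩
  rw [hmax]
  refine ⟨⟨H, rfl⟩, ?_⟩
  rintro _ ⟨K, rfl⟩
  exact hH K
end

section
/- Let G be a finite simple graph with m edges, let τ ≥ 0 be a rational number and let k ∈ ℕ. Then the following are equivalent: (1) there exists a function f assigning to every incident edge–vertex pair (e, v), where v is an endpoint of the edge e, a nonnegative rational number such that for every edge e = {u,v} one has f(e,u) + f(e,v) ∈ {0,1}, for every vertex v one has Σ_{e incident to v} f(e,v) ≤ τ, and the number of edges e = {u,v} with f(e,u) + f(e,v) = 1 is at least m − k; (2) there exists an edge set F ⊆ E(G) with |F| ≤ k and ρ*(G − F) ≤ τ. -/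
open scoped Classical

theorem aux_flow {V : Type*} [Fintype V] (G : SimpleGraph V) (τ : ℚ) (hτ : 0 ≤ τ)
    (hH : ∀ H : G.Subgraph, G.subDensity H ≤ τ) :
    ∃ f : V → V → ℚ, (∀ u v, 0 ≤ f u v) ∧ (∀ u v, G.Adj u v → f u v + f v u = 1) ∧
      (∀ u v, ¬ G.Adj u v → f u v = 0) ∧ ∀ v, ∑ u, f u v ≤ τ := by
  obtain ⟨p, hp⟩ : ∃ p : ℕ, τ.num = p := Int.eq_ofNat_of_zero_le (Rat.num_nonneg.2 hτ)
  obtain ⟨q, hq⟩ : ∃ q : ℕ, τ.den = q := ⟨_, rfl⟩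
  have hq0 : (0 : ℚ) < q := by
    have := τ.den_pos
    rw [hq] at this
    exact_mod_cast this
  have hpq : τ = p / q := by
    rw [← Rat.num_div_den τ, hp, hq]
    simp
  have hall : ∀ S : Finset (G.edgeSet × Fin q),
      S.card ≤ (S.biUnion (fun x => (Finset.univ.filter
        (fun y : V × Fin p => y.1 ∈ x.1.1)))).card := by
    intro S
    let E' : Finset G.edgeSet := S.image Prod.fst
    let W : Finset V := Finset.univ.filter (fun v => ∃ e ∈ E', v ∈ e.1)
    have h1 : S.card ≤ E'.card * q := by
      have : S ⊆ E' ×ˢ (Finset.univ : Finset (Fin q)) := by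
        intro x hx
        simp only [Finset.mem_product, Finset.mem_univ, and_true]
        exact Finset.mem_image_of_mem _ hx
      simpa using Finset.card_le_card this
    have h2 : S.biUnion (fun x => (Finset.univ.filter
        (fun y : V × Fin p => y.1 ∈ x.1.1))) = W ×ˢ (Finset.univ : Finset (Fin p)) := by
      ext ⟨v, j⟩
      simp only [Finset.mem_biUnion, Finset.mem_filter, Finset.mem_univ, true_and,
        Finset.mem_product, and_true, W, E', Finset.mem_image]
      constructor
      · rintro ⟨x, hx, hv⟩
        exact ⟨x.1, ⟨x, hx, rfl⟩, hv⟩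
      · rintro ⟨_, ⟨x, hx, rfl⟩, hv⟩
        exact ⟨x, hx, hv⟩
    rw [h2, Finset.card_product, Finset.card_univ, Fintype.card_fin]
    refine h1.trans ?_
    let H : G.Subgraph :=
      { verts := W
        Adj := fun u v => ∃ e ∈ E', e.1 = s(u, v)
        adj_sub := by
          rintro u v ⟨e, he, h⟩
          have := e.2
          rw [h] at this
          exact this
        edge_vert := by
          rintro u v ⟨e, he, h⟩
          simp only [W, Finset.coe_filter, Finset.mem_univ, true_and, Set.mem_ofPred_eq]
          exact ⟨e, he, by rw [h]; simp⟩
        symm := ⟨by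
          rintro u v ⟨e, he, h⟩
          exact ⟨e, he, by rw [h, Sym2.eq_swap]⟩⟩ }
    have hE : H.edgeSet.ncard = E'.card := by
      have : H.edgeSet = ((E'.image Subtype.val : Finset (Sym2 V)) : Set (Sym2 V)) := by
        ext e
        induction e with | _ u v
        simp only [SimpleGraph.Subgraph.mem_edgeSet, Finset.coe_image, Set.mem_image,
          Finset.mem_coe, H]
      rw [this, Set.ncard_coe_finset, Finset.card_image_of_injective _ Subtype.val_injective]
    have hV : H.verts.ncard = W.card := Set.ncard_coe_finset W
    have hd := hH H
    unfold SimpleGraph.subDensity at hd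
    rw [hE, hV, hpq] at hd
    rcases Nat.eq_zero_or_pos W.card with h0 | h0
    · have : E' = ∅ := by
        rw [Finset.card_eq_zero] at h0
        rw [Finset.eq_empty_iff_forall_notMem]
        intro e he
        obtain ⟨a, ha⟩ : ∃ a, a ∈ e.1 := by
          rcases e with ⟨e, h⟩
          induction e with | _ u v
          exact ⟨u, Sym2.mem_mk_left u v⟩
        have : a ∈ W := by
          simp only [W, Finset.mem_filter, Finset.mem_univ, true_and]
          exact ⟨e, he, ha⟩
        rw [h0] at this
        exact absurd this (Finset.notMem_empty a)
      rw [this, Finset.card_empty, Nat.zero_mul]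
      exact Nat.zero_le _
    · have h0' : (0 : ℚ) < W.card := by exact_mod_cast h0
      rw [div_le_div_iff₀ h0' hq0] at hd
      have : E'.card * q ≤ p * W.card := by exact_mod_cast hd
      linarith
  obtain ⟨g, ginj, hg⟩ := (Finset.all_card_le_biUnion_card_iff_exists_injective _).1 hall
  let C : V → V → Finset (Fin q) := fun u v =>
    Finset.univ.filter (fun i => ∃ (h : s(u, v) ∈ G.edgeSet) (j : Fin p),
      g (⟨s(u, v), h⟩, i) = (v, j))
  refine ⟨fun u v => ((C u v).card : ℚ) / q, fun u v => div_nonneg (Nat.cast_nonneg _) hq0.le, ?_, ?_, ?_⟩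
  · intro u v huv
    have hu : C u v ∪ C v u = Finset.univ := by
      ext i
      simp only [C, Finset.mem_union, Finset.mem_filter, Finset.mem_univ, true_and, iff_true]
      have := hg (⟨s(u, v), huv⟩, i)
      simp only [Finset.mem_filter, Finset.mem_univ, true_and, Sym2.mem_iff] at this
      rcases this with h | h
      · right
        refine ⟨huv.symm, (g (⟨s(u, v), huv⟩, i)).2, ?_⟩
        have e : (⟨s(v, u), huv.symm⟩ : G.edgeSet) = ⟨s(u, v), huv⟩ :=
          Subtype.ext Sym2.eq_swap
        rw [e]
        exact Prod.ext h rfl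
      · left
        exact ⟨huv, (g (⟨s(u, v), huv⟩, i)).2, Prod.ext h rfl⟩
    have hd : Disjoint (C u v) (C v u) := by
      rw [Finset.disjoint_left]
      intro i h1 h2
      simp only [C, Finset.mem_filter, Finset.mem_univ, true_and] at h1 h2
      obtain ⟨h, j, hj⟩ := h1
      obtain ⟨h', j', hj'⟩ := h2
      have e : (⟨s(v, u), h'⟩ : G.edgeSet) = ⟨s(u, v), h⟩ := Subtype.ext Sym2.eq_swap
      rw [e, hj] at hj'
      exact huv.ne (congrArg Prod.fst hj').symm
    have hc := Finset.card_union_of_disjoint hd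
    rw [hu, Finset.card_univ, Fintype.card_fin] at hc
    rw [← add_div, div_eq_one_iff_eq hq0.ne']
    exact_mod_cast hc.symm
  · intro u v huv
    have : C u v = ∅ := by
      rw [Finset.eq_empty_iff_forall_notMem]
      intro i hi
      simp only [C, Finset.mem_filter, Finset.mem_univ, true_and] at hi
      exact huv hi.1
    simp [this]
  · intro v
    rw [← Finset.sum_div, hpq]
    gcongr
    have : ((Finset.univ : Finset V).sigma (fun u => C u v)).card ≤
        (Finset.univ : Finset (Fin p)).card := by
      refine Finset.card_le_card_of_forall_subsingleton
        (fun x j => ∃ h : s(x.1, v) ∈ G.edgeSet, g (⟨s(x.1, v), h⟩, x.2) = (v, j)) ?_ ?_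
      · rintro ⟨u, i⟩ hx
        simp only [C, Finset.mem_sigma, Finset.mem_filter, Finset.mem_univ, true_and] at hx
        obtain ⟨h, j, hj⟩ := hx
        exact ⟨j, Finset.mem_univ _, h, hj⟩
      · rintro j - ⟨u, i⟩ ⟨-, h, hj⟩ ⟨u', i'⟩ ⟨-, h', hj'⟩
        have := ginj (hj.trans hj'.symm)
        simp only [Prod.mk.injEq, Subtype.mk.injEq] at this
        obtain ⟨a, b⟩ := this
        have := Sym2.congr_left.1 a
        change u = u' at this
        change i = i' at b
        subst this
        subst b
        rfl
    rw [Finset.card_sigma, Finset.card_univ, Fintype.card_fin] at this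
    exact_mod_cast this

theorem aux_density {V : Type*} [Fintype V] (G : SimpleGraph V) (τ : ℚ) (hτ : 0 ≤ τ)
    (f : V → V → ℚ) (h1 : ∀ u v, G.Adj u v → f u v + f v u = 1)
    (H : G.Subgraph)
    (h3 : ∀ v, (∑ u ∈ Finset.univ.filter (fun u => H.Adj u v), f u v) ≤ τ) :
    G.subDensity H ≤ τ := by
  unfold SimpleGraph.subDensity
  refine div_le_of_le_mul₀ (by positivity) hτ ?_
  have hE : H.edgeSet.ncard = H.spanningCoe.edgeFinset.card := by
    rw [← Set.ncard_coe_finset]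
    simp
  have hs := H.spanningCoe.sum_degrees_eq_twice_card_edges
  have hdeg : ∀ v, H.spanningCoe.degree v = (Finset.univ.filter (fun u => H.Adj u v)).card := by
    intro v
    rw [← SimpleGraph.card_neighborFinset_eq_degree]
    congr 1
    ext u
    simp [H.adj_comm]
  have hV : H.verts.ncard = (Finset.univ.filter (fun v => v ∈ H.verts)).card := by
    rw [← Set.ncard_coe_finset]
    simp
  have hb : ∑ v, ∑ u ∈ Finset.univ.filter (fun u => H.Adj u v), f u v
      ≤ τ * H.verts.ncard := by
    have : ∀ v, ∑ u ∈ Finset.univ.filter (fun u => H.Adj u v), f u v ≤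
        if v ∈ H.verts then τ else 0 := by
      intro v
      split_ifs with hv
      · exact h3 v
      · apply le_of_eq
        apply Finset.sum_eq_zero
        intro u hu
        exact absurd (H.edge_vert (Finset.mem_filter.1 hu).2.symm) hv
    refine (Finset.sum_le_sum (fun v _ => this v)).trans ?_
    rw [← Finset.sum_filter, Finset.sum_const, nsmul_eq_mul, hV, mul_comm]
  have hsw : ∑ v, ∑ u ∈ Finset.univ.filter (fun u => H.Adj u v), f u v =
      ∑ v, ∑ u ∈ Finset.univ.filter (fun u => H.Adj u v), f v u := by
    simp only [Finset.sum_filter]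
    rw [Finset.sum_comm]
    simp only [H.adj_comm]
  have hone : ∑ v, ∑ u ∈ Finset.univ.filter (fun u => H.Adj u v), (f u v + f v u) =
      ∑ v, (H.spanningCoe.degree v : ℚ) := by
    refine Finset.sum_congr rfl (fun v _ => ?_)
    rw [hdeg, Finset.card_eq_sum_ones]
    push_cast
    exact Finset.sum_congr rfl (fun u hu => h1 u v (H.adj_sub (Finset.mem_filter.1 hu).2))
  simp only [Finset.sum_add_distrib] at hone
  rw [← hsw, ← Nat.cast_sum, hs, ← hE] at hone
  push_cast at hone
  linarith

/-- Equivalence between the flow-like formulation and `τ`-Bounded-Density Edge Deletion: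
for a finite simple graph `G` with `m` edges, rational `τ ≥ 0` and `k ∈ ℕ`, there is a
nonnegative assignment `f` on incident edge–vertex pairs with `f(e,u) + f(e,v) ∈ {0,1}`
for every edge `e = {u,v}`, total at most `τ` at every vertex, and at least `m − k` edges
of total `1`, iff there is an edge set `F ⊆ E(G)` with `|F| ≤ k` and `ρ*(G − F) ≤ τ`. -/
theorem flow_iff_boundedDensityEdgeDeletion {V : Type*} [Fintype V] [DecidableEq V]
    (G : SimpleGraph V) [DecidableRel G.Adj] (τ : ℚ) (hτ : 0 ≤ τ) (k : ℕ) :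
    (∃ f : V → V → ℚ,
      (∀ u v, G.Adj u v → 0 ≤ f u v) ∧
      (∀ u v, G.Adj u v → (f u v + f v u = 0 ∨ f u v + f v u = 1)) ∧
      (∀ v, (∑ u ∈ G.neighborFinset v, f u v) ≤ τ) ∧
      G.edgeFinset.card ≤
        (G.edgeFinset.filter (fun e => ∃ u v, e = s(u, v) ∧ f u v + f v u = 1)).card + k) ↔
    (∃ F : Finset (Sym2 V), ↑F ⊆ G.edgeSet ∧ F.card ≤ k ∧
      ∀ H : (G.deleteEdges ↑F).Subgraph, (G.deleteEdges ↑F).subDensity H ≤ τ) := by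
  constructor
  · rintro ⟨f, h0, h1, h2, h3⟩
    set A := G.edgeFinset.filter (fun e => ∃ u v, e = s(u, v) ∧ f u v + f v u = 1) with hA
    have hAs : A ⊆ G.edgeFinset := Finset.filter_subset _ _
    refine ⟨G.edgeFinset \ A, ?_, ?_, ?_⟩
    · intro e he
      exact SimpleGraph.mem_edgeFinset.1 (Finset.mem_sdiff.1 (Finset.mem_coe.1 he)).1
    · rw [Finset.card_sdiff_of_subset hAs]
      omega
    · intro H
      refine aux_density _ τ hτ f ?_ H ?_
      · intro u v huv
        rw [SimpleGraph.deleteEdges_adj] at huv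
        obtain ⟨ha, hn⟩ := huv
        have hm : s(u, v) ∈ A := by
          by_contra hc
          exact hn (Finset.mem_coe.2 (Finset.mem_sdiff.2 ⟨SimpleGraph.mem_edgeFinset.2 ha, hc⟩))
        obtain ⟨a, b, hab, hs⟩ := (Finset.mem_filter.1 hm).2
        rcases Sym2.eq_iff.1 hab with ⟨rfl, rfl⟩ | ⟨rfl, rfl⟩
        · exact hs
        · rw [add_comm]; exact hs
      · intro v
        refine le_trans (Finset.sum_le_sum_of_subset_of_nonneg ?_ ?_) (h2 v)
        · intro u hu
          rw [SimpleGraph.mem_neighborFinset]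
          have := H.adj_sub (Finset.mem_filter.1 hu).2
          rw [SimpleGraph.deleteEdges_adj] at this
          exact this.1.symm
        · intro u hu _
          exact h0 u v ((SimpleGraph.mem_neighborFinset _ _ _).1 hu).symm
  · rintro ⟨F, hF, hk, hH⟩
    obtain ⟨f, h0, h1, h2, h3⟩ := aux_flow _ τ hτ hH
    refine ⟨f, fun u v _ => h0 u v, ?_, ?_, ?_⟩
    · intro u v _
      by_cases h : (G.deleteEdges ↑F).Adj u v
      · exact Or.inr (h1 u v h)
      · left
        rw [h2 u v h, h2 v u (fun h' => h h'.symm), add_zero]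
    · intro v
      exact (Finset.sum_le_sum_of_subset_of_nonneg (Finset.subset_univ _)
        (fun u _ _ => h0 u v)).trans (h3 v)
    · refine le_trans (Finset.card_le_card (t := G.edgeFinset.filter
        (fun e => ∃ u v, e = s(u, v) ∧ f u v + f v u = 1) ∪ F) ?_)
        ((Finset.card_union_le _ _).trans (by omega))
      intro e he
      by_cases heF : e ∈ F
      · exact Finset.mem_union_right _ heF
      · apply Finset.mem_union_left
        refine Finset.mem_filter.2 ⟨he, ?_⟩
        induction e with | _ u v
        refine ⟨u, v, rfl, h1 u v ?_⟩
        rw [SimpleGraph.deleteEdges_adj]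
        exact ⟨SimpleGraph.mem_edgeFinset.1 he, heF⟩
end

section
/- Let (D, c, B) be a 2-layered transshipment instance in which every capacity c(a) is a natural number and, for every vertex v, the set B_v either is a set of integers or is the interval [c_v, d_v] of all rationals between two integers c_v ≤ d_v. If (D, c, B) admits a B-transshipment, then it admits an integral B-transshipment f* such that val(f*) ≥ val(f) for every B-transshipment f of (D, c, B). -/
open scoped Classical

/-- A 2-layered transshipment instance: a finite digraph whose vertices are partitioned
into parts `υ` (sources) and `ω` (sinks), with all arcs going from `υ` to `ω`, nonnegative
rational arc capacities, and allowed-excess sets `BU u ⊆ ℚ≥0` for `u ∈ υ` and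
`BW w ⊆ ℚ≤0` for `w ∈ ω`. -/
structure TwoLayer (υ ω : Type*) [Fintype υ] [Fintype ω] where
  arcs : Finset (υ × ω)
  cap : υ × ω → ℚ
  cap_nonneg : ∀ a, 0 ≤ cap a
  BU : υ → Set ℚ
  BW : ω → Set ℚ
  BU_nonneg : ∀ u, ∀ x ∈ BU u, 0 ≤ x
  BW_nonpos : ∀ w, ∀ x ∈ BW w, x ≤ 0

variable {υ ω : Type*} [Fintype υ] [Fintype ω]

/-- `f` is a `B`-transshipment of the 2-layered instance `I`: it is a nonnegative,
capacity-respecting assignment supported on the arcs of `I`, whose excess at every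
`u ∈ υ` lies in `BU u` and whose excess at every `w ∈ ω` lies in `BW w`. -/
def TwoLayer.IsTrans (I : TwoLayer υ ω) (f : υ × ω → ℚ) : Prop :=
  (∀ a ∈ I.arcs, 0 ≤ f a ∧ f a ≤ I.cap a) ∧
  (∀ a ∉ I.arcs, f a = 0) ∧
  (∀ u : υ, (∑ w ∈ Finset.univ.filter (fun w => (u, w) ∈ I.arcs), f (u, w)) ∈ I.BU u) ∧
  (∀ w : ω, (-∑ u ∈ Finset.univ.filter (fun u => (u, w) ∈ I.arcs), f (u, w)) ∈ I.BW w)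

/-- The value of a transshipment: the total flow over all arcs. -/
def TwoLayer.val (I : TwoLayer υ ω) (f : υ × ω → ℚ) : ℚ :=
  ∑ a ∈ I.arcs, f a

theorem ax_key {α β : Type*} [Fintype α] [Fintype β] (F : Finset (α × β)) (hF : F.Nonempty)
    (TU : Finset α) (TW : Finset β)
    (hU : ∀ u ∈ TU, 2 ≤ (F.filter (fun a => a.1 = u)).card)
    (hW : ∀ w ∈ TW, 2 ≤ (F.filter (fun a => a.2 = w)).card) :
    ∃ h : α × β → ℚ, h ≠ 0 ∧ (∀ a, a ∉ F → h a = 0) ∧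
      (∀ u ∈ TU, ∑ w, h (u, w) = 0) ∧ (∀ w ∈ TW, ∑ u, h (u, w) = 0) := by
  by_contra hno
  let E : (F → ℚ) →ₗ[ℚ] (α × β → ℚ) := Function.ExtendByZero.linearMap ℚ Subtype.val
  have hE0 : ∀ x a, a ∉ F → E x a = 0 := by
    intro x a ha
    show Function.extend Subtype.val x 0 a = 0
    rw [Function.extend_apply']
    · rfl
    · rintro ⟨b, rfl⟩; exact ha b.2
  have hE1 : ∀ x (a : F), E x a = x a := by
    intro x a
    show Function.extend Subtype.val x 0 a.1 = x a
    exact Subtype.val_injective.extend_apply _ _ _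
  let L : (F → ℚ) →ₗ[ℚ] (TU ⊕ TW → ℚ) :=
    { toFun := fun x => Sum.elim (fun u => ∑ w, E x (u.1, w)) (fun w => ∑ u, E x (u, w.1))
      map_add' := by
        intro x y
        ext (i | i) <;> simp [Finset.sum_add_distrib]
      map_smul' := by
        intro r x
        ext (i | i) <;> simp [Finset.mul_sum] }
  have hinj : Function.Injective L := by
    rw [← LinearMap.ker_eq_bot, LinearMap.ker_eq_bot']
    intro x hx
    by_contra hx0
    apply hno
    refine ⟨E x, ?_, hE0 x, ?_, ?_⟩
    · intro h0
      apply hx0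
      ext a
      rw [← hE1 x a, h0]; rfl
    · intro u hu
      exact congrFun hx (Sum.inl ⟨u, hu⟩)
    · intro w hw
      exact congrFun hx (Sum.inr ⟨w, hw⟩)
  have hle := LinearMap.finrank_le_finrank_of_injective hinj
  simp only [Module.finrank_fintype_fun_eq_card, Fintype.card_sum, Fintype.card_coe] at hle
  have c1 : 2 * TU.card ≤ (F.filter (fun a => a.1 ∈ TU)).card := by
    rw [Finset.card_eq_sum_card_fiberwise (f := Prod.fst) (t := TU)
      (by intro a ha; simpa using (Finset.mem_filter.1 ha).2)]
    rw [mul_comm, ← smul_eq_mul]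
    apply Finset.card_nsmul_le_sum
    intro u hu
    refine (hU u hu).trans (Finset.card_le_card ?_)
    intro a ha
    simp only [Finset.mem_filter] at ha ⊢
    exact ⟨⟨ha.1, ha.2 ▸ hu⟩, ha.2⟩
  have c2 : 2 * TW.card ≤ (F.filter (fun a => a.2 ∈ TW)).card := by
    rw [Finset.card_eq_sum_card_fiberwise (f := Prod.snd) (t := TW)
      (by intro a ha; simpa using (Finset.mem_filter.1 ha).2)]
    rw [mul_comm, ← smul_eq_mul]
    apply Finset.card_nsmul_le_sum
    intro u hu
    refine (hW u hu).trans (Finset.card_le_card ?_)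
    intro a ha
    simp only [Finset.mem_filter] at ha ⊢
    exact ⟨⟨ha.1, ha.2 ▸ hu⟩, ha.2⟩
  have d1 := Finset.card_filter_le F (fun a => a.1 ∈ TU)
  have d2 := Finset.card_filter_le F (fun a => a.2 ∈ TW)
  have e1 : F.filter (fun a => a.1 ∈ TU) = F :=
    Finset.eq_of_subset_of_card_le (Finset.filter_subset _ _) (by omega)
  have e2 : F.filter (fun a => a.2 ∈ TW) = F :=
    Finset.eq_of_subset_of_card_le (Finset.filter_subset _ _) (by omega)
  rw [Finset.filter_eq_self] at e1 e2
  have hsurj : Function.Surjective L := by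
    rw [← LinearMap.injective_iff_surjective_of_finrank_eq_finrank]
    · exact hinj
    · simp only [Module.finrank_fintype_fun_eq_card, Fintype.card_sum, Fintype.card_coe]
      omega
  obtain ⟨x, hx⟩ := hsurj (Sum.elim (fun _ => 1) (fun _ => 0))
  have s1 : ∑ u, ∑ w, E x (u, w) = TU.card := by
    rw [← Finset.sum_subset (Finset.subset_univ TU)]
    · rw [Finset.sum_congr rfl (g := fun _ => (1 : ℚ))]
      · simp
      · intro u hu
        exact congrFun hx (Sum.inl ⟨u, hu⟩)
    · intro u _ hu
      apply Finset.sum_eq_zero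
      intro w _
      exact hE0 x _ (fun hh => hu (e1 _ hh))
  have s2 : ∑ w, ∑ u, E x (u, w) = 0 := by
    apply Finset.sum_eq_zero
    intro w _
    by_cases hw : w ∈ TW
    · exact congrFun hx (Sum.inr ⟨w, hw⟩)
    · apply Finset.sum_eq_zero
      intro u _
      exact hE0 x _ (fun hh => hw (e2 _ hh))
  rw [Finset.sum_comm, s2] at s1
  obtain ⟨a, ha⟩ := hF
  have := e1 _ ha
  have h0 : TU.card = 0 := by exact_mod_cast s1.symm
  rw [Finset.card_eq_zero] at h0
  simp [h0] at this

/-- The move to the boundary. -/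
theorem ax_move {ι : Type*} [Fintype ι] (x s : ι → ℚ)
    (hs : ∀ i, (∃ z : ℤ, x i = z) → s i = 0) (hne : ∃ i, s i ≠ 0) :
    ∃ t : ℚ, 0 ≤ t ∧ (∀ i, (⌊x i⌋ : ℚ) ≤ x i + t * s i ∧ x i + t * s i ≤ ⌈x i⌉) ∧
      ∃ i, (¬ ∃ z : ℤ, x i = z) ∧ ∃ z : ℤ, x i + t * s i = z := by
  let T : ι → ℚ := fun i => if 0 < s i then (⌈x i⌉ - x i) / s i else (⌊x i⌋ - x i) / s i
  obtain ⟨j, hj, hmin⟩ := Finset.exists_min_image (Finset.univ.filter (fun i => s i ≠ 0)) T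
    (by obtain ⟨i, hi⟩ := hne; exact ⟨i, by simpa using hi⟩)
  have hj : s j ≠ 0 := by simpa using hj
  have hT : ∀ i, 0 ≤ T i := by
    intro i
    have h1 := Int.floor_le (x i)
    have h2 := Int.le_ceil (x i)
    simp only [T]
    split_ifs with h
    · exact div_nonneg (by linarith) h.le
    · exact div_nonneg_of_nonpos (by linarith) (by linarith)
  refine ⟨T j, hT j, ?_, j, fun h => hj (hs j h), ?_⟩
  · intro i
    have h1 := Int.floor_le (x i)
    have h2 := Int.le_ceil (x i)
    rcases lt_trichotomy (s i) 0 with h | h | h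
    · have hm := hmin i (by simpa using h.ne)
      have h3 : T i * s i = ⌊x i⌋ - x i := by
        simp only [T, if_neg h.not_gt]; exact div_mul_cancel₀ _ h.ne
      have h4 : T j * s i ≤ 0 := mul_nonpos_of_nonneg_of_nonpos (hT j) h.le
      have h5 : T i * s i ≤ T j * s i := mul_le_mul_of_nonpos_right hm h.le
      constructor <;> linarith
    · rw [h]; constructor <;> linarith
    · have hm := hmin i (by simpa using h.ne')
      have h3 : T i * s i = ⌈x i⌉ - x i := by
        simp only [T, if_pos h]; field_simp
      have h4 : 0 ≤ T j * s i := mul_nonneg (hT j) h.le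
      have h5 : T j * s i ≤ T i * s i := mul_le_mul_of_nonneg_right hm h.le
      constructor <;> linarith
  · by_cases h : 0 < s j
    · refine ⟨⌈x j⌉, ?_⟩
      simp only [T, if_pos h]; field_simp; ring
    · refine ⟨⌊x j⌋, ?_⟩
      simp only [T, if_neg h]; field_simp; ring

/-- Arc values, row sums and column sums. -/
def axX {α β : Type*} [Fintype α] [Fintype β] (f : α × β → ℚ) : (α × β) ⊕ (α ⊕ β) → ℚ :=
  Sum.elim f (Sum.elim (fun u => ∑ w, f (u, w)) (fun w => ∑ u, f (u, w)))

theorem ax_int_sum {ι : Type*} (s : Finset ι) (x : ι → ℚ) (h : ∀ i ∈ s, ∃ z : ℤ, x i = z) :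
    ∃ z : ℤ, ∑ i ∈ s, x i = z := by
  refine ⟨∑ i ∈ s, ⌊x i⌋, ?_⟩
  push_cast
  apply Finset.sum_congr rfl
  intro i hi
  obtain ⟨z, hz⟩ := h i hi
  rw [hz]; simp

/-- An integral sum with a nonintegral term has another one. -/
theorem ax_two {ι : Type*} [Fintype ι] (x : ι → ℚ) (hsum : ∃ z : ℤ, ∑ i, x i = z)
    (i : ι) (hi : ¬ ∃ z : ℤ, x i = z) : ∃ j, j ≠ i ∧ ¬ ∃ z : ℤ, x j = z := by
  by_contra hno
  push Not at hno
  obtain ⟨z, hz⟩ := hsum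
  obtain ⟨y, hy⟩ := ax_int_sum (Finset.univ.erase i) x
    (fun j hj => hno j (Finset.ne_of_mem_erase hj))
  apply hi
  refine ⟨z - y, ?_⟩
  rw [← Finset.add_sum_erase _ _ (Finset.mem_univ i)] at hz
  push_cast
  linarith

theorem ax_round {α β : Type*} [Fintype α] [Fintype β] (n : ℕ) : ∀ f : α × β → ℚ,
    (Finset.univ.filter (fun i => ¬ ∃ z : ℤ, axX f i = z)).card = n →
    ∃ g : α × β → ℚ, (∀ a, ∃ z : ℤ, g a = z) ∧
      (∀ i, (⌊axX f i⌋ : ℚ) ≤ axX g i ∧ axX g i ≤ ⌈axX f i⌉) ∧ ∑ a, f a ≤ ∑ a, g a := by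
  induction n using Nat.strong_induction_on with
  | _ n ih =>
  intro f hn
  let F := Finset.univ.filter (fun a => ¬ ∃ z : ℤ, f a = z)
  have hFm : ∀ a, a ∈ F ↔ ¬ ∃ z : ℤ, f a = z := by intro a; simp [F]
  by_cases hF : F.Nonempty
  swap
  · refine ⟨f, ?_, fun i => ⟨Int.floor_le _, Int.le_ceil _⟩, le_rfl⟩
    intro a
    by_contra h
    exact hF ⟨a, (hFm a).2 h⟩
  let TU := Finset.univ.filter
    (fun u => (∃ z : ℤ, ∑ w, f (u, w) = z) ∧ ∃ w, (u, w) ∈ F)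
  let TW := Finset.univ.filter
    (fun w => (∃ z : ℤ, ∑ u, f (u, w) = z) ∧ ∃ u, (u, w) ∈ F)
  have key : ∃ h : α × β → ℚ, h ≠ 0 ∧ (∀ a, a ∉ F → h a = 0) ∧
      (∀ u ∈ TU, ∑ w, h (u, w) = 0) ∧ (∀ w ∈ TW, ∑ u, h (u, w) = 0) := by
    apply ax_key F hF
    · intro u hu
      obtain ⟨hz, w, hw⟩ := (Finset.mem_filter.1 hu).2
      obtain ⟨w', hne, hw'⟩ := ax_two (fun w => f (u, w)) hz w ((hFm _).1 hw)
      have : 1 < (F.filter (fun a => a.1 = u)).card := by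
        rw [Finset.one_lt_card]
        refine ⟨(u, w), by simp [hw], (u, w'), ?_, ?_⟩
        · rw [Finset.mem_filter]; exact ⟨(hFm _).2 hw', rfl⟩
        · intro h; exact hne (Prod.ext_iff.1 h).2.symm
      exact this
    · intro w hw
      obtain ⟨hz, u, hu⟩ := (Finset.mem_filter.1 hw).2
      obtain ⟨u', hne, hu'⟩ := ax_two (fun u => f (u, w)) hz u ((hFm _).1 hu)
      have : 1 < (F.filter (fun a => a.2 = w)).card := by
        rw [Finset.one_lt_card]
        refine ⟨(u, w), by simp [hu], (u', w), ?_, ?_⟩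
        · rw [Finset.mem_filter]; exact ⟨(hFm _).2 hu', rfl⟩
        · intro h; exact hne (Prod.ext_iff.1 h).1.symm
      exact this
  have key2 : ∃ h : α × β → ℚ, h ≠ 0 ∧ (∀ a, a ∉ F → h a = 0) ∧
      (∀ u ∈ TU, ∑ w, h (u, w) = 0) ∧ (∀ w ∈ TW, ∑ u, h (u, w) = 0) ∧ 0 ≤ ∑ a, h a := by
    obtain ⟨h, h0, h1, h2, h3⟩ := key
    rcases le_total 0 (∑ a, h a) with hh | hh
    · exact ⟨h, h0, h1, h2, h3, hh⟩
    · refine ⟨-h, by simpa using h0, ?_, ?_, ?_, ?_⟩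
      · intro a ha; simp [h1 a ha]
      · intro a ha; simp [h2 a ha]
      · intro a ha; simp [h3 a ha]
      · simpa using hh
  obtain ⟨h, h0, h1, h2, h3, hpos⟩ := key2
  have hs : ∀ i, (∃ z : ℤ, axX f i = z) → axX h i = 0 := by
    rintro (a | u | w) hz
    · exact h1 a (fun ha => (hFm a).1 ha hz)
    · by_cases hu : ∃ w, (u, w) ∈ F
      · exact h2 u (Finset.mem_filter.2 ⟨Finset.mem_univ _, hz, hu⟩)
      · exact Finset.sum_eq_zero (fun w _ => h1 _ (fun hh => hu ⟨w, hh⟩))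
    · by_cases hu : ∃ u, (u, w) ∈ F
      · exact h3 w (Finset.mem_filter.2 ⟨Finset.mem_univ _, hz, hu⟩)
      · exact Finset.sum_eq_zero (fun u _ => h1 _ (fun hh => hu ⟨u, hh⟩))
  obtain ⟨a, ha⟩ := Function.ne_iff.1 h0
  obtain ⟨t, ht, hb, j, hj1, hj2⟩ := ax_move (axX f) (axX h) hs ⟨Sum.inl a, ha⟩
  let f' : α × β → ℚ := fun a => f a + t * h a
  have hX : ∀ i, axX f' i = axX f i + t * axX h i := by
    rintro (a | u | w) <;> simp [axX, f', Finset.sum_add_distrib, Finset.mul_sum]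
  obtain ⟨g, g1, g2, g3⟩ := ih _ (by
    rw [← hn]
    apply Finset.card_lt_card (t := Finset.univ.filter (fun i => ¬ ∃ z : ℤ, axX f i = z))
    rw [Finset.ssubset_iff_of_subset]
    · refine ⟨j, by simpa using hj1, ?_⟩
      rw [Finset.mem_filter, hX]
      exact fun hh => hh.2 hj2
    · intro i hi
      rw [Finset.mem_filter] at hi ⊢
      refine ⟨hi.1, fun hz => hi.2 ?_⟩
      rw [hX, hs i hz]
      simpa using hz) f' rfl
  refine ⟨g, g1, ?_, ?_⟩
  · intro i
    have hbi := hb i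
    rw [← hX] at hbi
    constructor
    · refine le_trans ?_ (g2 i).1
      exact_mod_cast Int.le_floor.2 hbi.1
    · refine le_trans (g2 i).2 ?_
      exact_mod_cast Int.ceil_le.2 hbi.2
  · refine le_trans ?_ g3
    simp only [f', Finset.sum_add_distrib, ← Finset.mul_sum]
    have := mul_nonneg ht hpos
    linarith

theorem ax_mem (B : Set ℚ) (hB : (∀ x ∈ B, ∃ z : ℤ, x = z) ∨
      ∃ c d : ℤ, c ≤ d ∧ B = {x : ℚ | (c : ℚ) ≤ x ∧ x ≤ (d : ℚ)}) (x y : ℚ) (hx : x ∈ B)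
    (h1 : (⌊x⌋ : ℚ) ≤ y) (h2 : y ≤ ⌈x⌉) : y ∈ B := by
  rcases hB with hB | ⟨c, d, -, rfl⟩
  · obtain ⟨z, rfl⟩ := hB x hx
    simp at h1 h2
    rwa [le_antisymm h2 h1]
  · obtain ⟨hc, hd⟩ := hx
    constructor
    · refine le_trans ?_ h1
      exact_mod_cast Int.le_floor.2 hc
    · refine le_trans h2 ?_
      exact_mod_cast Int.ceil_le.2 hd

theorem ax_val {υ ω : Type*} [Fintype υ] [Fintype ω] (I : TwoLayer υ ω) (f : υ × ω → ℚ)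
    (hf : ∀ a ∉ I.arcs, f a = 0) :
    I.val f = ∑ a, f a ∧
    (∀ u, ∑ w ∈ Finset.univ.filter (fun w => (u, w) ∈ I.arcs), f (u, w) = ∑ w, f (u, w)) ∧
    (∀ w, ∑ u ∈ Finset.univ.filter (fun u => (u, w) ∈ I.arcs), f (u, w) = ∑ u, f (u, w)) := by
  refine ⟨?_, ?_, ?_⟩
  · exact Finset.sum_subset (Finset.subset_univ _) (fun a _ ha => hf a ha)
  · intro u
    exact Finset.sum_subset (Finset.subset_univ _) (fun a _ ha => hf _ (by simpa using ha))
  · intro u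
    exact Finset.sum_subset (Finset.subset_univ _) (fun a _ ha => hf _ (by simpa using ha))

theorem ax_step {υ ω : Type*} [Fintype υ] [Fintype ω] (I : TwoLayer υ ω)
    (hcap : ∀ a, ∃ n : ℕ, I.cap a = n)
    (hBU : ∀ u, (∀ x ∈ I.BU u, ∃ z : ℤ, x = z) ∨
      ∃ c d : ℤ, c ≤ d ∧ I.BU u = {x : ℚ | (c : ℚ) ≤ x ∧ x ≤ (d : ℚ)})
    (hBW : ∀ w, (∀ x ∈ I.BW w, ∃ z : ℤ, x = z) ∨
      ∃ c d : ℤ, c ≤ d ∧ I.BW w = {x : ℚ | (c : ℚ) ≤ x ∧ x ≤ (d : ℚ)})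
    (f : υ × ω → ℚ) (hf : I.IsTrans f) :
    ∃ g : υ × ω → ℚ, I.IsTrans g ∧ (∀ a, ∃ z : ℤ, g a = z) ∧ I.val f ≤ I.val g := by
  obtain ⟨f1, f2, f3, f4⟩ := hf
  obtain ⟨fv, fu, fw⟩ := ax_val I f f2
  obtain ⟨g, g1, g2, g3⟩ := ax_round _ f rfl
  have hg0 : ∀ a ∉ I.arcs, g a = 0 := by
    intro a ha
    have h := g2 (Sum.inl a)
    simp only [axX, Sum.elim_inl, f2 a ha, Int.floor_zero, Int.ceil_zero, Int.cast_zero] at h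
    exact le_antisymm h.2 h.1
  obtain ⟨gv, gu, gw⟩ := ax_val I g hg0
  refine ⟨g, ⟨?_, hg0, ?_, ?_⟩, g1, by rw [fv, gv]; exact g3⟩
  · intro a ha
    have h := g2 (Sum.inl a)
    simp only [axX, Sum.elim_inl] at h
    obtain ⟨n, hn⟩ := hcap a
    have := f1 a ha
    rw [hn] at this ⊢
    constructor
    · refine le_trans ?_ h.1
      exact_mod_cast Int.floor_nonneg.2 this.1
    · refine le_trans h.2 ?_
      have h5 : ⌈f a⌉ ≤ (n : ℤ) := Int.ceil_le.2 (by exact_mod_cast this.2)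
      exact_mod_cast h5
  · intro u
    have h := g2 (Sum.inr (Sum.inl u))
    have h3 := f3 u
    rw [fu] at h3
    rw [gu]
    exact ax_mem _ (hBU u) _ _ h3 h.1 h.2
  · intro w
    have h := g2 (Sum.inr (Sum.inr w))
    simp only [axX, Sum.elim_inr] at h
    have h3 := f4 w
    rw [fw] at h3
    rw [gw]
    refine ax_mem _ (hBW w) _ _ h3 ?_ ?_
    · rw [Int.floor_neg]; push_cast; linarith [h.2]
    · rw [Int.ceil_neg]; push_cast; linarith [h.1]

/-- If a 2-layered instance has natural-number capacities and every excess set is either a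
set of integers or the interval of rationals between two integers `c ≤ d`, then the
existence of a transshipment implies the existence of an integral maximum transshipment. -/
theorem exists_integral_maximum_transshipment (I : TwoLayer υ ω)
    (hcap : ∀ a, ∃ n : ℕ, I.cap a = n)
    (hBU : ∀ u, (∀ x ∈ I.BU u, ∃ z : ℤ, x = z) ∨
      ∃ c d : ℤ, c ≤ d ∧ I.BU u = {x : ℚ | (c : ℚ) ≤ x ∧ x ≤ (d : ℚ)})
    (hBW : ∀ w, (∀ x ∈ I.BW w, ∃ z : ℤ, x = z) ∨
      ∃ c d : ℤ, c ≤ d ∧ I.BW w = {x : ℚ | (c : ℚ) ≤ x ∧ x ≤ (d : ℚ)})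
    (hfeas : ∃ f, I.IsTrans f) :
    ∃ f : υ × ω → ℚ, I.IsTrans f ∧ (∀ a, ∃ z : ℤ, f a = z) ∧
      ∀ g : υ × ω → ℚ, I.IsTrans g → I.val g ≤ I.val f := by
  let P : ℤ → Prop := fun z => ∃ f : υ × ω → ℚ, I.IsTrans f ∧ (∀ a, ∃ z : ℤ, f a = z) ∧
    I.val f = z
  have hval : ∀ f : υ × ω → ℚ, (∀ a, ∃ z : ℤ, f a = z) → ∃ z : ℤ, I.val f = z :=
    fun f hf => ax_int_sum _ _ (fun a _ => hf a)
  obtain ⟨z, ⟨f, hf1, hf2, hf3⟩, hmax⟩ : ∃ ub, P ub ∧ ∀ z, P z → z ≤ ub := by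
    apply Int.exists_greatest_of_bdd
    · refine ⟨⌈∑ a ∈ I.arcs, I.cap a⌉, ?_⟩
      rintro z ⟨f, hf, -, hz⟩
      have h : I.val f ≤ ∑ a ∈ I.arcs, I.cap a :=
        Finset.sum_le_sum (fun a ha => (hf.1 a ha).2)
      rw [hz] at h
      exact_mod_cast h.trans (Int.le_ceil _)
    · obtain ⟨f, hf⟩ := hfeas
      obtain ⟨g, hg1, hg2, -⟩ := ax_step I hcap hBU hBW f hf
      obtain ⟨z, hz⟩ := hval g hg2
      exact ⟨z, g, hg1, hg2, hz⟩
  refine ⟨f, hf1, hf2, ?_⟩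
  intro g hg
  obtain ⟨g', h1, h2, h3⟩ := ax_step I hcap hBU hBW g hg
  obtain ⟨y, hy⟩ := hval g' h2
  have := hmax y ⟨g', h1, h2, hy⟩
  rw [hf3]
  refine h3.trans ?_
  rw [hy]
  exact_mod_cast this
end

section
/- Let (D, c, B) be a 2-layered transshipment instance with parts U and W, natural-number capacities, and B_v ⊆ ℤ for every vertex v. Let G be the simple graph with vertex set U ∪ W ∪ H, where H contains a vertex h^i_{uw} for every arc (u,w) ∈ A(D) and every i ∈ {1,...,c(u,w)}, and whose edges are {u, h^i_{uw}} and {h^i_{uw}, w} for all such vertices h^i_{uw}. Set B'_v = {|x| : x ∈ B_v} for every v ∈ U ∪ W and B'_h = {0, 2} for every h ∈ H. Then, for every natural number p, the instance (D, c, B) has an integral B-transshipment of value p if and only if (G, B') has a factor of size 2p. -/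
open scoped Classical

variable {υ ω : Type*} [Fintype υ] [Fintype ω]

/-- The subdivision vertices `h^i_{uw}`: one for every arc `a` of `I` and every
`i ∈ {1, …, capN a}`. -/
abbrev TwoLayer.HVert (I : TwoLayer υ ω) (capN : υ × ω → ℕ) : Type _ :=
  Σ a : {a : υ × ω // a ∈ I.arcs}, Fin (capN a.1)

/-- The general-factor graph `G` on vertex set `υ ∪ ω ∪ H`, whose edges are
`{u, h^i_{uw}}` and `{h^i_{uw}, w}` for every subdivision vertex `h^i_{uw}`. -/
def TwoLayer.factorGraph (I : TwoLayer υ ω) (capN : υ × ω → ℕ) :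
    SimpleGraph (υ ⊕ ω ⊕ I.HVert capN) :=
  SimpleGraph.fromRel (fun x y =>
    match x, y with
    | Sum.inl u, Sum.inr (Sum.inr h) => h.1.1.1 = u
    | Sum.inr (Sum.inl w), Sum.inr (Sum.inr h) => h.1.1.2 = w
    | _, _ => False)

namespace TwoLayer

/-- edge from the source to the subdivision vertex -/
def eU (I : TwoLayer υ ω) (capN : υ × ω → ℕ) (h : I.HVert capN) :
    Sym2 (υ ⊕ ω ⊕ I.HVert capN) := s(Sum.inl h.1.1.1, Sum.inr (Sum.inr h))

/-- edge from the subdivision vertex to the sink -/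
def eW (I : TwoLayer υ ω) (capN : υ × ω → ℕ) (h : I.HVert capN) :
    Sym2 (υ ⊕ ω ⊕ I.HVert capN) := s(Sum.inr (Sum.inl h.1.1.2), Sum.inr (Sum.inr h))

/-- all edges at chosen subdivision vertices -/
noncomputable def FS (I : TwoLayer υ ω) (capN : υ × ω → ℕ) (S : Finset (I.HVert capN)) :
    Finset (Sym2 (υ ⊕ ω ⊕ I.HVert capN)) := S.image (I.eU capN) ∪ S.image (I.eW capN)

/-- number of chosen copies of an arc -/
noncomputable def cnt (I : TwoLayer υ ω) (capN : υ × ω → ℕ) (S : Finset (I.HVert capN))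
    (a : υ × ω) : ℕ := (S.filter (fun h => h.1.1 = a)).card

variable (I : TwoLayer υ ω) (capN : υ × ω → ℕ)

lemma eU_inj : Function.Injective (I.eU capN) := by
  intro a b h
  simp only [eU, Sym2.eq_iff] at h
  rcases h with h | h
  · simpa using h.2
  · simp at h

lemma eW_inj : Function.Injective (I.eW capN) := by
  intro a b h
  simp only [eW, Sym2.eq_iff] at h
  rcases h with h | h
  · simpa using h.2
  · simp at h

lemma eU_ne_eW (a b : I.HVert capN) : I.eU capN a ≠ I.eW capN b := by
  intro h
  simp [eU, eW, Sym2.eq_iff] at h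

lemma mem_edge (e : Sym2 (υ ⊕ ω ⊕ I.HVert capN)) :
    e ∈ (I.factorGraph capN).edgeFinset ↔ ∃ h, e = I.eU capN h ∨ e = I.eW capN h := by
  rw [SimpleGraph.mem_edgeFinset]
  constructor
  · induction e using Sym2.ind with
    | _ x y =>
      intro h
      rw [SimpleGraph.mem_edgeSet, factorGraph, SimpleGraph.fromRel_adj] at h
      rcases x with u | w | k <;> rcases y with u' | w' | k' <;> simp at h
      · subst h; exact ⟨k', Or.inl rfl⟩
      · subst h; exact ⟨k', Or.inr rfl⟩
      · subst h; exact ⟨k, Or.inl Sym2.eq_swap⟩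
      · subst h; exact ⟨k, Or.inr Sym2.eq_swap⟩
  · rintro ⟨h, rfl | rfl⟩
    · simp [eU, factorGraph, SimpleGraph.fromRel_adj]
    · simp [eW, factorGraph, SimpleGraph.fromRel_adj]

lemma disj (S T : Finset (I.HVert capN)) :
    Disjoint (S.image (I.eU capN)) (T.image (I.eW capN)) := by
  rw [Finset.disjoint_left]
  intro e h1 h2
  obtain ⟨a, _, rfl⟩ := Finset.mem_image.1 h1
  obtain ⟨b, _, hb⟩ := Finset.mem_image.1 h2
  exact I.eU_ne_eW capN a b hb.symm

lemma FS_card (S : Finset (I.HVert capN)) : (I.FS capN S).card = 2 * S.card := by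
  rw [FS, Finset.card_union_of_disjoint (I.disj capN S S),
    Finset.card_image_of_injective _ (I.eU_inj capN),
    Finset.card_image_of_injective _ (I.eW_inj capN)]
  ring

lemma FS_filter (S : Finset (I.HVert capN)) (P : Sym2 (υ ⊕ ω ⊕ I.HVert capN) → Prop) :
    ((I.FS capN S).filter P).card = (S.filter (fun h => P (I.eU capN h))).card
      + (S.filter (fun h => P (I.eW capN h))).card := by
  rw [FS, Finset.filter_union, Finset.filter_image, Finset.filter_image,
    Finset.card_union_of_disjoint (I.disj capN _ _),
    Finset.card_image_of_injective _ (I.eU_inj capN),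
    Finset.card_image_of_injective _ (I.eW_inj capN)]

lemma FS_u (S : Finset (I.HVert capN)) (u : υ) :
    ((I.FS capN S).filter (fun e => Sum.inl u ∈ e)).card
      = ∑ w ∈ Finset.univ.filter (fun w => (u, w) ∈ I.arcs), I.cnt capN S (u, w) := by
  rw [FS_filter]
  have h2 : S.filter (fun h => Sum.inl u ∈ I.eW capN h) = ∅ := by
    ext h; simp [eW]
  rw [h2, Finset.card_empty, add_zero,
    Finset.card_eq_sum_card_fiberwise (f := fun h => h.1.1.2)
      (t := Finset.univ.filter (fun w => (u, w) ∈ I.arcs))]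
  · apply Finset.sum_congr rfl
    intro w _
    rw [cnt, Finset.filter_filter]
    congr 1
    ext h
    simp only [Finset.mem_filter, eU, Sym2.mem_iff, Prod.ext_iff]
    simp [eq_comm]
  · intro h hh
    have := h.1.2
    simp [eU] at hh ⊢
    rw [hh.2]; exact this

lemma FS_w (S : Finset (I.HVert capN)) (w : ω) :
    ((I.FS capN S).filter (fun e => Sum.inr (Sum.inl w) ∈ e)).card
      = ∑ u ∈ Finset.univ.filter (fun u => (u, w) ∈ I.arcs), I.cnt capN S (u, w) := by
  rw [FS_filter]
  have h2 : S.filter (fun h => Sum.inr (Sum.inl w) ∈ I.eU capN h) = ∅ := by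
    ext h; simp [eU]
  rw [h2, Finset.card_empty, zero_add,
    Finset.card_eq_sum_card_fiberwise (f := fun h => h.1.1.1)
      (t := Finset.univ.filter (fun u => (u, w) ∈ I.arcs))]
  · apply Finset.sum_congr rfl
    intro u _
    rw [cnt, Finset.filter_filter]
    congr 1
    ext h
    simp only [Finset.mem_filter, eW, Sym2.mem_iff, Prod.ext_iff]
    simp [eq_comm, and_comm]
  · intro h hh
    have := h.1.2
    simp [eW] at hh ⊢
    rw [hh.2]; exact this

lemma FS_h (S : Finset (I.HVert capN)) (h : I.HVert capN) :
    ((I.FS capN S).filter (fun e => Sum.inr (Sum.inr h) ∈ e)).card = 0 ∨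
    ((I.FS capN S).filter (fun e => Sum.inr (Sum.inr h) ∈ e)).card = 2 := by
  rw [FS_filter]
  have h1 : S.filter (fun k => Sum.inr (Sum.inr h) ∈ I.eU capN k) = S.filter (fun k => h = k) := by
    ext k; simp [eU]
  have h2 : S.filter (fun k => Sum.inr (Sum.inr h) ∈ I.eW capN k) = S.filter (fun k => h = k) := by
    ext k; simp [eW]
  rw [h1, h2, Finset.filter_eq]
  split_ifs <;> simp

lemma card_S (S : Finset (I.HVert capN)) : S.card = ∑ a ∈ I.arcs, I.cnt capN S a := by
  unfold cnt
  exact Finset.card_eq_sum_card_fiberwise (f := fun h : I.HVert capN => h.1.1) (fun h _ => h.1.2)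

lemma eq_FS (F : Finset (Sym2 (υ ⊕ ω ⊕ I.HVert capN)))
    (hF : F ⊆ (I.factorGraph capN).edgeFinset)
    (hh : ∀ h : I.HVert capN,
        (F.filter (fun e => Sum.inr (Sum.inr h) ∈ e)).card = 0 ∨
        (F.filter (fun e => Sum.inr (Sum.inr h) ∈ e)).card = 2) :
    ∃ S, F = I.FS capN S := by
  have key : ∀ h, I.eU capN h ∈ F ↔ I.eW capN h ∈ F := by
    intro h
    have hsub : F.filter (fun e => Sum.inr (Sum.inr h) ∈ e) ⊆ {I.eU capN h, I.eW capN h} := by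
      intro e he
      rw [Finset.mem_filter] at he
      obtain ⟨k, rfl | rfl⟩ := (I.mem_edge capN e).1 (hF he.1)
      · have : h = k := by simpa [eU] using he.2
        simp [this]
      · have : h = k := by simpa [eW] using he.2
        simp [this]
    have hU : Sum.inr (Sum.inr h) ∈ I.eU capN h := by simp [eU]
    have hW : Sum.inr (Sum.inr h) ∈ I.eW capN h := by simp [eW]
    rcases hh h with h0 | h2
    · rw [Finset.card_eq_zero, Finset.filter_eq_empty_iff] at h0
      exact ⟨fun a => absurd hU (h0 a), fun a => absurd hW (h0 a)⟩
    · have := Finset.eq_of_subset_of_card_le hsub (by rw [h2]; exact Finset.card_le_two)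
      have a1 : I.eU capN h ∈ F.filter (fun e => Sum.inr (Sum.inr h) ∈ e) := by rw [this]; simp
      have a2 : I.eW capN h ∈ F.filter (fun e => Sum.inr (Sum.inr h) ∈ e) := by rw [this]; simp
      exact ⟨fun _ => (Finset.mem_filter.1 a2).1, fun _ => (Finset.mem_filter.1 a1).1⟩
  refine ⟨Finset.univ.filter (fun h => I.eU capN h ∈ F), ?_⟩
  ext e
  simp only [FS, Finset.mem_union, Finset.mem_image, Finset.mem_filter, Finset.mem_univ, true_and]
  constructor
  · intro he
    obtain ⟨k, rfl | rfl⟩ := (I.mem_edge capN e).1 (hF he)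
    · exact Or.inl ⟨k, he, rfl⟩
    · exact Or.inr ⟨k, (key k).2 he, rfl⟩
  · rintro (⟨k, hk, rfl⟩ | ⟨k, hk, rfl⟩)
    · exact hk
    · exact (key k).1 hk

lemma FS_sub (S : Finset (I.HVert capN)) : I.FS capN S ⊆ (I.factorGraph capN).edgeFinset := by
  intro e he
  rw [mem_edge]
  simp only [FS, Finset.mem_union, Finset.mem_image] at he
  rcases he with ⟨k, _, rfl⟩ | ⟨k, _, rfl⟩
  · exact ⟨k, Or.inl rfl⟩
  · exact ⟨k, Or.inr rfl⟩

lemma cnt_univ (P : υ × ω → ℕ → Prop) [∀ a i, Decidable (P a i)] (a : υ × ω) (ha : a ∈ I.arcs) :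
    I.cnt capN (Finset.univ.filter (fun h => P h.1.1 h.2.1)) a
      = (Finset.univ.filter (fun i : Fin (capN a) => P a i.1)).card := by
  rw [cnt]
  symm
  refine Finset.card_bij (fun i _ => ⟨⟨a, ha⟩, i⟩) ?_ ?_ ?_
  · intro i hi; simpa using hi
  · intro i _ j _ h; simpa using h
  · rintro ⟨⟨b, hb⟩, i⟩ h
    simp only [Finset.mem_filter, Finset.mem_univ, true_and] at h
    obtain ⟨h1, rfl⟩ := h
    exact ⟨i, by simpa using h1, rfl⟩

lemma cnt_le (S : Finset (I.HVert capN)) (a : υ × ω) (ha : a ∈ I.arcs) :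
    I.cnt capN S a ≤ capN a := by
  have h1 : I.cnt capN S a ≤ I.cnt capN (Finset.univ.filter (fun _ => True)) a := by
    unfold cnt
    apply Finset.card_le_card
    apply Finset.filter_subset_filter
    simp
  have h2 := I.cnt_univ capN (fun _ _ => True) a ha
  simp only [Finset.filter_true, Finset.card_univ, Fintype.card_fin] at h1 h2
  omega

lemma cnt_zero (S : Finset (I.HVert capN)) (a : υ × ω) (ha : a ∉ I.arcs) :
    I.cnt capN S a = 0 := by
  rw [cnt, Finset.card_eq_zero, Finset.filter_eq_empty_iff]
  rintro h _ rfl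
  exact ha h.1.2

end TwoLayer

/-- Correctness of the reduction from 2-layered transshipment to General Factor:
for a 2-layered instance with natural-number capacities and integer excess sets, there is
an integral transshipment of value `p` iff the associated general-factor instance (with
degree sets `abs(B_v)` on `υ ∪ ω` and `{0,2}` on the subdivision vertices) has a factor of
size `2p`. -/
theorem integral_transshipment_iff_factor (I : TwoLayer υ ω) (capN : υ × ω → ℕ)
    (hcap : ∀ a, I.cap a = (capN a : ℚ))
    (hBU : ∀ u, ∀ x ∈ I.BU u, ∃ z : ℤ, x = z)
    (hBW : ∀ w, ∀ x ∈ I.BW w, ∃ z : ℤ, x = z)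
    (p : ℕ) :
    (∃ f : υ × ω → ℚ, I.IsTrans f ∧ (∀ a, ∃ z : ℤ, f a = z) ∧ I.val f = p) ↔
    (∃ F : Finset (Sym2 (υ ⊕ ω ⊕ I.HVert capN)),
      F ⊆ (I.factorGraph capN).edgeFinset ∧
      (∀ u : υ,
        ((F.filter (fun e => Sum.inl u ∈ e)).card : ℚ) ∈ {y : ℚ | ∃ x ∈ I.BU u, |x| = y}) ∧
      (∀ w : ω,
        ((F.filter (fun e => Sum.inr (Sum.inl w) ∈ e)).card : ℚ)
          ∈ {y : ℚ | ∃ x ∈ I.BW w, |x| = y}) ∧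
      (∀ h : I.HVert capN,
        (F.filter (fun e => Sum.inr (Sum.inr h) ∈ e)).card = 0 ∨
        (F.filter (fun e => Sum.inr (Sum.inr h) ∈ e)).card = 2) ∧
      F.card = 2 * p) := by
  constructor
  · rintro ⟨f, ⟨h1, h2, h3, h4⟩, hz, hv⟩
    have hn : ∀ a, ∃ n : ℕ, f a = n := by
      intro a
      obtain ⟨z, hz⟩ := hz a
      have h0 : 0 ≤ f a := by
        by_cases ha : a ∈ I.arcs
        · exact (h1 a ha).1
        · exact (h2 a ha).ge
      rw [hz] at h0
      have h0' : 0 ≤ z := by exact_mod_cast h0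
      obtain ⟨n, rfl⟩ := Int.eq_ofNat_of_zero_le h0'
      exact ⟨n, by simpa using hz⟩
    choose n hn using hn
    let S : Finset (I.HVert capN) := Finset.univ.filter (fun h => h.2.1 < n h.1.1)
    have hS : ∀ a ∈ I.arcs, I.cnt capN S a = n a := by
      intro a ha
      have hle : n a ≤ capN a := by
        have := (h1 a ha).2
        rw [hcap, hn] at this
        exact_mod_cast this
      rw [show I.cnt capN S a = _ from I.cnt_univ capN (fun a i => i < n a) a ha, Fin.card_filter_val_lt]
      exact min_eq_right hle
    refine ⟨I.FS capN S, I.FS_sub capN S, ?_, ?_, I.FS_h capN S, ?_⟩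
    · intro u
      refine ⟨_, h3 u, ?_⟩
      rw [abs_of_nonneg (I.BU_nonneg u _ (h3 u)), I.FS_u capN S u]
      push_cast
      apply Finset.sum_congr rfl
      intro w hw
      rw [hn, hS _ (Finset.mem_filter.1 hw).2]
    · intro w
      refine ⟨_, h4 w, ?_⟩
      rw [abs_of_nonpos (I.BW_nonpos w _ (h4 w)), I.FS_w capN S w, neg_neg]
      push_cast
      apply Finset.sum_congr rfl
      intro u hu
      rw [hn, hS _ (Finset.mem_filter.1 hu).2]
    · rw [I.FS_card, I.card_S, Finset.sum_congr rfl hS]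
      congr 1
      have : ((∑ a ∈ I.arcs, n a : ℕ) : ℚ) = p := by
        rw [← hv, TwoLayer.val]
        push_cast
        exact Finset.sum_congr rfl (fun a _ => (hn a).symm)
      exact_mod_cast this
  · rintro ⟨F, hF, hu, hw, hh, hc⟩
    obtain ⟨S, rfl⟩ := I.eq_FS capN F hF hh
    refine ⟨fun a => (I.cnt capN S a : ℚ), ⟨?_, ?_, ?_, ?_⟩, fun a => ⟨I.cnt capN S a, by simp⟩, ?_⟩
    · intro a ha
      refine ⟨by positivity, ?_⟩
      rw [hcap]
      show (I.cnt capN S a : ℚ) ≤ capN a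
      exact_mod_cast I.cnt_le capN S a ha
    · intro a ha
      simp [I.cnt_zero capN S a ha]
    · intro u
      obtain ⟨x, hx, hx'⟩ := hu u
      rw [abs_of_nonneg (I.BU_nonneg u x hx), I.FS_u capN S u] at hx'
      push_cast at hx'
      rw [← hx']; exact hx
    · intro w
      obtain ⟨x, hx, hx'⟩ := hw w
      rw [abs_of_nonpos (I.BW_nonpos w x hx), I.FS_w capN S w] at hx'
      push_cast at hx'
      rw [← hx', neg_neg]; exact hx
    · rw [I.FS_card, I.card_S] at hc
      have : ∑ a ∈ I.arcs, I.cnt capN S a = p := by omega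
      rw [TwoLayer.val, ← this]
      push_cast
      rfl
end

section
/- Let (D, c, B) be a 2-layered transshipment instance with parts U and W, natural-number capacities, B_v ⊆ ℤ for every vertex v, and at least one arc of positive capacity. Let (G, B') be constructed as follows: G has vertex set U ∪ W ∪ H, where H contains a vertex h^i_{uw} for every arc (u,w) ∈ A(D) and every i ∈ {1,...,c(u,w)}, with edges {u, h^i_{uw}} and {h^i_{uw}, w}; B'_v = {|x| : x ∈ B_v} for v ∈ U ∪ W and B'_h = {0, 2} for h ∈ H. Then the max-gap of the collection {B'_v : v ∈ V(G)} equals max{1, γ}, where γ is the max-gap of the collection {B_v : v ∈ V(D)}. -/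
open scoped Classical

variable {υ ω : Type*} [Fintype υ] [Fintype ω]

/-- An integer set `B` has a gap of length `d ≥ 1` if there is `p ∈ B` with
`p+1, …, p+d ∉ B` and `p+d+1 ∈ B`. -/
def HasGap (B : Set ℤ) (d : ℕ) : Prop :=
  1 ≤ d ∧ ∃ p ∈ B, (∀ j : ℕ, 1 ≤ j → j ≤ d → (p + j : ℤ) ∉ B) ∧ (p + d + 1 : ℤ) ∈ B

/-- `γ` is the max-gap of a collection of integer sets: every gap of a member has length at
most `γ`, and `γ` is attained by some member (or `γ = 0` if no member has a gap). -/
def MaxGapIs (𝒞 : Set (Set ℤ)) (γ : ℕ) : Prop :=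
  (∀ B ∈ 𝒞, ∀ d : ℕ, HasGap B d → d ≤ γ) ∧ (γ = 0 ∨ ∃ B ∈ 𝒞, HasGap B γ)

theorem hasGap_neg_aux {B C : Set ℤ} (h : ∀ z, z ∈ C ↔ -z ∈ B) {d : ℕ} (hg : HasGap B d) :
    HasGap C d := by
  obtain ⟨hd, p, hp, hj, hq⟩ := hg
  refine ⟨hd, -(p + d + 1), ?_, ?_, ?_⟩
  · rw [h]; simpa using hq
  · intro j h1 h2 hm
    rw [h] at hm
    apply hj (d + 1 - j) (by omega) (by omega)
    have : (p + ((d + 1 - j : ℕ) : ℤ)) = -(-(p + d + 1) + j) := by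
      omega
    rw [this]; exact hm
  · rw [h]
    have : -(-(p + (d : ℤ) + 1) + d + 1) = p := by ring
    rw [this]; exact hp

/-- Max-gap of the General Factor instance produced from a 2-layered transshipment
instance with natural-number capacities, integer excess sets and at least one arc of
positive capacity: the degree-set collection, consisting of `abs(B_u)` for `u ∈ υ`,
`abs(B_w)` for `w ∈ ω` and `{0,2}` for the subdivision vertices, has max-gap
`max 1 γ`, where `γ` is the max-gap of the collection of excess sets. -/
theorem maxGap_factor_instance (I : TwoLayer υ ω) (capN : υ × ω → ℕ)
    (hcap : ∀ a, I.cap a = (capN a : ℚ))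
    (hBU : ∀ u, ∀ x ∈ I.BU u, ∃ z : ℤ, x = z)
    (hBW : ∀ w, ∀ x ∈ I.BW w, ∃ z : ℤ, x = z)
    (hpos : ∃ a ∈ I.arcs, 0 < capN a)
    (γ : ℕ)
    (hγ : MaxGapIs
      ((Set.range fun u : υ => {z : ℤ | (z : ℚ) ∈ I.BU u}) ∪
       (Set.range fun w : ω => {z : ℤ | (z : ℚ) ∈ I.BW w})) γ) :
    MaxGapIs
      ((Set.range fun u : υ => {z : ℤ | ∃ y : ℤ, (y : ℚ) ∈ I.BU u ∧ |y| = z}) ∪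
       (Set.range fun w : ω => {z : ℤ | ∃ y : ℤ, (y : ℚ) ∈ I.BW w ∧ |y| = z}) ∪
       {({0, 2} : Set ℤ)}) (max 1 γ) := by
  have hU : ∀ u, {z : ℤ | ∃ y : ℤ, (y : ℚ) ∈ I.BU u ∧ |y| = z} = {z : ℤ | (z : ℚ) ∈ I.BU u} := by
    intro u
    ext z
    constructor
    · rintro ⟨y, hy, rfl⟩
      have h0 : (0 : ℤ) ≤ y := by exact_mod_cast I.BU_nonneg u _ hy
      rw [abs_of_nonneg h0]; exact hy
    · intro hz
      have h0 : (0 : ℤ) ≤ z := by exact_mod_cast I.BU_nonneg u _ hz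
      exact ⟨z, hz, abs_of_nonneg h0⟩
  have hW : ∀ w, ∀ z : ℤ, z ∈ {z : ℤ | ∃ y : ℤ, (y : ℚ) ∈ I.BW w ∧ |y| = z} ↔
      -z ∈ {z : ℤ | (z : ℚ) ∈ I.BW w} := by
    intro w z
    constructor
    · rintro ⟨y, hy, rfl⟩
      have h0 : y ≤ (0 : ℤ) := by exact_mod_cast I.BW_nonpos w _ hy
      rw [abs_of_nonpos h0, neg_neg]; exact hy
    · intro hz
      have h0 : -z ≤ (0 : ℤ) := by exact_mod_cast I.BW_nonpos w _ hz
      exact ⟨-z, hz, by rw [abs_of_nonpos h0, neg_neg]⟩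
  have hW' : ∀ w, ∀ z : ℤ, z ∈ {z : ℤ | (z : ℚ) ∈ I.BW w} ↔
      -z ∈ {z : ℤ | ∃ y : ℤ, (y : ℚ) ∈ I.BW w ∧ |y| = z} := by
    intro w z
    rw [hW, neg_neg]
  obtain ⟨hub, hat⟩ := hγ
  constructor
  · rintro B ((⟨u, rfl⟩ | ⟨w, rfl⟩) | hB) d hd
    · simp only [hU] at hd
      exact le_max_of_le_right (hub _ (Or.inl ⟨u, rfl⟩) d hd)
    · exact le_max_of_le_right (hub _ (Or.inr ⟨w, rfl⟩) d (hasGap_neg_aux (hW' w) hd))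
    · rw [Set.mem_singleton_iff] at hB
      subst hB
      obtain ⟨h1, p, hp, -, hq⟩ := hd
      simp only [Set.mem_insert_iff, Set.mem_singleton_iff] at hp hq
      apply le_max_of_le_left
      omega
  · right
    rcases Nat.lt_or_ge 1 γ with h | h
    · rw [max_eq_right h.le]
      rcases hat with h0 | ⟨B, (⟨u, rfl⟩ | ⟨w, rfl⟩), hB⟩
      · omega
      · exact ⟨_, Or.inl (Or.inl ⟨u, rfl⟩), by simp only [hU]; exact hB⟩
      · exact ⟨_, Or.inl (Or.inr ⟨w, rfl⟩), hasGap_neg_aux (hW w) hB⟩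
    · rw [max_eq_left h]
      refine ⟨{0, 2}, Or.inr rfl, le_rfl, 0, by simp, ?_, by norm_num⟩
      intro j h1 h2
      have : j = 1 := by omega
      subst this
      norm_num
end

section
/- Let G be a finite simple graph containing a cycle C and let φ be a fractional orientation of G. Then there exists a fractional orientation φ' of G such that deg⁻_{φ'}(v) = deg⁻_φ(v) for every vertex v of G and there is an edge e = {u,v} of C with φ'(e)^u = 1, i.e., e is completely assigned to one of its endpoints by φ'. -/
open scoped Classical

noncomputable def walkFlow {V : Type*} {G : SimpleGraph V} :
    {a b : V} → G.Walk a b → V → V → ℚ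
  | _, _, .nil, _, _ => 0
  | _, _, .cons (u := a) (v := b) _ p, u, v =>
      walkFlow p u v + (if u = a then (if v = b then 1 else 0) else 0)
        - (if u = b then (if v = a then 1 else 0) else 0)

theorem walkFlow_antisymm {V : Type*} {G : SimpleGraph V} {a b : V} (p : G.Walk a b) (u v : V) :
    walkFlow p u v + walkFlow p v u = 0 := by
  induction p with
  | nil => simp [walkFlow]
  | cons h p ih =>
    simp only [walkFlow]
    split_ifs <;> linarith

theorem walkFlow_sum {V : Type*} [Fintype V] {G : SimpleGraph V} {a b : V} (p : G.Walk a b)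
    (v : V) : ∑ u ∈ Finset.univ.filter (fun u => G.Adj u v), walkFlow p u v
      = (if v = b then 1 else 0) - (if v = a then 1 else 0) := by
  induction p with
  | nil => simp [walkFlow]
  | cons h p ih =>
    simp only [walkFlow, Finset.sum_sub_distrib, Finset.sum_add_distrib, ih,
      Finset.sum_ite_eq', Finset.mem_filter, Finset.mem_univ, true_and]
    have h2 := h.symm
    have h3 := h.ne
    split_ifs <;> simp_all

theorem walkFlow_notMem {V : Type*} {G : SimpleGraph V} {a b : V} (p : G.Walk a b) (u v : V)
    (h : s(u, v) ∉ p.edges) : walkFlow p u v = 0 := by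
  induction p with
  | nil => simp [walkFlow]
  | cons h' p ih =>
    simp only [SimpleGraph.Walk.edges_cons, List.mem_cons, not_or] at h
    simp only [walkFlow, ih h.2]
    have := h.1
    rw [Sym2.eq_iff] at this
    split_ifs <;> simp_all

theorem walkFlow_dart {V : Type*} {G : SimpleGraph V} {a b : V} (p : G.Walk a b)
    (hp : p.IsTrail) (d : G.Dart) (h : d ∈ p.darts) : walkFlow p d.fst d.snd = 1 := by
  induction p with
  | nil => simp at h
  | cons h' p ih =>
    rw [SimpleGraph.Walk.isTrail_cons] at hp
    rw [SimpleGraph.Walk.darts_cons, List.mem_cons] at h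
    rcases h with rfl | h
    · simp [walkFlow, walkFlow_notMem p _ _ hp.2, h'.ne]
    · have h1 := ih hp.1 h
      have h2 : s(d.fst, d.snd) ∈ p.edges := List.mem_map.2 ⟨d, h, rfl⟩
      simp only [walkFlow, h1]
      have h3 : ∀ x y, s(x, y) ∉ p.edges → ¬ (d.fst = x ∧ d.snd = y) := by
        rintro x y hxy ⟨rfl, rfl⟩
        exact hxy h2
      have h4 := h3 _ _ hp.2
      have h5 := h3 _ _ (Sym2.eq_swap ▸ hp.2)
      split_ifs <;> simp_all

/-- If a finite simple graph `G` contains a cycle `C` and `φ` is a fractional orientation of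
`G`, then there is a fractional orientation `φ'` with the same indegree at every vertex such
that some edge `{u,v}` of `C` is completely assigned to one of its endpoints
(`φ'(e)^u = 1`, i.e. `φ'.toFun v u = 1`). -/
theorem exists_fracOrientation_with_full_edge_on_cycle {V : Type*} [Fintype V]
    (G : SimpleGraph V) {a : V} (C : G.Walk a a) (hC : C.IsCycle)
    (φ : G.FracOrientation) :
    ∃ φ' : G.FracOrientation,
      (∀ v : V, φ'.inDeg v = φ.inDeg v) ∧
      ∃ u v : V, s(u, v) ∈ C.edges ∧ φ'.toFun v u = 1 := by
  have hT : C.IsTrail := hC.isCircuit.isTrail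
  have hne : C.darts.toFinset.Nonempty := by
    cases C with
    | nil => exact absurd rfl hC.ne_nil
    | cons h p => exact ⟨⟨(_, _), h⟩, by simp⟩
  obtain ⟨d, hd, hmin⟩ := Finset.exists_min_image C.darts.toFinset
    (fun d => φ.toFun d.snd d.fst) hne
  rw [List.mem_toFinset] at hd
  have hdE : s(d.fst, d.snd) ∈ C.edges := List.mem_map.2 ⟨d, hd, rfl⟩
  have ht : 0 ≤ φ.toFun d.snd d.fst := φ.nonneg _ _ d.adj.symm
  refine ⟨⟨fun u v => φ.toFun u v + φ.toFun d.snd d.fst * walkFlow C u v, ?_, ?_⟩, ?_, ?_⟩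
  · intro u v huv
    have h0 := φ.nonneg u v huv
    by_cases hE : s(u, v) ∈ C.edges
    · obtain ⟨e, he, hee⟩ := List.mem_map.1 hE
      have h1 := walkFlow_dart C hT e he
      have h2 := hmin e (List.mem_toFinset.2 he)
      have h3 := walkFlow_antisymm C e.fst e.snd
      have hee' : s(e.fst, e.snd) = s(u, v) := hee
      rw [Sym2.eq_iff] at hee'
      rcases hee' with ⟨rfl, rfl⟩ | ⟨rfl, rfl⟩
      · rw [h1]; linarith
      · have : walkFlow C e.snd e.fst = -1 := by linarith
        rw [this]; linarith
    · rw [walkFlow_notMem C u v hE]; simpa using h0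
  · intro u v huv
    have h1 := φ.sum_eq_one u v huv
    have h2 := walkFlow_antisymm C u v
    linear_combination h1 + φ.toFun d.snd d.fst * h2
  · intro v
    simp only [SimpleGraph.FracOrientation.inDeg, Finset.sum_add_distrib, ← Finset.mul_sum,
      walkFlow_sum, sub_self, mul_zero, add_zero]
  · refine ⟨d.snd, d.fst, Sym2.eq_swap ▸ hdE, ?_⟩
    simp only [walkFlow_dart C hT d hd, mul_one]
    exact φ.sum_eq_one _ _ d.adj
end

section
/- For every rational number τ = p/q > 1, where p and q are coprime positive integers, there exists a finite simple graph W with two distinct vertices u and w and two fractional orientations φ1 and φ2 of W such that: (i) deg⁻_{φ1}(v) = deg⁻_{φ2}(v) = τ for every vertex v ∈ V(W)\{u,w}; (ii) deg⁻_{φ1}(u) = deg⁻_{φ2}(w) = τ − 1 + 1/q; and (iii) deg⁻_{φ1}(w) = deg⁻_{φ2}(u) = τ − 1. -/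
open scoped Classical

namespace EdgeGadget

def kk (p q i : ℕ) : ℕ := (i + 1) * p / q - i * p / q - 1

def own (p q m : ℕ) (i j : Fin (m + 1)) : Prop :=
  2 ≤ (j - i).val ∧ (j - i).val ≤ kk p q i.val + 1

lemma sub_cases {m : ℕ} (i j : Fin (m + 1)) :
    (j - i).val + i.val = j.val ∨ (j - i).val + i.val = j.val + (m + 1) := by
  have h1 := i.isLt
  have h2 := j.isLt
  rw [Fin.val_sub]
  by_cases h : i.val ≤ j.val
  · left
    have : m + 1 - i.val + j.val = (j.val - i.val) + (m + 1) := by omega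
    rw [this, Nat.add_mod_right, Nat.mod_eq_of_lt (by omega)]
    omega
  · right
    rw [Nat.mod_eq_of_lt (by omega)]
    omega

lemma div_step {p q : ℕ} (hq : 0 < q) (hpq : q ≤ p) (i : ℕ) :
    i * p / q + 1 ≤ (i + 1) * p / q := by
  rw [Nat.le_div_iff_mul_le hq]
  have := Nat.div_mul_le_self (i * p) q
  nlinarith

lemma kk_le {p q : ℕ} (hq : 0 < q) (i : ℕ) : kk p q i ≤ p := by
  unfold kk
  have : (i + 1) * p / q ≤ i * p / q + p := by
    rw [← Nat.add_mul_div_right _ _ hq]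
    apply Nat.div_le_div_right
    nlinarith
  omega

lemma own_card {p q m : ℕ} (hq : 0 < q) (hm : 2 * p + 10 ≤ m) (i : Fin (m + 1)) :
    (∑ j : Fin (m + 1), if own p q m i j then (1 : ℚ) else 0) = kk p q i.val := by
  have hk := kk_le (p := p) hq i.val
  unfold own
  rw [← Equiv.sum_comp (Equiv.addRight i)]
  simp only [Equiv.coe_addRight, add_sub_cancel_right]
  rw [Fin.sum_univ_eq_sum_range
    (fun t => if 2 ≤ t ∧ t ≤ kk p q i.val + 1 then (1 : ℚ) else 0) (m + 1)]
  rw [← Finset.sum_filter, Finset.sum_const]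
  have : Finset.filter (fun t => 2 ≤ t ∧ t ≤ kk p q i.val + 1) (Finset.range (m + 1))
      = Finset.Icc 2 (kk p q i.val + 1) := by
    ext t
    simp only [Finset.mem_filter, Finset.mem_range, Finset.mem_Icc]
    omega
  rw [this]
  simp

def W (p q m : ℕ) (hm : 2 * p + 10 ≤ m) : SimpleGraph (Fin (m + 1)) where
  Adj a b := own p q m a b ∨ own p q m b a ∨ a.val + 1 = b.val ∨ b.val + 1 = a.val
  symm := ⟨by intro a b h; tauto⟩
  loopless := ⟨by
    intro a h
    simp [own] at h⟩

noncomputable def f (p q m : ℕ) (ε : ℚ) (a b : Fin (m + 1)) : ℚ :=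
  (if own p q m b a then 1 else 0)
  + (if b.val + 1 = a.val then (((a.val * p % q : ℕ) : ℚ) + ε) / q else 0)
  + (if a.val + 1 = b.val then ((q : ℚ) - ε - ((b.val * p % q : ℕ) : ℚ)) / q else 0)

lemma f_nonneg {p q m : ℕ} (hq : 0 < q) {ε : ℚ} (h0 : 0 ≤ ε) (h1 : ε ≤ 1)
    (a b : Fin (m + 1)) : 0 ≤ f p q m ε a b := by
  have hb : ((b.val * p % q : ℕ) : ℚ) + 1 ≤ q := by
    exact_mod_cast Nat.mod_lt _ hq
  unfold f
  refine add_nonneg (add_nonneg ?_ ?_) ?_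
  · split_ifs <;> norm_num
  · split_ifs
    · positivity
    · exact le_rfl
  · split_ifs
    · apply div_nonneg
      · linarith
      · positivity
    · exact le_rfl

lemma f_sum {p q m : ℕ} (hq : 0 < q) (hm : 2 * p + 10 ≤ m) (ε : ℚ)
    (a b : Fin (m + 1)) (h : (W p q m hm).Adj a b) : f p q m ε a b + f p q m ε b a = 1 := by
  have hq' : (q : ℚ) ≠ 0 := by positivity
  have ka := kk_le (p := p) hq a.val
  have kb := kk_le (p := p) hq b.val
  have c1 := sub_cases a b
  have c2 := sub_cases b a
  have l1 := a.isLt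
  have l2 := b.isLt
  have l3 := (a - b).isLt
  have l4 := (b - a).isLt
  have e1 : own p q m a b → ¬ own p q m b a ∧ a.val + 1 ≠ b.val ∧ b.val + 1 ≠ a.val := by
    unfold own; omega
  have e2 : own p q m b a → ¬ own p q m a b ∧ a.val + 1 ≠ b.val ∧ b.val + 1 ≠ a.val := by
    unfold own; omega
  unfold f
  rcases h with h | h | h | h
  · obtain ⟨x, y, z⟩ := e1 h
    simp [h, x, y, z]
  · obtain ⟨x, y, z⟩ := e2 h
    simp [h, x, y, z]
  · have x : ¬ own p q m a b := fun t => (e1 t).2.1 h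
    have y : ¬ own p q m b a := fun t => (e2 t).2.1 h
    have z : b.val + 1 ≠ a.val := by omega
    simp only [x, y, z, h, if_true, if_false]
    field_simp
    ring
  · have x : ¬ own p q m a b := fun t => (e1 t).2.2 h
    have y : ¬ own p q m b a := fun t => (e2 t).2.2 h
    have z : a.val + 1 ≠ b.val := by omega
    simp only [x, y, z, h, if_true, if_false]
    field_simp
    ring

noncomputable def φ {p q m : ℕ} (hq : 0 < q) (hm : 2 * p + 10 ≤ m) (ε : ℚ)
    (h0 : 0 ≤ ε) (h1 : ε ≤ 1) : (W p q m hm).FracOrientation where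
  toFun := f p q m ε
  nonneg a b _ := f_nonneg hq h0 h1 a b
  sum_eq_one a b h := f_sum hq hm ε a b h

lemma inDeg_eq {p q m : ℕ} (hq : 0 < q) (hm : 2 * p + 10 ≤ m) (ε : ℚ)
    (h0 : 0 ≤ ε) (h1 : ε ≤ 1) (b : Fin (m + 1)) :
    (φ hq hm ε h0 h1).inDeg b = (kk p q b.val : ℚ)
      + (if b.val < m then ((((b.val + 1) * p % q : ℕ) : ℚ) + ε) / q else 0)
      + (if 0 < b.val then ((q : ℚ) - ε - ((b.val * p % q : ℕ) : ℚ)) / q else 0) := by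
  have hb := b.isLt
  unfold SimpleGraph.FracOrientation.inDeg
  have s1 : ∑ u ∈ Finset.univ.filter (fun u => (W p q m hm).Adj u b),
      (φ hq hm ε h0 h1).toFun u b = ∑ u, f p q m ε u b := by
    apply Finset.sum_subset (Finset.filter_subset _ _)
    intro a _ ha
    have ha' : ¬ (own p q m a b ∨ own p q m b a ∨ a.val + 1 = b.val ∨ b.val + 1 = a.val) := by
      intro h
      apply ha
      simp only [Finset.mem_filter, Finset.mem_univ, true_and]
      exact h
    push Not at ha'
    obtain ⟨_, x, y, z⟩ := ha'
    show f p q m ε a b = 0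
    simp [f, x, y, z]
  rw [s1]
  unfold f
  rw [Finset.sum_add_distrib, Finset.sum_add_distrib, own_card hq hm]
  congr 1
  · congr 1
    split_ifs with h
    · rw [Finset.sum_eq_single (⟨b.val + 1, by omega⟩ : Fin (m + 1))]
      · simp
      · intro c _ hc
        rw [if_neg]
        intro h'
        exact hc (Fin.ext h'.symm)
      · simp
    · apply Finset.sum_eq_zero
      intro c _
      rw [if_neg]
      have := c.isLt
      omega
  · split_ifs with h
    · rw [Finset.sum_eq_single (⟨b.val - 1, by omega⟩ : Fin (m + 1))]
      · rw [if_pos]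
        show b.val - 1 + 1 = b.val
        omega
      · intro c _ hc
        rw [if_neg]
        intro h'
        exact hc (Fin.ext (by show c.val = b.val - 1; omega))
      · simp
    · apply Finset.sum_eq_zero
      intro c _
      rw [if_neg]
      omega

lemma kk_cast {p q : ℕ} (hq : 0 < q) (hpq : q ≤ p) (i : ℕ) :
    (kk p q i : ℚ) = ((p : ℚ) - q + (i * p % q : ℕ) - ((i + 1) * p % q : ℕ)) / q := by
  have hq' : (q : ℚ) ≠ 0 := by positivity
  have h := div_step hq hpq i
  have a1 := Nat.div_add_mod (i * p) q
  have a2 := Nat.div_add_mod ((i + 1) * p) q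
  have h3 : kk p q i + i * p / q + 1 = (i + 1) * p / q := by unfold kk; omega
  have b1 : (q : ℚ) * (i * p / q : ℕ) + (i * p % q : ℕ) = i * p := by exact_mod_cast a1
  have b2 : (q : ℚ) * ((i + 1) * p / q : ℕ) + ((i + 1) * p % q : ℕ) = (i + 1) * p := by
    exact_mod_cast a2
  have b3 : (kk p q i : ℚ) + (i * p / q : ℕ) + 1 = ((i + 1) * p / q : ℕ) := by exact_mod_cast h3
  rw [eq_div_iff hq']
  rw [← b3] at b2
  linarith

lemma exists_m {p q : ℕ} (hq : 0 < q) (hco : Nat.Coprime p q) :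
    ∃ m, 2 * p + 10 ≤ m ∧ (m + 1) * p % q + 1 = q := by
  haveI : NeZero q := ⟨hq.ne'⟩
  let a : ℕ := (-(p : ZMod q)⁻¹).val
  have h1 : ((a * p + 1 : ℕ) : ZMod q) = 0 := by
    have : (p : ZMod q) * (p : ZMod q)⁻¹ = 1 := ZMod.coe_mul_inv_eq_one p hco
    push_cast
    simp only [a, ZMod.natCast_val, ZMod.cast_id', id]
    linear_combination -this
  rw [ZMod.natCast_eq_zero_iff] at h1
  refine ⟨a + q * (2 * p + 11) - 1, ?_, ?_⟩
  · have : 2 * p + 11 ≤ q * (2 * p + 11) := Nat.le_mul_of_pos_left _ hq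
    omega
  · have : 2 * p + 11 ≤ q * (2 * p + 11) := Nat.le_mul_of_pos_left _ hq
    have e : a + q * (2 * p + 11) - 1 + 1 = a + q * (2 * p + 11) := by omega
    rw [e, add_mul, mul_assoc, Nat.add_mul_mod_self_left]
    have h2 := Nat.div_add_mod (a * p) q
    have h3 := Nat.mod_lt (a * p) hq
    have h4 : q ∣ a * p % q + 1 := by
      have : q ∣ q * (a * p / q) + (a * p % q + 1) := by
        rw [← add_assoc, h2]; exact h1
      exact (Nat.dvd_add_right (Dvd.intro _ rfl)).1 this
    have := Nat.le_of_dvd (by omega) h4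
    omega

end EdgeGadget

/-- Edge-gadget lemma: for every rational `τ = p/q > 1` with `p, q` coprime positive integers
there is a finite simple graph `W` with two distinct vertices `u, w` and two fractional
orientations `φ1, φ2` such that all other vertices have indegree `τ` in both, while
`u` and `w` have indegrees `τ - 1 + 1/q` and `τ - 1` in `φ1`, and swapped in `φ2`. -/
theorem exists_edge_gadget (p q : ℕ) (hp : 0 < p) (hq : 0 < q) (hco : Nat.Coprime p q)
    (hτ : 1 < (p : ℚ) / q) :
    ∃ (n : ℕ) (W : SimpleGraph (Fin n)) (u w : Fin n), u ≠ w ∧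
      ∃ φ1 φ2 : W.FracOrientation,
        (∀ v : Fin n, v ≠ u → v ≠ w →
          φ1.inDeg v = (p : ℚ) / q ∧ φ2.inDeg v = (p : ℚ) / q) ∧
        φ1.inDeg u = (p : ℚ) / q - 1 + 1 / q ∧
        φ2.inDeg w = (p : ℚ) / q - 1 + 1 / q ∧
        φ1.inDeg w = (p : ℚ) / q - 1 ∧
        φ2.inDeg u = (p : ℚ) / q - 1 := by
  have hq' : (q : ℚ) ≠ 0 := by positivity
  have hpq : q ≤ p := by
    rw [one_lt_div (by positivity)] at hτ
    exact_mod_cast hτ.le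
  obtain ⟨m, hm, hs⟩ := EdgeGadget.exists_m hq hco
  have hs' : (((m + 1) * p % q : ℕ) : ℚ) + 1 = q := by exact_mod_cast hs
  refine ⟨m + 1, EdgeGadget.W p q m hm, ⟨0, by omega⟩, ⟨m, by omega⟩, ?_,
    EdgeGadget.φ hq hm 1 (by norm_num) (by norm_num),
    EdgeGadget.φ hq hm 0 (by norm_num) (by norm_num), ?_, ?_, ?_, ?_, ?_⟩
  · intro h
    have := congrArg Fin.val h
    simp only at this
    omega
  · intro v hu hw
    have h0 : 0 < v.val := by
      rcases Nat.eq_zero_or_pos v.val with h | h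
      · exact absurd (Fin.ext h) hu
      · exact h
    have h1 : v.val < m := by
      rcases Nat.lt_or_ge v.val m with h | h
      · exact h
      · exact absurd (Fin.ext (by have := v.isLt; show v.val = m; omega)) hw
    constructor <;>
    · rw [EdgeGadget.inDeg_eq, EdgeGadget.kk_cast hq hpq, if_pos h1, if_pos h0]
      field_simp
      ring
  all_goals
    rw [EdgeGadget.inDeg_eq, EdgeGadget.kk_cast hq hpq]
    have hm0 : 0 < m := by omega
    simp only [hm0, lt_irrefl, if_true, if_false, zero_mul, Nat.zero_mod, Nat.cast_zero]
    field_simp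
    linarith
end

section
/- Let ℓ ≥ 3 and q ≥ 1 and t ≥ q be integers, let X = {x_1,...,x_{ℓq}} be a set with ℓq elements, and let C_1,...,C_t be ℓ-element subsets of X such that every element of X lies in at least one C_j. Let G be the graph with vertices y_1,...,y_{ℓq}, c_1,...,c_t, u_1,...,u_{t−q}, and z_i^j for i ∈ {1,...,t−q} and j ∈ {1,...,ℓ−1}, whose edges are: {y_i, c_j} whenever x_i ∈ C_j; {u_i, z_i^j} for all i ∈ {1,...,t−q} and j ∈ {1,...,ℓ−1}; and {c_j, u_i} for all j ∈ {1,...,t} and i ∈ {1,...,t−q}. Let m = |E(G)|. Then there exists an edge set F ⊆ E(G) with |F| ≤ m − ℓt and ρ*(G − F) ≤ ℓ/(ℓ+1) if and only if there is a subcollection C' of {C_1,...,C_t} such that every element of X occurs in exactly one member of C'. -/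
open scoped Classical

/-- Vertex set of the graph built from an Exact Cover by ℓ-Sets instance: element vertices
`y_i`, set vertices `c_j`, star centers `u_i`, and star leaves `z_i^j`. -/
abbrev XVx (ℓ q t : ℕ) : Type :=
  Fin (ℓ * q) ⊕ Fin t ⊕ Fin (t - q) ⊕ (Fin (t - q) × Fin (ℓ - 1))

/-- The graph of the reduction: edges `{y_i, c_j}` whenever `x_i ∈ C_j`, star edges
`{u_i, z_i^j}`, and all edges `{c_j, u_i}`. -/
def xGraph (ℓ q t : ℕ) (C : Fin t → Finset (Fin (ℓ * q))) : SimpleGraph (XVx ℓ q t) :=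
  SimpleGraph.fromRel (fun x y =>
    match x, y with
    | Sum.inl i, Sum.inr (Sum.inl j) => i ∈ C j
    | Sum.inr (Sum.inr (Sum.inl i)), Sum.inr (Sum.inr (Sum.inr z)) => z.1 = i
    | Sum.inr (Sum.inl _), Sum.inr (Sum.inr (Sum.inl _)) => True
    | _, _ => False)

theorem star_bound {I V : Type*} [Fintype I] [Fintype V] (ℓ : ℕ) (leaf center : I → V)
    (hinj : Function.Injective leaf) (hne : ∀ a b, leaf a ≠ center b)
    (hfib : ∀ r, (Finset.univ.filter (fun a => center a = r)).card ≤ ℓ)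
    (G : SimpleGraph V) (hG : ∀ e ∈ G.edgeSet, ∃ a, s(leaf a, center a) = e)
    (H : G.Subgraph) : G.subDensity H ≤ (ℓ : ℚ) / (ℓ + 1) := by
  unfold SimpleGraph.subDensity
  set A : Finset I := Finset.univ.filter (fun a => s(leaf a, center a) ∈ H.edgeSet) with hA
  have h1 : H.edgeSet.ncard ≤ A.card := by
    have : H.edgeSet ⊆ ((A.image (fun a => s(leaf a, center a)) : Finset _) : Set _) := by
      intro e he
      obtain ⟨a, rfl⟩ := hG e (H.edgeSet_subset he)
      simp only [Finset.coe_image, Set.mem_image]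
      exact ⟨a, by simpa [hA] using he, rfl⟩
    calc _ ≤ _ := Set.ncard_le_ncard this (Finset.finite_toSet _)
      _ = _ := Set.ncard_coe_finset _
      _ ≤ _ := Finset.card_image_le
  have h2 : A.card ≤ ℓ * (A.image center).card :=
    Finset.card_le_mul_card_image A ℓ (fun b _ => le_trans
      (Finset.card_le_card (by intro x; simp)) (hfib b))
  have h3 : A.card + (A.image center).card ≤ H.verts.ncard := by
    have hs : ((A.image leaf ∪ A.image center : Finset V) : Set V) ⊆ H.verts := by
      intro v hv
      simp only [Finset.coe_union, Finset.coe_image, Set.mem_union, Set.mem_image] at hv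
      rcases hv with ⟨a, ha, rfl⟩ | ⟨a, ha, rfl⟩
      · have : H.Adj (leaf a) (center a) := by simpa [hA] using ha
        exact H.edge_vert this
      · have : H.Adj (leaf a) (center a) := by simpa [hA] using ha
        exact H.edge_vert this.symm
    have := Set.ncard_le_ncard hs (Set.toFinite _)
    rw [Set.ncard_coe_finset, Finset.card_union_of_disjoint,
      Finset.card_image_of_injective _ hinj] at this
    · exact this
    · rw [Finset.disjoint_left]
      simp only [Finset.mem_image]
      rintro v ⟨a, _, rfl⟩ ⟨b, _, hb⟩
      exact hne a b hb.symm
  have h4 : (ℓ + 1) * H.edgeSet.ncard ≤ ℓ * H.verts.ncard := by nlinarith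
  rcases Nat.eq_zero_or_pos H.verts.ncard with h0 | h0
  · rw [h0]; simp; positivity
  · rw [div_le_div_iff₀ (by exact_mod_cast h0) (by positivity)]
    have : ((ℓ : ℚ) + 1) * H.edgeSet.ncard ≤ ℓ * H.verts.ncard := by exact_mod_cast h4
    linarith

theorem backward (ℓ q t : ℕ) (hℓ : 3 ≤ ℓ) (ht : q ≤ t)
    (C : Fin t → Finset (Fin (ℓ * q)))
    (hcard : ∀ j, (C j).card = ℓ)
    (S : Finset (Fin t)) (hS : ∀ i : Fin (ℓ * q), ∃! j : Fin t, j ∈ S ∧ i ∈ C j) :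
    (∃ F : Finset (Sym2 (XVx ℓ q t)), ↑F ⊆ (xGraph ℓ q t C).edgeSet ∧
      (F.card : ℤ) ≤ ((xGraph ℓ q t C).edgeFinset.card : ℤ) - ℓ * t ∧
      ∀ H : ((xGraph ℓ q t C).deleteEdges ↑F).Subgraph,
        ((xGraph ℓ q t C).deleteEdges ↑F).subDensity H ≤ (ℓ : ℚ) / (ℓ + 1)) := by
  choose J hJ hJu using hS
  have hSq : S.card = q := by
    have h := Finset.card_eq_sum_card_fiberwise (s := (Finset.univ : Finset (Fin (ℓ * q))))
      (t := S) (f := J) (fun i _ => (hJ i).1)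
    have h' : ∀ j ∈ S, (Finset.univ.filter (fun i => J i = j)).card = ℓ := by
      intro j hj
      refine Eq.trans ?_ (hcard j)
      congr 1
      ext i
      simp only [Finset.mem_filter, Finset.mem_univ, true_and]
      exact ⟨fun h => h ▸ (hJ i).2, fun h => (hJu i j ⟨hj, h⟩).symm⟩
    rw [Finset.sum_congr rfl h'] at h
    simp at h
    have : ℓ * q = ℓ * S.card := by rw [h]; ring
    exact (Nat.eq_of_mul_eq_mul_left (by omega) this).symm
  have hc : Fintype.card (Fin (t - q)) = Fintype.card {j // j ∉ S} := by
    rw [Fintype.card_subtype_compl]; simp [hSq]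
  let σ := Fintype.equivOfCardEq hc
  let leaf : Fin (ℓ * q) ⊕ Fin (t - q) ⊕ (Fin (t - q) × Fin (ℓ - 1)) → XVx ℓ q t := fun a =>
    match a with
    | Sum.inl i => Sum.inl i
    | Sum.inr (Sum.inl k) => Sum.inr (Sum.inl (σ k).1)
    | Sum.inr (Sum.inr z) => Sum.inr (Sum.inr (Sum.inr z))
  let center : Fin (ℓ * q) ⊕ Fin (t - q) ⊕ (Fin (t - q) × Fin (ℓ - 1)) → XVx ℓ q t := fun a =>
    match a with
    | Sum.inl i => Sum.inr (Sum.inl (J i))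
    | Sum.inr (Sum.inl k) => Sum.inr (Sum.inr (Sum.inl k))
    | Sum.inr (Sum.inr z) => Sum.inr (Sum.inr (Sum.inl z.1))
  have hinj : Function.Injective leaf := by
    rintro (a | a | a) (b | b | b) h <;> simp [leaf, Subtype.val_inj] at h ⊢ <;> exact h
  have hne : ∀ a b, leaf a ≠ center b := by
    rintro (a | a | a) (b | b | b) <;> simp [leaf, center]
    intro h
    exact (σ a).2 (h ▸ (hJ b).1)
  have hfib : ∀ r, (Finset.univ.filter (fun a => center a = r)).card ≤ ℓ := by
    rintro (r | r | r | r)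
    · rw [Finset.card_eq_zero.2]; omega
      ext a; rcases a with a | a | a <;> simp [center]
    · refine le_trans ?_ (hcard r).le
      refine le_trans (Finset.card_le_card (t := (C r).image Sum.inl) ?_) Finset.card_image_le
      intro a; rcases a with a | a | a <;> simp [center]
      rintro rfl; exact (hJ a).2
    · refine le_trans (Finset.card_le_card (t := insert (Sum.inr (Sum.inl r))
        ((Finset.univ : Finset (Fin (ℓ-1))).image (fun x => Sum.inr (Sum.inr (r, x))))) ?_) ?_
      · intro a; rcases a with a | a | a <;> simp [center]
        rintro rfl; exact ⟨a.2, rfl⟩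
      · refine le_trans (Finset.card_insert_le _ _) ?_
        have := Finset.card_image_le (s := (Finset.univ : Finset (Fin (ℓ-1))))
          (f := fun x => (Sum.inr (Sum.inr (r, x)) :
            Fin (ℓ * q) ⊕ Fin (t - q) ⊕ (Fin (t - q) × Fin (ℓ - 1))))
        simp at this
        omega
    · rw [Finset.card_eq_zero.2]; omega
      ext a; rcases a with a | a | a <;> simp [center]
  have hadj : ∀ a, s(leaf a, center a) ∈ (xGraph ℓ q t C).edgeSet := by
    intro a
    rw [SimpleGraph.mem_edgeSet, xGraph, SimpleGraph.fromRel_adj]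
    refine ⟨hne a a, ?_⟩
    rcases a with a | a | a <;> simp [leaf, center]
    exact (hJ a).2
  have heinj : Function.Injective (fun a => s(leaf a, center a)) := by
    intro a b h
    simp only [Sym2.eq_iff] at h
    rcases h with h | h
    · exact hinj h.1
    · exact absurd h.1 (hne _ _)
  set K : Finset (Sym2 (XVx ℓ q t)) := Finset.univ.image (fun a => s(leaf a, center a)) with hK
  have hKc : K.card = ℓ * t := by
    rw [hK, Finset.card_image_of_injective _ heinj]
    simp
    obtain ⟨d, rfl⟩ := Nat.exists_eq_add_of_le ht
    obtain ⟨m, rfl⟩ : ∃ m, ℓ = m + 1 := ⟨ℓ - 1, by omega⟩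
    simp
    ring
  have hKs : K ⊆ (xGraph ℓ q t C).edgeFinset := by
    intro e he
    simp only [hK, Finset.mem_image] at he
    obtain ⟨a, _, rfl⟩ := he
    rw [SimpleGraph.mem_edgeFinset]; exact hadj a
  refine ⟨(xGraph ℓ q t C).edgeFinset \ K, ?_, ?_, ?_⟩
  · intro e he
    have := (Finset.mem_sdiff.1 (Finset.mem_coe.1 he)).1
    rwa [SimpleGraph.mem_edgeFinset] at this
  · have h1 := Finset.card_sdiff_add_card_eq_card hKs
    rw [hKc] at h1
    have : (((xGraph ℓ q t C).edgeFinset \ K).card : ℤ) + ℓ * t = (xGraph ℓ q t C).edgeFinset.card := by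
      exact_mod_cast h1
    linarith
  · intro H
    refine star_bound ℓ leaf center hinj hne (fun r => by convert hfib r) _ ?_ H
    intro e he
    rw [SimpleGraph.edgeSet_deleteEdges] at he
    have h2 : e ∈ K := by
      by_contra h
      exact he.2 (Finset.mem_coe.2 (Finset.mem_sdiff.2 ⟨SimpleGraph.mem_edgeFinset.2 he.1, h⟩))
    simpa [hK] using h2

theorem comp_card {V : Type*} [Fintype V] (G : SimpleGraph V) (ℓ t : ℕ) (hℓ : 1 ≤ ℓ)
    (hV : Fintype.card V = (ℓ + 1) * t) (hE : ℓ * t ≤ G.edgeSet.ncard)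
    (hD : ∀ H : G.Subgraph, G.subDensity H ≤ (ℓ : ℚ) / (ℓ + 1)) (c : G.ConnectedComponent) :
    c.supp.ncard = ℓ + 1 := by
  have hD' : ∀ A : Set V, (ℓ + 1) * ((⊤ : G.Subgraph).induce A).edgeSet.ncard ≤ ℓ * A.ncard := by
    intro A
    have h := hD ((⊤ : G.Subgraph).induce A)
    unfold SimpleGraph.subDensity at h
    rw [SimpleGraph.Subgraph.induce_verts] at h
    rcases Nat.eq_zero_or_pos A.ncard with h0 | h0
    · have hA : A = ∅ := (Set.ncard_eq_zero (Set.toFinite _)).1 h0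
      have : ((⊤ : G.Subgraph).induce A).edgeSet = ∅ := by
        rw [Set.eq_empty_iff_forall_notMem]
        intro e
        induction e with | _ x y => simp [hA]
      rw [this]; simp
    · rw [div_le_div_iff₀ (by exact_mod_cast h0) (by positivity)] at h
      have : (ℓ + 1 : ℚ) * ((⊤ : G.Subgraph).induce A).edgeSet.ncard ≤ ℓ * A.ncard := by linarith
      exact_mod_cast this
  set A := c.supp with hA
  have h1 := hD' A
  have h2 := hD' Aᶜ
  have h3 : G.edgeSet.ncard ≤ ((⊤ : G.Subgraph).induce A).edgeSet.ncard +
      ((⊤ : G.Subgraph).induce Aᶜ).edgeSet.ncard := by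
    refine le_trans (Set.ncard_le_ncard ?_ (Set.toFinite _)) (Set.ncard_union_le _ _)
    intro e
    induction e with | _ x y =>
    intro h
    have h : G.Adj x y := h
    have := c.mem_supp_congr_adj h
    simp only [Set.mem_union, SimpleGraph.Subgraph.mem_edgeSet, SimpleGraph.Subgraph.induce_adj,
      SimpleGraph.Subgraph.top_adj, Set.mem_compl_iff, hA]
    tauto
  have h4 : A.ncard + Aᶜ.ncard = (ℓ + 1) * t := by
    rw [Set.ncard_add_ncard_compl, Nat.card_eq_fintype_card, hV]
  have h5 : A.ncard ≤ ((⊤ : G.Subgraph).induce A).edgeSet.ncard + 1 := by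
    have hc := c.connected_toSimpleGraph
    have hc' : ((⊤ : G.Subgraph).induce A).coe.Connected := by
      rw [← SimpleGraph.induce_eq_coe_induce_top]; exact hc
    have h := hc'.card_vert_le_card_edgeSet_add_one
    rw [← SimpleGraph.Subgraph.image_coe_edgeSet_coe, Set.ncard_image_of_injective _
      (Sym2.map.injective Subtype.val_injective)]
    exact h
  have h6 : 0 < A.ncard := (Set.ncard_pos (Set.toFinite _)).2 c.nonempty_supp
  generalize ((⊤ : G.Subgraph).induce A).edgeSet.ncard = e at *
  generalize ((⊤ : G.Subgraph).induce Aᶜ).edgeSet.ncard = e' at *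
  generalize A.ncard = a at *
  generalize Aᶜ.ncard = a' at *
  have h7 : (ℓ + 1) * e = ℓ * a := by nlinarith
  have h8 : a ≤ ℓ + 1 := by nlinarith
  have h9 : (ℓ + 1) ∣ a := by
    refine (Nat.Coprime.dvd_of_dvd_mul_left (m := ℓ) ?_ ⟨e, h7.symm⟩)
    simp
  exact le_antisymm h8 (Nat.le_of_dvd h6 h9)

theorem comp_count {V : Type*} [Fintype V] (G : SimpleGraph V) (ℓ t : ℕ)
    (hV : Fintype.card V = (ℓ + 1) * t) (h : ∀ c : G.ConnectedComponent, c.supp.ncard = ℓ + 1) :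
    Fintype.card G.ConnectedComponent = t := by
  have h1 := Finset.card_eq_sum_card_fiberwise (s := (Finset.univ : Finset V))
    (t := (Finset.univ : Finset G.ConnectedComponent)) (f := G.connectedComponentMk)
    (fun i _ => by simp)
  have h2 : ∀ c ∈ (Finset.univ : Finset G.ConnectedComponent),
      (Finset.univ.filter (fun v => G.connectedComponentMk v = c)).card = ℓ + 1 := by
    intro c _
    rw [← h c, ← Set.ncard_coe_finset]
    congr 1
    ext v; simp
  rw [Finset.sum_congr rfl h2] at h1
  simp [hV] at h1
  have : (ℓ + 1) * t = (ℓ + 1) * Fintype.card G.ConnectedComponent := by rw [h1]; ring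
  exact (Nat.eq_of_mul_eq_mul_left (by omega) this).symm

theorem supp_sub_closed {V : Type*} (G : SimpleGraph V) (A : Set V)
    (hA : ∀ x y, x ∈ A → G.Adj x y → y ∈ A) (x y : V) (hx : x ∈ A)
    (h : G.connectedComponentMk y = G.connectedComponentMk x) : y ∈ A := by
  have h : G.Reachable x y := SimpleGraph.ConnectedComponent.exact h.symm
  obtain ⟨p⟩ := h
  induction p with
  | nil => exact hx
  | cons hadj p ih => exact ih (hA _ _ hx hadj) (by
      exact SimpleGraph.ConnectedComponent.sound p.reachable.symm)

theorem forward (ℓ q t : ℕ) (hℓ : 3 ≤ ℓ) (ht : q ≤ t)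
    (C : Fin t → Finset (Fin (ℓ * q)))
    (hcard : ∀ j, (C j).card = ℓ)
    (F : Finset (Sym2 (XVx ℓ q t))) (hF : ↑F ⊆ (xGraph ℓ q t C).edgeSet)
    (hFc : (F.card : ℤ) ≤ ((xGraph ℓ q t C).edgeFinset.card : ℤ) - ℓ * t)
    (hD : ∀ H : ((xGraph ℓ q t C).deleteEdges ↑F).Subgraph,
        ((xGraph ℓ q t C).deleteEdges ↑F).subDensity H ≤ (ℓ : ℚ) / (ℓ + 1)) :
    (∃ S : Finset (Fin t), ∀ i : Fin (ℓ * q), ∃! j : Fin t, j ∈ S ∧ i ∈ C j) := by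
  have hV : Fintype.card (XVx ℓ q t) = (ℓ + 1) * t := by
    simp [XVx]
    obtain ⟨d, rfl⟩ := Nat.exists_eq_add_of_le ht
    obtain ⟨m, rfl⟩ : ∃ m, ℓ = m + 1 := ⟨ℓ - 1, by omega⟩
    simp
    ring
  have hle := SimpleGraph.deleteEdges_le (G := xGraph ℓ q t C) (↑F : Set (Sym2 (XVx ℓ q t)))
  have hE : ℓ * t ≤ ((xGraph ℓ q t C).deleteEdges ↑F).edgeSet.ncard := by
    rw [SimpleGraph.edgeSet_deleteEdges]
    have h1 := Set.ncard_sdiff_add_ncard_of_subset hF (Set.toFinite _)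
    rw [Set.ncard_coe_finset] at h1
    have h2 : (xGraph ℓ q t C).edgeSet.ncard = (xGraph ℓ q t C).edgeFinset.card := by
      rw [← Set.ncard_coe_finset, SimpleGraph.coe_edgeFinset]
    rw [← h2] at hFc
    zify at h1 ⊢
    linarith
  generalize (xGraph ℓ q t C).deleteEdges ↑F = G at *
  have hcc := comp_card G ℓ t (by omega) hV hE hD
  have hcnt := comp_count G ℓ t hV hcc
  have hsz : ∀ (v : XVx ℓ q t) (A : Finset (XVx ℓ q t)),
      (∀ w, G.connectedComponentMk w = G.connectedComponentMk v → w ∈ A) → ℓ + 1 ≤ A.card := by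
    intro v A h
    rw [← hcc (G.connectedComponentMk v), ← Set.ncard_coe_finset]
    exact Set.ncard_le_ncard (fun w hw => by simpa using h w hw) (Set.toFinite _)
  have hsz' : ∀ (v : XVx ℓ q t) (A : Finset (XVx ℓ q t)),
      (∀ w ∈ A, G.connectedComponentMk w = G.connectedComponentMk v) → A.card ≤ ℓ + 1 := by
    intro v A h
    rw [← hcc (G.connectedComponentMk v), ← Set.ncard_coe_finset A]
    exact Set.ncard_le_ncard (fun w hw => h w (by simpa using hw)) (Set.toFinite _)
  have hnb : ∀ v, ∃ w, G.Adj v w := by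
    intro v
    by_contra! h
    have := hsz v {v} (fun w hw => by
      have := supp_sub_closed G {v} (by rintro x y rfl hxy; exact absurd hxy (h y)) v w rfl hw
      simpa using this)
    simp at this
    omega
  -- neighbours
  have hy : ∀ i, ∃ j, i ∈ C j ∧
      G.connectedComponentMk (Sum.inr (Sum.inl j)) = G.connectedComponentMk (Sum.inl i) := by
    intro i
    obtain ⟨w, hw⟩ := hnb (Sum.inl i)
    have h2 := hle hw
    rw [xGraph, SimpleGraph.fromRel_adj] at h2
    rcases w with w | w | w | w <;> simp at h2
    exact ⟨w, h2, (SimpleGraph.ConnectedComponent.connectedComponentMk_eq_of_adj hw).symm⟩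
  have hz : ∀ z : Fin (t - q) × Fin (ℓ - 1),
      G.connectedComponentMk (Sum.inr (Sum.inr (Sum.inr z))) =
        G.connectedComponentMk (Sum.inr (Sum.inr (Sum.inl z.1))) := by
    intro z
    obtain ⟨w, hw⟩ := hnb (Sum.inr (Sum.inr (Sum.inr z)))
    have h2 := hle hw
    rw [xGraph, SimpleGraph.fromRel_adj] at h2
    rcases w with w | w | w | w <;> simp at h2
    rw [h2]
    exact (SimpleGraph.ConnectedComponent.connectedComponentMk_eq_of_adj hw)
  let ST : Fin (t - q) → Finset (XVx ℓ q t) := fun k =>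
    insert (Sum.inr (Sum.inr (Sum.inl k)))
      ((Finset.univ : Finset (Fin (ℓ - 1))).image (fun x => Sum.inr (Sum.inr (Sum.inr (k, x)))))
  have hST : ∀ k, (ST k).card = ℓ := by
    intro k
    rw [Finset.card_insert_of_notMem (by simp), Finset.card_image_of_injective]
    · simp; omega
    · intro a b h; simpa using h
  have hu : ∀ k, ∃ j, G.connectedComponentMk (Sum.inr (Sum.inl j)) =
      G.connectedComponentMk (Sum.inr (Sum.inr (Sum.inl k))) := by
    intro k
    by_cases hk : ∃ j, G.Adj (Sum.inr (Sum.inr (Sum.inl k))) (Sum.inr (Sum.inl j))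
    · obtain ⟨j, hj⟩ := hk
      exact ⟨j, (SimpleGraph.ConnectedComponent.connectedComponentMk_eq_of_adj hj).symm⟩
    · exfalso
      push Not at hk
      have := hsz (Sum.inr (Sum.inr (Sum.inl k))) (ST k) (fun w hw => by
        refine supp_sub_closed G (↑(ST k) : Set _) ?_ (Sum.inr (Sum.inr (Sum.inl k))) w
          (by simp [ST]) hw
        intro x y hx hxy
        simp only [ST, Finset.coe_insert, Finset.coe_image, Set.mem_insert_iff, Set.mem_image] at hx
        have h2 := hle hxy
        rw [xGraph, SimpleGraph.fromRel_adj] at h2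
        rcases hx with rfl | ⟨m, -, rfl⟩
        · rcases y with w | w | w | w <;> simp at h2
          · exact absurd hxy (hk w)
          · simp [ST]; exact ⟨w.2, by rw [← h2]⟩
        · rcases y with w | w | w | w <;> simp at h2
          simp [ST, h2])
      rw [hST] at this
      omega
  let φ : Fin t → G.ConnectedComponent := fun j => G.connectedComponentMk (Sum.inr (Sum.inl j))
  have hsurj : Function.Surjective φ := by
    intro c
    induction c using SimpleGraph.ConnectedComponent.ind with | _ v =>
    rcases v with v | v | v | v
    · obtain ⟨j, _, hj⟩ := hy v; exact ⟨j, hj⟩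
    · exact ⟨v, rfl⟩
    · exact hu v
    · obtain ⟨j, hj⟩ := hu v.1; exact ⟨j, hj.trans (hz v).symm⟩
  have hφ : Function.Injective φ :=
    ((Fintype.bijective_iff_surjective_and_card φ).2 ⟨hsurj, by rw [Fintype.card_fin]; convert hcnt.symm⟩).1
  refine ⟨Finset.univ.filter (fun j => ∀ k, G.connectedComponentMk (Sum.inr (Sum.inr (Sum.inl k)))
    ≠ φ j), ?_⟩
  intro i
  obtain ⟨j, hij, hj⟩ := hy i
  refine ⟨j, ⟨?_, hij⟩, ?_⟩
  · simp only [Finset.mem_filter, Finset.mem_univ, true_and]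
    intro k hk
    have := hsz' (Sum.inl i) (insert (Sum.inl i) (insert (Sum.inr (Sum.inl j)) (ST k))) (by
      intro w hw
      simp only [ST, Finset.mem_insert, Finset.mem_image] at hw
      rcases hw with rfl | rfl | rfl | ⟨m, -, rfl⟩
      · rfl
      · exact hj
      · exact hk.trans hj
      · exact (hz _).trans (hk.trans hj))
    rw [Finset.card_insert_of_notMem (by simp [ST]), Finset.card_insert_of_notMem (by simp [ST]),
      hST] at this
    omega
  · rintro j' ⟨hj', hij'⟩
    simp only [Finset.mem_filter, Finset.mem_univ, true_and] at hj'
    set Y := Finset.univ.filter (fun i => G.connectedComponentMk (Sum.inl i) = φ j') with hY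
    have hYC : Y ⊆ C j' := by
      intro i' hi'
      simp only [hY, Finset.mem_filter, Finset.mem_univ, true_and] at hi'
      obtain ⟨j2, h1, h2⟩ := hy i'
      have : j2 = j' := hφ (h2.trans hi')
      exact this ▸ h1
    have hYc : ℓ ≤ Y.card := by
      have := hsz (Sum.inr (Sum.inl j')) (insert (Sum.inr (Sum.inl j')) (Y.image Sum.inl)) (by
        intro w hw
        rcases w with w | w | w | w
        · simp [hY]; exact hw
        · have : w = j' := hφ hw
          simp [this]
        · exact absurd hw (hj' w)
        · exact absurd ((hz w).symm.trans hw) (hj' w.1))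
      have h2 := Finset.card_insert_le (Sum.inr (Sum.inl j') : XVx ℓ q t) (Y.image Sum.inl)
      have h3 := Finset.card_image_le (s := Y) (f := (Sum.inl : _ → XVx ℓ q t))
      omega
    have hYe := Finset.eq_of_subset_of_card_le hYC (by rw [hcard]; exact hYc)
    rw [← hYe] at hij'
    simp only [hY, Finset.mem_filter, Finset.mem_univ, true_and] at hij'
    exact hφ (hij'.symm.trans hj.symm)

/-- Correctness of the reduction from Exact Cover by ℓ-Sets to `τ`-Bounded-Density Edge
Deletion with `τ = ℓ/(ℓ+1)`: one can delete at most `m − ℓt` edges of the constructed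
graph so that every subgraph of the remainder has density at most `ℓ/(ℓ+1)` iff there is a
subcollection of `C` covering every element exactly once. -/
theorem boundedDensity_iff_exactCover (ℓ q t : ℕ) (hℓ : 3 ≤ ℓ) (hq : 1 ≤ q) (ht : q ≤ t)
    (C : Fin t → Finset (Fin (ℓ * q)))
    (hcard : ∀ j, (C j).card = ℓ)
    (hcover : ∀ i : Fin (ℓ * q), ∃ j, i ∈ C j) :
    (∃ F : Finset (Sym2 (XVx ℓ q t)), ↑F ⊆ (xGraph ℓ q t C).edgeSet ∧
      (F.card : ℤ) ≤ ((xGraph ℓ q t C).edgeFinset.card : ℤ) - ℓ * t ∧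
      ∀ H : ((xGraph ℓ q t C).deleteEdges ↑F).Subgraph,
        ((xGraph ℓ q t C).deleteEdges ↑F).subDensity H ≤ (ℓ : ℚ) / (ℓ + 1)) ↔
    (∃ S : Finset (Fin t), ∀ i : Fin (ℓ * q), ∃! j : Fin t, j ∈ S ∧ i ∈ C j) := by
  constructor
  · rintro ⟨F, h1, h2, h3⟩
    exact forward ℓ q t hℓ ht C hcard F h1 h2 h3
  · rintro ⟨S, hS⟩
    exact backward ℓ q t hℓ ht C hcard S hS
end

section
/- Let p and q be coprime positive integers with τ = p/q > 1, let G be a q-regular finite simple graph, and let k ∈ ℕ. Suppose that for every vertex v of G we are given a balanced finite simple graph H_v of density τ, an edge e_v of H_v with an endpoint x_v, and a fractional orientation φ_v of H_v such that deg⁻_{φ_v}(u) = τ for every vertex u of H_v and φ_v(e_v)^{x_v} = 1. Suppose further that for every edge e = {u,v} of G we are given a finite simple graph W_e with two distinct vertices w^e_u and w^e_v and two fractional orientations φ^e_1 and φ^e_2 of W_e such that deg⁻_{φ^e_1}(x) = deg⁻_{φ^e_2}(x) = τ for every vertex x of W_e other than w^e_u and w^e_v, deg⁻_{φ^e_1}(w^e_u)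 = deg⁻_{φ^e_2}(w^e_v) = τ − 1 + 1/q, and deg⁻_{φ^e_1}(w^e_v) = deg⁻_{φ^e_2}(w^e_u) = τ − 1. Let G' be the disjoint union of all graphs H_v (v ∈ V(G)) and W_e (e ∈ E(G)), together with, for every edge e = {u,v} of G, the two additional edges {x_u, w^e_u} and {x_v, w^e_v}. Then G has a vertex cover of size at most k if and only if there exists F ⊆ E(G') with |F| ≤ k and ρ*(G' − F) ≤ τ. -/
open scoped Classical

/-- The density `|E(G)|/|V(G)|` of a finite simple graph. -/
noncomputable def SimpleGraph.density {V : Type*} [Fintype V] (G : SimpleGraph V) : ℚ :=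
  (G.edgeSet.ncard : ℚ) / (Fintype.card V : ℚ)

/-- The graph `G'` of the reduction from Vertex Cover: the disjoint union of the vertex
gadgets `H v` (for `v ∈ V`) and the edge gadgets `We e` (for `e ∈ E(G)`), together with,
for every edge `e` and every endpoint `u` of `e`, a connecting edge between the special
vertex `xv u` of `H u` and the special vertex `sp e u` of `We e`. -/
def bigGraph {V : Type*} (G : SimpleGraph V)
    (Hty : V → Type*) (H : ∀ v, SimpleGraph (Hty v)) (xv : ∀ v, Hty v)
    (Wty : G.edgeSet → Type*) (We : ∀ e, SimpleGraph (Wty e))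
    (sp : ∀ e : G.edgeSet, V → Wty e) :
    SimpleGraph ((Σ v, Hty v) ⊕ (Σ e : G.edgeSet, Wty e)) :=
  SimpleGraph.fromRel (fun x y =>
    (∃ (v : V) (a b : Hty v), (H v).Adj a b ∧ x = Sum.inl ⟨v, a⟩ ∧ y = Sum.inl ⟨v, b⟩) ∨
    (∃ (e : G.edgeSet) (a b : Wty e),
      (We e).Adj a b ∧ x = Sum.inr ⟨e, a⟩ ∧ y = Sum.inr ⟨e, b⟩) ∨
    (∃ (u : V) (e : G.edgeSet),
      u ∈ (e : Sym2 V) ∧ x = Sum.inl ⟨u, xv u⟩ ∧ y = Sum.inr ⟨e, sp e u⟩))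


theorem edge_count_aux {X : Type*} [Fintype X] (G : SimpleGraph X) (f : X → X → ℚ)
    (hf : ∀ u v, G.Adj u v → f u v + f v u = 1) :
    (G.edgeSet.ncard : ℚ) = ∑ v, ∑ u, if G.Adj u v then f u v else 0 := by
  have h1 : (∑ v, ∑ u, if G.Adj u v then f u v else 0) +
      (∑ v, ∑ u, if G.Adj u v then f u v else 0) = ∑ v, (G.degree v : ℚ) := by
    have h0 : (∑ v, ∑ u, if G.Adj u v then f u v else 0) =
        ∑ v, ∑ u, if G.Adj v u then f v u else 0 := Finset.sum_comm
    nth_rewrite 2 [h0]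
    rw [← Finset.sum_add_distrib]
    refine Finset.sum_congr rfl fun v _ => ?_
    rw [← G.card_neighborFinset_eq_degree v, SimpleGraph.neighborFinset_eq_filter,
      Finset.card_filter, Nat.cast_sum, ← Finset.sum_add_distrib]
    refine Finset.sum_congr rfl fun u _ => ?_
    by_cases h : G.Adj u v
    · simp [h, h.symm, hf u v h]
    · have h' : ¬ G.Adj v u := fun h' => h h'.symm
      simp [h, h']
  have h2 := G.sum_degrees_eq_twice_card_edges
  have h3 : G.edgeSet.ncard = G.edgeFinset.card := by
    rw [← SimpleGraph.coe_edgeFinset, Set.ncard_coe_finset]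
  rw [h3]
  have h4 : (∑ v, (G.degree v : ℚ)) = 2 * (G.edgeFinset.card : ℚ) := by exact_mod_cast h2
  linarith

theorem subgraph_count_aux {X : Type*} [Fintype X] (G : SimpleGraph X) (f : X → X → ℚ)
    (hf : ∀ u v, G.Adj u v → f u v + f v u = 1) (Hs : G.Subgraph) :
    (Hs.edgeSet.ncard : ℚ) = ∑ v, ∑ u, if Hs.Adj u v then f u v else 0 := by
  have := edge_count_aux Hs.spanningCoe f (fun u v h => hf u v (Hs.adj_sub h))
  rw [SimpleGraph.Subgraph.edgeSet_spanningCoe] at this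
  simpa using this

theorem density_le_aux {X : Type*} [Fintype X] (G : SimpleGraph X) (f : X → X → ℚ)
    (hf : ∀ u v, G.Adj u v → f u v + f v u = 1) (hn : ∀ u v, G.Adj u v → 0 ≤ f u v)
    (τ : ℚ) (hτ : 0 ≤ τ) (hd : ∀ v, (∑ u, if G.Adj u v then f u v else 0) ≤ τ)
    (Hs : G.Subgraph) : G.subDensity Hs ≤ τ := by
  unfold SimpleGraph.subDensity
  refine div_le_of_le_mul₀ (by positivity) hτ ?_
  rw [subgraph_count_aux G f hf Hs]
  have hv : (Hs.verts.ncard : ℚ) = ∑ v, if v ∈ Hs.verts then (1 : ℚ) else 0 := by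
    rw [Set.ncard_eq_toFinset_card']
    simp
  rw [hv, Finset.mul_sum]
  refine Finset.sum_le_sum fun v _ => ?_
  by_cases h : v ∈ Hs.verts
  · simp only [h, if_true, mul_one]
    refine le_trans (Finset.sum_le_sum fun u _ => ?_) (hd v)
    by_cases h1 : Hs.Adj u v
    · simp [h1, Hs.adj_sub h1]
    · by_cases h2 : G.Adj u v
      · simp [h1, h2, hn u v h2]
      · simp [h1, h2]
  · simp only [h, if_false, mul_zero]
    refine le_of_eq (Finset.sum_eq_zero fun u _ => ?_)
    rw [if_neg]
    intro h1
    exact h (Hs.edge_vert h1.symm)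

theorem induce_count_aux {X : Type*} [Fintype X] (G : SimpleGraph X) (f : X → X → ℚ)
    (hf : ∀ u v, G.Adj u v → f u v + f v u = 1)
    (τ : ℚ) (hd : ∀ Hs : G.Subgraph, G.subDensity Hs ≤ τ) (A : Finset X) :
    (∑ v ∈ A, ∑ u, if u ∈ A ∧ G.Adj u v then f u v else 0) ≤ τ * A.card := by
  rcases A.eq_empty_or_nonempty with rfl | hA
  · simp
  have h := hd ((⊤ : G.Subgraph).induce (A : Set X))
  unfold SimpleGraph.subDensity at h
  rw [subgraph_count_aux G f hf] at h
  have hc : ((⊤ : G.Subgraph).induce (A : Set X)).verts.ncard = A.card := by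
    simp
  rw [hc, div_le_iff₀ (by exact_mod_cast hA.card_pos)] at h
  refine le_trans (le_of_eq ?_) h
  rw [← Finset.sum_subset (Finset.subset_univ A)]
  · refine Finset.sum_congr rfl fun v hv => Finset.sum_congr rfl fun u _ => ?_
    simp [hv]
  · intro v _ hv
    simp [hv]

section big
variable {V : Type*} (G : SimpleGraph V)
    (Hty : V → Type*) (H : ∀ v, SimpleGraph (Hty v)) (xv : ∀ v, Hty v)
    (Wty : G.edgeSet → Type*) (We : ∀ e, SimpleGraph (Wty e))
    (sp : ∀ e : G.edgeSet, V → Wty e)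

theorem big_adj_ll (v : V) (a b : Hty v) :
    (bigGraph G Hty H xv Wty We sp).Adj (Sum.inl ⟨v, a⟩) (Sum.inl ⟨v, b⟩) ↔ (H v).Adj a b := by
  unfold bigGraph
  rw [SimpleGraph.fromRel_adj]
  constructor
  · rintro ⟨_, (⟨v', a', b', h, h1, h2⟩ | ⟨_, _, _, _, h, _⟩ | ⟨_, _, _, _, h⟩) |
      (⟨v', a', b', h, h1, h2⟩ | ⟨_, _, _, _, h, _⟩ | ⟨_, _, _, _, h⟩)⟩
    · cases h1; cases h2; exact h
    · cases h
    · cases h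
    · cases h1; cases h2; exact h.symm
    · cases h
    · cases h
  · intro h
    refine ⟨?_, Or.inl (Or.inl ⟨v, a, b, h, rfl, rfl⟩)⟩
    intro h'
    cases h'
    exact h.ne rfl

theorem big_adj_ll_eq (x y : Σ v, Hty v)
    (h : (bigGraph G Hty H xv Wty We sp).Adj (Sum.inl x) (Sum.inl y)) : x.1 = y.1 := by
  unfold bigGraph at h
  rw [SimpleGraph.fromRel_adj] at h
  rcases h with ⟨_, (⟨v', a', b', h, h1, h2⟩ | ⟨_, _, _, _, h, _⟩ | ⟨_, _, _, _, h⟩) |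
      (⟨v', a', b', h, h1, h2⟩ | ⟨_, _, _, _, h, _⟩ | ⟨_, _, _, _, h⟩)⟩
  · cases h1; cases h2; rfl
  · cases h
  · cases h
  · cases h1; cases h2; rfl
  · cases h
  · cases h

theorem big_adj_rr (e : G.edgeSet) (a b : Wty e) :
    (bigGraph G Hty H xv Wty We sp).Adj (Sum.inr ⟨e, a⟩) (Sum.inr ⟨e, b⟩) ↔ (We e).Adj a b := by
  unfold bigGraph
  rw [SimpleGraph.fromRel_adj]
  constructor
  · rintro ⟨_, (⟨_, _, _, _, h, _⟩ | ⟨v', a', b', h, h1, h2⟩ | ⟨_, _, _, h, _⟩) |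
      (⟨_, _, _, _, h, _⟩ | ⟨v', a', b', h, h1, h2⟩ | ⟨_, _, _, h, _⟩)⟩
    · cases h
    · cases h1; cases h2; exact h
    · cases h
    · cases h
    · cases h1; cases h2; exact h.symm
    · cases h
  · intro h
    refine ⟨?_, Or.inl (Or.inr (Or.inl ⟨e, a, b, h, rfl, rfl⟩))⟩
    intro h'
    cases h'
    exact h.ne rfl

theorem big_adj_rr_eq (x y : Σ e, Wty e)
    (h : (bigGraph G Hty H xv Wty We sp).Adj (Sum.inr x) (Sum.inr y)) : x.1 = y.1 := by
  unfold bigGraph at h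
  rw [SimpleGraph.fromRel_adj] at h
  rcases h with ⟨_, (⟨_, _, _, _, h, _⟩ | ⟨v', a', b', h, h1, h2⟩ | ⟨_, _, _, h, _⟩) |
      (⟨_, _, _, _, h, _⟩ | ⟨v', a', b', h, h1, h2⟩ | ⟨_, _, _, h, _⟩)⟩
  · cases h
  · cases h1; cases h2; rfl
  · cases h
  · cases h
  · cases h1; cases h2; rfl
  · cases h

theorem big_adj_lr (v : V) (a : Hty v) (e : G.edgeSet) (b : Wty e) :
    (bigGraph G Hty H xv Wty We sp).Adj (Sum.inl ⟨v, a⟩) (Sum.inr ⟨e, b⟩) ↔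
      v ∈ (e : Sym2 V) ∧ a = xv v ∧ b = sp e v := by
  unfold bigGraph
  rw [SimpleGraph.fromRel_adj]
  constructor
  · rintro ⟨_, (⟨_, _, _, _, _, h⟩ | ⟨_, _, _, _, h, _⟩ | ⟨u, e', h, h1, h2⟩) |
      (⟨_, _, _, _, h, _⟩ | ⟨_, _, _, _, _, h⟩ | ⟨_, _, _, h, _⟩)⟩
    · cases h
    · cases h
    · cases h1; cases h2; exact ⟨h, rfl, rfl⟩
    · cases h
    · cases h
    · cases h
  · rintro ⟨h, rfl, rfl⟩
    exact ⟨by simp, Or.inl (Or.inr (Or.inr ⟨v, e, h, rfl, rfl⟩))⟩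

theorem big_adj_rl (v : V) (a : Hty v) (e : G.edgeSet) (b : Wty e) :
    (bigGraph G Hty H xv Wty We sp).Adj (Sum.inr ⟨e, b⟩) (Sum.inl ⟨v, a⟩) ↔
      v ∈ (e : Sym2 V) ∧ a = xv v ∧ b = sp e v := by
  rw [SimpleGraph.adj_comm, big_adj_lr]

variable (φH : ∀ v, (H v).FracOrientation) (φW : ∀ e, (We e).FracOrientation)
  (c : V → G.edgeSet → ℚ)

noncomputable def bigF :
    ((Σ v, Hty v) ⊕ (Σ e : G.edgeSet, Wty e)) → ((Σ v, Hty v) ⊕ (Σ e : G.edgeSet, Wty e)) → ℚ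
  | Sum.inl x, Sum.inl y => if h : x.1 = y.1 then (φH y.1).toFun (h ▸ x.2) y.2 else 0
  | Sum.inr x, Sum.inr y => if h : x.1 = y.1 then (φW y.1).toFun (h ▸ x.2) y.2 else 0
  | Sum.inl x, Sum.inr y => c x.1 y.1
  | Sum.inr x, Sum.inl y => 1 - c y.1 x.1

theorem bigF_sum (x y : (Σ v, Hty v) ⊕ (Σ e : G.edgeSet, Wty e))
    (h : (bigGraph G Hty H xv Wty We sp).Adj x y) :
    bigF G Hty H Wty We φH φW c x y + bigF G Hty H Wty We φH φW c y x = 1 := by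
  rcases x with ⟨v, a⟩ | ⟨e, a⟩ <;> rcases y with ⟨v', b⟩ | ⟨e', b⟩
  · obtain rfl : v = v' := big_adj_ll_eq _ _ _ _ _ _ _ _ _ h
    rw [big_adj_ll] at h
    simpa [bigF] using (φH v).sum_eq_one a b h
  · simp [bigF]
  · simp [bigF]
  · obtain rfl : e = e' := big_adj_rr_eq _ _ _ _ _ _ _ _ _ h
    rw [big_adj_rr] at h
    simpa [bigF] using (φW e).sum_eq_one a b h

theorem bigF_nonneg (hc0 : ∀ u e, 0 ≤ c u e) (hc1 : ∀ u e, c u e ≤ 1)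
    (x y : (Σ v, Hty v) ⊕ (Σ e : G.edgeSet, Wty e))
    (h : (bigGraph G Hty H xv Wty We sp).Adj x y) :
    0 ≤ bigF G Hty H Wty We φH φW c x y := by
  rcases x with ⟨v, a⟩ | ⟨e, a⟩ <;> rcases y with ⟨v', b⟩ | ⟨e', b⟩
  · obtain rfl : v = v' := big_adj_ll_eq _ _ _ _ _ _ _ _ _ h
    rw [big_adj_ll] at h
    simpa [bigF] using (φH v).nonneg a b h
  · simp [bigF, hc0]
  · simp [bigF, hc1]
  · obtain rfl : e = e' := big_adj_rr_eq _ _ _ _ _ _ _ _ _ h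
    rw [big_adj_rr] at h
    simpa [bigF] using (φW e).nonneg a b h

variable [Fintype V] [Fintype G.edgeSet] [∀ v, Fintype (Hty v)] [∀ e, Fintype (Wty e)]

theorem bigF_inl [DecidableEq V] (v : V) (a : Hty v) :
    (∑ x, if (bigGraph G Hty H xv Wty We sp).Adj x (Sum.inl ⟨v, a⟩) then
      bigF G Hty H Wty We φH φW c x (Sum.inl ⟨v, a⟩) else 0) =
    (φH v).inDeg a + if a = xv v then
      ∑ e : G.edgeSet, if v ∈ (e : Sym2 V) then 1 - c v e else 0 else 0 := by
  rw [Fintype.sum_sum_type, Fintype.sum_sigma, Fintype.sum_sigma]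
  congr 1
  · rw [Finset.sum_eq_single v]
    · simp only [big_adj_ll]
      rw [SimpleGraph.FracOrientation.inDeg, Finset.sum_filter]
      simp [bigF]
    · intro w _ hw
      refine Finset.sum_eq_zero fun b _ => ?_
      rw [if_neg]
      intro h
      exact hw (big_adj_ll_eq _ _ _ _ _ _ _ _ _ h)
    · simp
  · simp only [big_adj_rl, bigF]
    by_cases ha : a = xv v
    · simp only [ha, true_and, if_true]
      refine Finset.sum_congr rfl fun e _ => ?_
      by_cases hv : v ∈ (e : Sym2 V) <;> simp [hv]
    · simp [ha]

theorem bigF_inr (e : G.edgeSet) (b : Wty e) (u v : V) (he : (e : Sym2 V) = s(u, v))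
    (huv : sp e u ≠ sp e v) :
    (∑ x, if (bigGraph G Hty H xv Wty We sp).Adj x (Sum.inr ⟨e, b⟩) then
      bigF G Hty H Wty We φH φW c x (Sum.inr ⟨e, b⟩) else 0) =
    (φW e).inDeg b + ((if b = sp e u then c u e else 0) + if b = sp e v then c v e else 0) := by
  have hne : u ≠ v := fun h => huv (by rw [h])
  rw [Fintype.sum_sum_type, Fintype.sum_sigma, Fintype.sum_sigma, add_comm]
  congr 1
  · rw [Finset.sum_eq_single e]
    · simp only [big_adj_rr]
      rw [SimpleGraph.FracOrientation.inDeg, Finset.sum_filter]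
      simp [bigF]
    · intro w _ hw
      refine Finset.sum_eq_zero fun b _ => ?_
      rw [if_neg]
      intro h
      exact hw (big_adj_rr_eq _ _ _ _ _ _ _ _ _ h)
    · simp
  · simp only [big_adj_lr, bigF]
    have h1 : ∀ w : V, (∑ a : Hty w, if w ∈ (e : Sym2 V) ∧ a = xv w ∧ b = sp e w then c w e else 0)
        = if w ∈ (e : Sym2 V) ∧ b = sp e w then c w e else 0 := by
      intro w
      rw [Finset.sum_eq_single (xv w)]
      · simp
      · intro a _ ha
        simp [ha]
      · simp
    simp only [h1]
    rw [← Finset.sum_subset (Finset.subset_univ {u, v})]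
    · rw [Finset.sum_pair hne]
      simp [he]
    · intro w _ hw
      rw [he]
      simp at hw
      simp [hw]

end big

set_option maxHeartbeats 2000000 in
/-- Correctness of the reduction from Vertex Cover (on `q`-regular graphs) to
`τ`-Bounded-Density Edge Deletion for `τ = p/q > 1` with `p, q` coprime: given balanced
vertex gadgets `H v` of density `τ` with an edge `e_v = {yv v, xv v}` fully assignable to
`x_v` in an everywhere-`τ` fractional orientation, and edge gadgets `We e` with the two
special vertices and pairs of fractional orientations as produced by the edge-gadget
lemma, the graph `G` has a vertex cover of size at most `k` iff one can delete at most `k`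
edges from `G'` so that every subgraph of the remainder has density at most `τ`. -/
theorem vertexCover_iff_boundedDensityEdgeDeletion {V : Type*} [Fintype V] [DecidableEq V]
    (G : SimpleGraph V) [DecidableRel G.Adj]
    (p q : ℕ) (hp : 0 < p) (hq : 0 < q) (hco : Nat.Coprime p q) (hτ : 1 < (p : ℚ) / q)
    (hreg : ∀ v : V, G.degree v = q) (k : ℕ)
    (Hty : V → Type*) [∀ v, Fintype (Hty v)] (H : ∀ v, SimpleGraph (Hty v))
    (xv yv : ∀ v, Hty v) (hadj : ∀ v, (H v).Adj (yv v) (xv v))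
    (hdens : ∀ v, (H v).density = (p : ℚ) / q)
    (hbal : ∀ v, ∀ S : (H v).Subgraph, (H v).subDensity S ≤ (p : ℚ) / q)
    (φH : ∀ v, (H v).FracOrientation)
    (hφH : ∀ v, (∀ x, (φH v).inDeg x = (p : ℚ) / q) ∧ (φH v).toFun (yv v) (xv v) = 1)
    (Wty : G.edgeSet → Type*) [∀ e, Fintype (Wty e)] (We : ∀ e, SimpleGraph (Wty e))
    (sp : ∀ e : G.edgeSet, V → Wty e)
    (hW : ∀ (e : G.edgeSet) (u v : V), (e : Sym2 V) = s(u, v) →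
      sp e u ≠ sp e v ∧
      ∃ φ1 φ2 : (We e).FracOrientation,
        (∀ x : Wty e, x ≠ sp e u → x ≠ sp e v →
          φ1.inDeg x = (p : ℚ) / q ∧ φ2.inDeg x = (p : ℚ) / q) ∧
        φ1.inDeg (sp e u) = (p : ℚ) / q - 1 + 1 / q ∧
        φ2.inDeg (sp e v) = (p : ℚ) / q - 1 + 1 / q ∧
        φ1.inDeg (sp e v) = (p : ℚ) / q - 1 ∧
        φ2.inDeg (sp e u) = (p : ℚ) / q - 1) :
    (∃ S : Finset V, S.card ≤ k ∧ ∀ u v : V, G.Adj u v → u ∈ S ∨ v ∈ S) ↔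
    (∃ F : Finset (Sym2 ((Σ v, Hty v) ⊕ (Σ e : G.edgeSet, Wty e))),
      ↑F ⊆ (bigGraph G Hty H xv Wty We sp).edgeSet ∧ F.card ≤ k ∧
      ∀ Hs : ((bigGraph G Hty H xv Wty We sp).deleteEdges ↑F).Subgraph,
        ((bigGraph G Hty H xv Wty We sp).deleteEdges ↑F).subDensity Hs ≤ (p : ℚ) / q) := by
  have hq0 : (0 : ℚ) < q := by exact_mod_cast hq
  have hq1 : (1 : ℚ) / q ≤ 1 := by
    rw [div_le_one hq0]; exact_mod_cast hq
  have hqp : (0 : ℚ) < 1 / q := by positivity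
  have hτ0 : (0 : ℚ) ≤ (p : ℚ) / q := by positivity
  set τ : ℚ := (p : ℚ) / q with hτdef
  -- choice of an orientation for every edge and every endpoint
  have hW' : ∀ (e : G.edgeSet) (u : V), u ∈ (e : Sym2 V) → ∃ v, (e : Sym2 V) = s(u, v) ∧
      u ≠ v ∧ sp e u ≠ sp e v ∧ ∃ φ : (We e).FracOrientation,
        (∀ x : Wty e, x ≠ sp e u → x ≠ sp e v → φ.inDeg x = τ) ∧
        φ.inDeg (sp e u) = τ - 1 + 1 / q ∧ φ.inDeg (sp e v) = τ - 1 := by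
    intro e u hu
    obtain ⟨v, hv⟩ := Sym2.mem_iff_exists.1 hu
    obtain ⟨h1, φ1, φ2, h2, h3, h4, h5, h6⟩ := hW e u v hv
    exact ⟨v, hv, fun h => h1 (by rw [h]), h1, φ1, fun x hx hx' => (h2 x hx hx').1, h3, h5⟩
  constructor
  · rintro ⟨S, hSk, hS⟩
    have hch : ∀ e : G.edgeSet, ∃ u, u ∈ (e : Sym2 V) ∧ u ∈ S := by
      rintro ⟨e, he⟩
      induction e with
      | _ u v =>
        rcases hS u v he with h | h
        · exact ⟨u, by simp, h⟩
        · exact ⟨v, by simp, h⟩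
    choose ch hch1 hch2 using hch
    choose ot ho1 ho2 ho3 φW hφ1 hφ2 hφ3 using fun e => hW' e (ch e) (hch1 e)
    set c : V → G.edgeSet → ℚ := fun u e => if u = ch e then 1 - 1 / q else 1 with hc
    have hc0 : ∀ u e, 0 ≤ c u e := by
      intro u e
      simp only [hc]
      split_ifs <;> linarith
    have hc1 : ∀ u e, c u e ≤ 1 := by
      intro u e
      simp only [hc]
      split_ifs <;> linarith
    set F : Finset (Sym2 ((Σ v, Hty v) ⊕ (Σ e : G.edgeSet, Wty e))) :=
      S.image (fun v => s(Sum.inl ⟨v, yv v⟩, Sum.inl ⟨v, xv v⟩)) with hF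
    have hsum := bigF_sum G Hty H xv Wty We sp φH φW c
    have hnn := bigF_nonneg G Hty H xv Wty We sp φH φW c hc0 hc1
    refine ⟨F, ?_, le_trans Finset.card_image_le hSk, ?_⟩
    · intro z hz
      simp only [hF, Finset.coe_image, Set.mem_image] at hz
      obtain ⟨v, _, rfl⟩ := hz
      rw [SimpleGraph.mem_edgeSet, big_adj_ll]
      exact hadj v
    · refine density_le_aux _ (bigF G Hty H Wty We φH φW c)
        (fun u v h => hsum u v (SimpleGraph.deleteEdges_le _ h))
        (fun u v h => hnn u v (SimpleGraph.deleteEdges_le _ h)) τ hτ0 ?_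
      suffices hd : ∀ y, (∑ x, if ((bigGraph G Hty H xv Wty We sp).deleteEdges ↑F).Adj x y then
          bigF G Hty H Wty We φH φW c x y else 0) ≤ τ by
        intro y
        convert hd y
      have hle : ∀ y, (∑ x, if ((bigGraph G Hty H xv Wty We sp).deleteEdges ↑F).Adj x y then
          bigF G Hty H Wty We φH φW c x y else 0) ≤
          ∑ x, if (bigGraph G Hty H xv Wty We sp).Adj x y then
          bigF G Hty H Wty We φH φW c x y else 0 := by
        intro y
        refine Finset.sum_le_sum fun x _ => ?_
        by_cases h1 : ((bigGraph G Hty H xv Wty We sp).deleteEdges ↑F).Adj x y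
        · rw [if_pos h1, if_pos (SimpleGraph.deleteEdges_le _ h1)]
        · rw [if_neg h1]
          split_ifs with h2
          · exact hnn x y h2
          · exact le_rfl
      rintro (⟨v, a⟩ | ⟨e, b⟩)
      · have hfull := bigF_inl G Hty H xv Wty We sp φH φW c v a
        rw [(hφH v).1 a] at hfull
        by_cases ha : a = xv v
        · subst ha
          rw [if_pos rfl] at hfull
          by_cases hv : v ∈ S
          · have hdeg : (∑ e : G.edgeSet, if v ∈ (e : Sym2 V) then 1 - c v e else 0) ≤ 1 := by
              have h1 : (∑ e : G.edgeSet, if v ∈ (e : Sym2 V) then 1 - c v e else 0) ≤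
                  ∑ e : G.edgeSet, if v ∈ (e : Sym2 V) then 1 / (q : ℚ) else 0 := by
                refine Finset.sum_le_sum fun e _ => ?_
                split_ifs
                · simp only [hc]
                  split_ifs <;> linarith
                · exact le_rfl
              have h2 : (Finset.univ.filter (fun e : G.edgeSet => v ∈ (e : Sym2 V))).card = q := by
                rw [← hreg v, ← SimpleGraph.card_incidenceFinset_eq_degree]
                refine Finset.card_bij (fun e _ => (e : Sym2 V)) ?_ ?_ ?_
                · rintro ⟨e, he⟩ h
                  simp at h
                  simp [SimpleGraph.incidenceSet, h]
                  simpa using he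
                · intro e _ e' _ h
                  exact Subtype.ext h
                · intro e he
                  simp [SimpleGraph.incidenceSet] at he
                  exact ⟨⟨e, he.1⟩, by simp [he.2], rfl⟩
              have h3 : (∑ e : G.edgeSet, if v ∈ (e : Sym2 V) then 1 / (q : ℚ) else 0) =
                  q * (1 / (q : ℚ)) := by
                rw [← Finset.sum_filter, Finset.sum_const, h2, nsmul_eq_mul]
              rw [h3, mul_one_div_cancel hq0.ne'] at h1
              exact h1
            have hlt : (∑ x, if ((bigGraph G Hty H xv Wty We sp).deleteEdges ↑F).Adj x
                (Sum.inl ⟨v, xv v⟩) then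
                bigF G Hty H Wty We φH φW c x (Sum.inl ⟨v, xv v⟩) else 0) + 1 ≤
              ∑ x, if (bigGraph G Hty H xv Wty We sp).Adj x (Sum.inl ⟨v, xv v⟩) then
                bigF G Hty H Wty We φH φW c x (Sum.inl ⟨v, xv v⟩) else 0 := by
              have h1 : (1 : ℚ) = ∑ x : (Σ v, Hty v) ⊕ (Σ e : G.edgeSet, Wty e),
                  if x = Sum.inl ⟨v, yv v⟩ then 1 else 0 := by simp
              rw [h1, ← Finset.sum_add_distrib]
              refine Finset.sum_le_sum fun x _ => ?_
              by_cases hx : x = Sum.inl ⟨v, yv v⟩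
              · subst hx
                rw [if_neg, if_pos rfl, if_pos]
                · have := (hφH v).2
                  simp [bigF, this]
                · rw [big_adj_ll]; exact hadj v
                · rw [SimpleGraph.deleteEdges_adj]
                  rintro ⟨_, h⟩
                  apply h
                  simp only [hF, Finset.coe_image, Set.mem_image]
                  exact ⟨v, hv, rfl⟩
              · rw [if_neg hx, add_zero]
                by_cases h1 : ((bigGraph G Hty H xv Wty We sp).deleteEdges ↑F).Adj x
                  (Sum.inl ⟨v, xv v⟩)
                · rw [if_pos h1, if_pos (SimpleGraph.deleteEdges_le _ h1)]
                · rw [if_neg h1]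
                  split_ifs with h2
                  · exact hnn x _ h2
                  · exact le_rfl
            linarith
          · refine le_trans (hle _) ?_
            rw [hfull]
            have : (∑ e : G.edgeSet, if v ∈ (e : Sym2 V) then 1 - c v e else 0) = 0 := by
              refine Finset.sum_eq_zero fun e _ => ?_
              have : v ≠ ch e := fun h => hv (h ▸ hch2 e)
              simp [hc, this]
            linarith
        · rw [if_neg ha, add_zero] at hfull
          exact le_trans (hle _) hfull.le
      · refine le_trans (hle _) ?_
        rw [bigF_inr G Hty H xv Wty We sp φH φW c e b (ch e) (ot e) (ho1 e) (ho3 e)]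
        by_cases h1 : b = sp e (ch e)
        · subst h1
          rw [if_pos rfl, if_neg (ho3 e), hφ2 e]
          simp only [hc, if_true]
          linarith
        · by_cases h2 : b = sp e (ot e)
          · subst h2
            rw [if_pos rfl, if_neg (ho3 e).symm, hφ3 e]
            simp only [hc, if_neg (ho2 e).symm]
            linarith
          · rw [if_neg h1, if_neg h2, hφ1 e b h1 h2]
            linarith
  · rintro ⟨F, hFE, hFk, hF⟩
    let P : G.edgeSet → ((Σ v, Hty v) ⊕ (Σ e : G.edgeSet, Wty e)) → Prop := fun e x =>
      match x with
      | Sum.inl x => x.1 ∈ (e : Sym2 V)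
      | Sum.inr x => x.1 = e
    have key : ∀ e : G.edgeSet, ∃ z ∈ F, ∀ x ∈ z, P e x := by
      intro e
      by_contra hcon
      push Not at hcon
      obtain ⟨u, hu⟩ : ∃ u, u ∈ (e : Sym2 V) := ⟨_, Sym2.out_fst_mem _⟩
      obtain ⟨v, he, huv, hsp, φ, h1, h2, h3⟩ := hW' e u hu
      have hex : ∀ e' : G.edgeSet, ∃ φ' : (We e').FracOrientation,
          ∀ h : e' = e, h ▸ φ' = φ := by
        intro e'
        by_cases h : e' = e
        · subst h
          exact ⟨φ, fun _ => rfl⟩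
        · obtain ⟨_, _, _, _, φ', _⟩ := hW' e' _ (Sym2.out_fst_mem _)
          exact ⟨φ', fun h' => absurd h' h⟩
      choose φW hφW using hex
      have hφe : φW e = φ := hφW e rfl
      let A : Finset ((Σ v, Hty v) ⊕ (Σ e : G.edgeSet, Wty e)) := Finset.univ.filter (P e)
      have hsum := bigF_sum G Hty H xv Wty We sp φH φW (fun _ _ => 1)
      have hI : (∑ y ∈ A, ∑ x, if x ∈ A ∧
          ((bigGraph G Hty H xv Wty We sp).deleteEdges ↑F).Adj x y then
          bigF G Hty H Wty We φH φW (fun _ _ => 1) x y else 0) ≤ τ * A.card := by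
        convert induce_count_aux _ (bigF G Hty H Wty We φH φW (fun _ _ => 1))
          (fun u v h => hsum u v (SimpleGraph.deleteEdges_le _ h)) τ hF A
      have hrow : ∀ y ∈ A, (∑ x, if x ∈ A ∧
          ((bigGraph G Hty H xv Wty We sp).deleteEdges ↑F).Adj x y then
          bigF G Hty H Wty We φH φW (fun _ _ => 1) x y else 0) =
          ∑ x, if (bigGraph G Hty H xv Wty We sp).Adj x y then
          bigF G Hty H Wty We φH φW (fun _ _ => 1) x y else 0 := by
        intro y hy
        have hPy : P e y := by simpa [A] using hy
        refine Finset.sum_congr rfl fun x _ => ?_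
        by_cases hxy : (bigGraph G Hty H xv Wty We sp).Adj x y
        · rw [if_pos hxy]
          by_cases hx : x ∈ A
          · have hPx : P e x := by simpa [A] using hx
            rw [if_pos]
            refine ⟨hx, ?_⟩
            rw [SimpleGraph.deleteEdges_adj]
            refine ⟨hxy, fun hz => ?_⟩
            obtain ⟨w, hw, hw'⟩ := hcon _ hz
            rcases Sym2.mem_iff.1 hw with rfl | rfl
            · exact hw' hPx
            · exact hw' hPy
          · rw [if_neg (fun h => hx h.1)]
            have hPx : ¬ P e x := by simpa [A] using hx
            rcases x with ⟨v, a⟩ | ⟨e', a⟩ <;> rcases y with ⟨v', b⟩ | ⟨e'', b⟩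
            · exfalso
              have : v = v' := big_adj_ll_eq _ _ _ _ _ _ _ _ _ hxy
              subst this
              exact hPx hPy
            · exfalso
              rw [big_adj_lr] at hxy
              have : e'' = e := hPy
              subst this
              exact hPx hxy.1
            · simp [bigF]
            · exfalso
              have : e' = e'' := big_adj_rr_eq _ _ _ _ _ _ _ _ _ hxy
              subst this
              exact hPx hPy
        · rw [if_neg hxy, if_neg]
          exact fun h => hxy (SimpleGraph.deleteEdges_le _ h.2)
      rw [Finset.sum_congr rfl hrow] at hI
      have hval : ∀ y ∈ A, (∑ x, if (bigGraph G Hty H xv Wty We sp).Adj x y then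
          bigF G Hty H Wty We φH φW (fun _ _ => 1) x y else 0) =
          τ + if y = Sum.inr ⟨e, sp e u⟩ then 1 / (q : ℚ) else 0 := by
        intro y hy
        have hPy : P e y := by simpa [A] using hy
        rcases y with ⟨v', b⟩ | ⟨e'', b⟩
        · rw [bigF_inl, (hφH v').1 b]
          simp
        · have : e'' = e := hPy
          subst this
          rw [bigF_inr G Hty H xv Wty We sp φH φW _ e'' b u v he hsp, hφe]
          by_cases hb1 : b = sp e'' u
          · subst hb1
            rw [if_pos rfl, if_neg hsp, if_pos rfl, h2]
            ring
          · have hb1' : ¬ ((Sum.inr ⟨e'', b⟩ : (Σ v, Hty v) ⊕ (Σ e : G.edgeSet, Wty e)) =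
                Sum.inr ⟨e'', sp e'' u⟩) := by
              intro h
              apply hb1
              cases h
              rfl
            rw [if_neg hb1, if_neg hb1']
            by_cases hb2 : b = sp e'' v
            · subst hb2
              rw [if_pos rfl, h3]
              ring
            · rw [if_neg hb2, h1 b hb1 hb2]
              ring
      rw [Finset.sum_congr rfl hval, Finset.sum_add_distrib, Finset.sum_const,
        Finset.sum_ite_eq', if_pos, nsmul_eq_mul] at hI
      · linarith
      · simp [A, P]
    have hh : ∀ z : {z // z ∈ F}, ∃ v : V, ∀ e : G.edgeSet, (∀ x ∈ z.1, P e x) →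
        v ∈ (e : Sym2 V) := by
      rintro ⟨z, hz⟩
      induction z with
      | _ x y =>
        have hxy : (bigGraph G Hty H xv Wty We sp).Adj x y := hFE hz
        rcases x with ⟨v, a⟩ | ⟨e', a⟩
        · exact ⟨v, fun e he => he (Sum.inl ⟨v, a⟩) (by simp)⟩
        · rcases y with ⟨v', b⟩ | ⟨e'', b⟩
          · exact ⟨v', fun e he => he (Sum.inl ⟨v', b⟩) (by simp)⟩
          · refine ⟨(Quot.out (e' : Sym2 V)).1, fun e he => ?_⟩
            · have : e' = e := he (Sum.inr ⟨e', a⟩) (by simp)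
              rw [← this]
              exact Sym2.out_fst_mem _
    choose g hg using hh
    refine ⟨F.attach.image g, le_trans Finset.card_image_le (by simpa using hFk), ?_⟩
    intro u v huv
    obtain ⟨z, hz, hze⟩ := key ⟨s(u, v), huv⟩
    have hmem : g ⟨z, hz⟩ ∈ F.attach.image g := Finset.mem_image_of_mem _ (Finset.mem_attach _ _)
    rcases Sym2.mem_iff.1 (hg ⟨z, hz⟩ _ hze) with h | h
    · left; rwa [← h]
    · right; rwa [← h]
end

section
/- Let G be a finite simple graph and let τ be a rational number with 0 ≤ τ < 1. Then ρ*(G) ≤ τ if and only if G contains no cycle and every connected component of G has at most ⌊1/(1−τ)⌋ vertices. -/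
open scoped Classical

theorem forest_edges_le {W : Type*} [Fintype W] (F : SimpleGraph W) (hF : F.IsAcyclic) (τ : ℚ)
    (hc : ∀ c : F.ConnectedComponent, (c.supp.ncard : ℚ) * (1 - τ) ≤ 1) :
    (F.edgeSet.ncard : ℚ) ≤ τ * (Fintype.card W : ℚ) := by
  have hsub : F.edgeFinset ⊆ (Finset.univ : Finset F.ConnectedComponent).biUnion
      (fun c => c.toSimpleGraph.edgeFinset.image (Sym2.map Subtype.val)) := by
    intro e
    induction e using Sym2.ind with
    | _ x y =>
      intro he
      have hxy : F.Adj x y := by simpa using he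
      simp only [Finset.mem_biUnion, Finset.mem_univ, true_and, Finset.mem_image]
      have hx : x ∈ (F.connectedComponentMk x).supp := rfl
      have hy : y ∈ (F.connectedComponentMk x).supp :=
        SimpleGraph.ConnectedComponent.mem_supp_of_adj_mem_supp _ hx hxy
      refine ⟨F.connectedComponentMk x, s(⟨x, hx⟩, ⟨y, hy⟩), ?_, rfl⟩
      rw [SimpleGraph.mem_edgeFinset, SimpleGraph.mem_edgeSet]
      exact hxy
  have hV : Fintype.card W = ∑ c : F.ConnectedComponent, c.supp.ncard := by
    rw [← Finset.card_univ, Finset.card_eq_sum_card_fiberwise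
      (f := F.connectedComponentMk) (t := Finset.univ) (by simp)]
    refine Finset.sum_congr rfl fun c _ => ?_
    rw [Set.ncard_eq_toFinset_card']
    congr 1
    ext v
    simp
  have hE : (F.edgeSet.ncard : ℚ) ≤
      ∑ c : F.ConnectedComponent, (c.toSimpleGraph.edgeFinset.card : ℚ) := by
    rw [Set.ncard_eq_toFinset_card']
    have := (Finset.card_le_card hsub).trans
      (Finset.card_biUnion_le.trans (Finset.sum_le_sum fun c _ => Finset.card_image_le))
    exact_mod_cast this
  rw [hV]
  push_cast
  rw [Finset.mul_sum]
  refine hE.trans (Finset.sum_le_sum fun c _ => ?_)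
  have ht := (hF.isTree_connectedComponent c).card_edgeFinset
  have h2 : Fintype.card c = c.supp.ncard := by
    rw [← Nat.card_eq_fintype_card]; rfl
  rw [h2] at ht
  have h3 := hc c
  rw [← ht] at h3 ⊢
  push_cast at h3 ⊢
  linarith

/-- For a finite simple graph `G` and rational `0 ≤ τ < 1`: every subgraph of `G` has
density at most `τ` iff `G` is acyclic and every connected component of `G` has at most
`⌊1/(1-τ)⌋` vertices. -/
theorem maxDensity_le_iff_acyclic_and_small_components {V : Type*} [Fintype V]
    (G : SimpleGraph V) (τ : ℚ) (h0 : 0 ≤ τ) (h1 : τ < 1) :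
    (∀ H : G.Subgraph, G.subDensity H ≤ τ) ↔
      (G.IsAcyclic ∧
        ∀ c : G.ConnectedComponent, (c.supp.ncard : ℤ) ≤ ⌊1 / (1 - τ)⌋) := by
  constructor
  · intro h
    have key : ∀ H : G.Subgraph, (H.edgeSet.ncard : ℚ) ≤ τ * H.verts.ncard := by
      intro H
      by_cases hv : H.verts.ncard = 0
      · have hv' : H.verts = ∅ := (Set.ncard_eq_zero).1 hv
        have : H.edgeSet = ∅ := by
          ext e
          induction e using Sym2.ind with
          | _ x y =>
            simp only [SimpleGraph.Subgraph.mem_edgeSet, Set.mem_empty_iff_false, iff_false]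
            intro hxy
            have := hxy.fst_mem
            simp [hv'] at this
        simp [this, hv]
      · have hpos : (0 : ℚ) < H.verts.ncard := by exact_mod_cast Nat.pos_of_ne_zero hv
        exact (div_le_iff₀ hpos).1 (h H)
    refine ⟨?_, ?_⟩
    · intro u p hp
      have hk := key p.toSubgraph
      have he : p.toSubgraph.edgeSet.ncard = p.length := by
        rw [← p.length_edges, ← List.toFinset_card_of_nodup hp.edges_nodup,
          ← Set.ncard_coe_finset]
        congr 1
        ext e
        simp
      have hn : p.toSubgraph.verts.ncard ≤ p.length := by
        have h5 : p.toSubgraph.verts ⊆ (p.support.tail.toFinset : Set V) := by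
          intro x hx
          have hx' : x ∈ p.support := by simpa using hx
          simp only [List.coe_toFinset, Set.mem_ofPred_eq]
          rw [SimpleGraph.Walk.support_eq_cons] at hx'
          rcases List.mem_cons.1 hx' with rfl | hx'
          · exact SimpleGraph.Walk.end_mem_tail_support hp.not_nil
          · exact hx'
        have h6 := Set.ncard_le_ncard h5 (Finset.finite_toSet _)
        rw [Set.ncard_coe_finset] at h6
        refine h6.trans ((List.toFinset_card_le _).trans ?_)
        simp
      have h3 := hp.three_le_length
      rw [he] at hk
      have h3' : (3 : ℚ) ≤ p.length := by exact_mod_cast h3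
      have hn' : (p.toSubgraph.verts.ncard : ℚ) ≤ p.length := by exact_mod_cast hn
      nlinarith
    · intro c
      rw [Int.le_floor, le_div_iff₀ (by linarith)]
      have hk := key c.toSubgraph
      have hcon := c.connected_toSimpleGraph.card_vert_le_card_edgeSet_add_one
      have h2 : Nat.card c = c.supp.ncard := rfl
      have hv : c.toSubgraph.verts = c.supp := rfl
      have he : Nat.card c.toSimpleGraph.edgeSet = c.toSubgraph.edgeSet.ncard := by
        rw [← SimpleGraph.Subgraph.image_coe_edgeSet_coe,
          Set.ncard_image_of_injective _ (Sym2.map.injective Subtype.val_injective)]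
        rw [SimpleGraph.ConnectedComponent.coe_toSubgraph, Nat.card_coe_set_eq]
        rfl
      rw [h2, he] at hcon
      rw [hv] at hk
      have hcon' : (c.supp.ncard : ℚ) ≤ c.toSubgraph.edgeSet.ncard + 1 := by exact_mod_cast hcon
      push_cast
      linarith
  · rintro ⟨hac, hcomp⟩ H
    have hb := forest_edges_le H.coe (hac.subgraph H) τ (by
      intro d
      obtain ⟨v, rfl⟩ := d.exists_rep
      have h7 := hcomp (G.connectedComponentMk v)
      rw [Int.le_floor, le_div_iff₀ (by linarith)] at h7
      refine le_trans (mul_le_mul_of_nonneg_right ?_ (by linarith)) h7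
      have : (SimpleGraph.ConnectedComponent.supp (H.coe.connectedComponentMk v)).ncard ≤
          (G.connectedComponentMk (v : V)).supp.ncard := by
        refine Set.ncard_le_ncard_of_injOn Subtype.val ?_ Subtype.val_injective.injOn
          (Set.toFinite _)
        intro w hw
        have hr : H.coe.Reachable w v := SimpleGraph.ConnectedComponent.exact hw
        exact SimpleGraph.ConnectedComponent.sound (hr.map H.hom)
      exact_mod_cast this)
    have he : H.coe.edgeSet.ncard = H.edgeSet.ncard := by
      rw [← SimpleGraph.Subgraph.image_coe_edgeSet_coe,
          Set.ncard_image_of_injective _ (Sym2.map.injective Subtype.val_injective)]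
    have hv : Fintype.card H.verts = H.verts.ncard := by
      rw [← Nat.card_eq_fintype_card]; rfl
    rw [he, hv] at hb
    unfold SimpleGraph.subDensity
    exact div_le_of_le_mul₀ (by positivity) h0 hb
end

section
/- Let p and q be coprime positive integers with q < p < 2q. Then there exists an integer n ≥ 4 such that q divides p·n + 1 − 2q and, setting m = (p·n + 1 − 2q)/q, one has n + 1 ≤ m ≤ 2n − 3. -/
/-- For coprime positive integers `p, q` with `q < p < 2q` there is an integer `n ≥ 4`
such that `q` divides `p·n + 1 − 2q` and the quotient `m = (p·n + 1 − 2q)/q` satisfies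
`n + 1 ≤ m ≤ 2n − 3`. -/
theorem exists_n_for_edge_gadget (p q : ℕ) (hco : Nat.Coprime p q)
    (h1 : q < p) (h2 : p < 2 * q) :
    ∃ (n : ℕ) (m : ℤ), 4 ≤ n ∧ (q : ℤ) * m = (p : ℤ) * n + 1 - 2 * q ∧
      (n : ℤ) + 1 ≤ m ∧ m ≤ 2 * (n : ℤ) - 3 := by
  obtain ⟨a, b, hab⟩ := Nat.isCoprime_iff_coprime.mpr hco
  have hq : (2 : ℤ) ≤ q := by omega
  have h1' : (q : ℤ) + 1 ≤ p := by omega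
  have h2' : (p : ℤ) + 1 ≤ 2 * q := by omega
  generalize (q : ℤ) = Q at *
  generalize (p : ℤ) = P at *
  have hn : 3 * Q ≤ -a + Q * (|a| + 3) := by
    nlinarith [le_abs_self a, abs_nonneg a]
  have hk : ∃ n : ℕ, (n : ℤ) = -a + Q * (|a| + 3) :=
    ⟨(-a + Q * (|a| + 3)).toNat, Int.toNat_of_nonneg (by linarith)⟩
  obtain ⟨n, hk⟩ := hk
  rw [← hk] at hn
  have hm : Q * (b + P * (|a| + 3) - 2) = P * n + 1 - 2 * Q := by
    rw [hk]; linear_combination hab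
  refine ⟨n, b + P * (|a| + 3) - 2, by omega, hm, ?_, ?_⟩
  · refine le_of_mul_le_mul_left ?_ (by linarith : 0 < Q)
    rw [hm]; nlinarith
  · refine le_of_mul_le_mul_left ?_ (by linarith : 0 < Q)
    rw [hm]; nlinarith
end

section
/- Let G be a finite simple graph and let τ ∈ ℕ. Then ρ*(G) ≤ τ if and only if there exists an orientation of G, i.e., an assignment of a direction to every edge of G, in which every vertex has indegree at most τ. -/
open scoped Classical

/-- For a finite simple graph `G` and `τ ∈ ℕ`: every subgraph of `G` has density at most
`τ` iff there is an orientation of `G` (a choice `head e ∈ e` of a head for every edge)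
in which every vertex has indegree at most `τ`. -/
theorem maxDensity_le_iff_exists_orientation {V : Type*} [Fintype V] [DecidableEq V]
    (G : SimpleGraph V) [DecidableRel G.Adj] (τ : ℕ) :
    (∀ H : G.Subgraph, G.subDensity H ≤ (τ : ℚ)) ↔
      ∃ head : G.edgeSet → V,
        (∀ e : G.edgeSet, head e ∈ (e : Sym2 V)) ∧
        ∀ v : V, (Finset.univ.filter (fun e : G.edgeSet => head e = v)).card ≤ τ := by
  constructor
  · intro h
    have hall := (Finset.all_card_le_biUnion_card_iff_exists_injective
      (fun e : G.edgeSet => (Finset.univ.filter (fun p : V × Fin τ => p.1 ∈ (e : Sym2 V))))).1 ?_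
    · obtain ⟨f, hf, hm⟩ := hall
      refine ⟨fun e => (f e).1, fun e => by simpa using hm e, fun v => ?_⟩
      have : (Finset.univ.filter (fun e : G.edgeSet => (f e).1 = v)).card
          ≤ (Finset.univ : Finset (Fin τ)).card := by
        apply Finset.card_le_card_of_injOn (fun e => (f e).2) (by simp)
        intro a ha b hb hab
        simp only [Finset.coe_filter, Finset.mem_univ, true_and, Set.mem_setOf_eq] at ha hb
        exact hf (Prod.ext (ha.trans hb.symm) hab)
      simpa using this
    · intro s
      let W : Finset V := Finset.univ.filter (fun v => ∃ e ∈ s, v ∈ (e : Sym2 V))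
      let S : Set (Sym2 V) := {x | ∃ e ∈ s, (e : Sym2 V) = x}
      let H : G.Subgraph :=
        { verts := {v | v ∈ W}
          Adj := fun a b => s(a, b) ∈ S
          adj_sub := by
            rintro a b ⟨e, he, hab⟩
            have := e.2
            rw [hab] at this
            exact this
          edge_vert := by
            rintro a b ⟨e, he, hab⟩
            simp only [W, Finset.mem_filter, Finset.mem_univ, true_and, Set.mem_setOf_eq]
            exact ⟨e, he, by rw [hab]; simp⟩
          symm := ⟨by
            intro a b hab
            rwa [Sym2.eq_swap]⟩ }
      have hE : H.edgeSet = ((s.image Subtype.val : Finset (Sym2 V)) : Set (Sym2 V)) := by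
        ext x
        induction x with
        | _ a b =>
          rw [SimpleGraph.Subgraph.mem_edgeSet]
          change (∃ e ∈ s, (e : Sym2 V) = s(a,b)) ↔ _
          rw [Finset.mem_coe, Finset.mem_image]
      have hEc : H.edgeSet.ncard = s.card := by
        rw [hE, Set.ncard_coe_finset, Finset.card_image_of_injective _ Subtype.val_injective]
      have hV : H.verts.ncard = W.card := Set.ncard_coe_finset W
      have hH := h H
      rw [SimpleGraph.subDensity, hEc, hV] at hH
      have hU : (s.biUnion (fun e : G.edgeSet =>
          (Finset.univ.filter (fun p : V × Fin τ => p.1 ∈ (e : Sym2 V)))))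
          = W ×ˢ (Finset.univ : Finset (Fin τ)) := by
        ext p
        simp [W]
      rw [hU, Finset.card_product, Finset.card_univ, Fintype.card_fin]
      rcases Nat.eq_zero_or_pos W.card with h0 | h0
      · have : s = ∅ := by
          rw [Finset.eq_empty_iff_forall_notMem]
          intro e he
          rw [Finset.card_eq_zero] at h0
          have : (e : Sym2 V).out.1 ∈ W := by
            simp only [W, Finset.mem_filter, Finset.mem_univ, true_and]
            exact ⟨e, he, Sym2.out_fst_mem _⟩
          simp [h0] at this
        simp [this]
      · rw [div_le_iff₀ (by exact_mod_cast h0)] at hH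
        rw [mul_comm]
        exact_mod_cast hH
  · rintro ⟨head, hm, hd⟩ H
    rw [SimpleGraph.subDensity]
    apply div_le_of_le_mul₀ (by positivity) (by positivity)
    let E : Finset G.edgeSet := Finset.univ.filter (fun e => (e : Sym2 V) ∈ H.edgeSet)
    have hE : H.edgeSet = ((E.image Subtype.val : Finset (Sym2 V)) : Set (Sym2 V)) := by
      ext x
      simp only [E, Finset.coe_image, Set.mem_image, Finset.mem_coe, Finset.mem_filter,
        Finset.mem_univ, true_and]
      constructor
      · intro hx
        exact ⟨⟨x, H.edgeSet_subset hx⟩, hx, rfl⟩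
      · rintro ⟨e, he, rfl⟩
        exact he
    have hEc : H.edgeSet.ncard = E.card := by
      rw [hE, Set.ncard_coe_finset, Finset.card_image_of_injective _ Subtype.val_injective]
    have hV : H.verts.ncard = H.verts.toFinset.card := Set.ncard_eq_toFinset_card' _
    rw [hEc, hV]
    have := Finset.card_le_mul_card_image_of_maps_to (f := head) (s := E) (t := H.verts.toFinset)
      (fun e he => by
        simp only [E, Finset.mem_filter, Finset.mem_univ, true_and] at he
        rw [Set.mem_toFinset]
        exact H.mem_verts_of_mem_edge he (hm e)) τ
      (fun v _ => le_trans (Finset.card_le_card (by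
        intro e he
        simp only [Finset.mem_filter, Finset.mem_univ, true_and] at he ⊢
        exact he.2)) (hd v))
    exact_mod_cast this
end

section
/- Let G be a finite simple cubic graph (every vertex has exactly three neighbours) and let k ∈ ℕ. Construct the digraph D as follows: D has two vertices s and t; for every vertex v of G with neighbours u_1, u_2, u_3, D has six vertices v_1, v_2, v_3, (v,u_1), (v,u_2), (v,u_3), the arcs (s, v_i) for i ∈ {1,2,3}, and the arcs (v_i, (v,u_j)) for all i, j ∈ {1,2,3} with i ≠ j; for every edge {u,w} of G, D has a vertex e_{uw} and the arcs ((u,w), e_{uw}), ((w,u), e_{uw}) and (e_{uw}, t). Call an arc restricted if it is of the form (s, v_i), ((u,w), e_{uw}), ((w,u), e_{uw}) or (e_{uw}, t). Then G has an independent set of size k if and only if there exists a function f from the arcs of D to the nonnegative rationals satisfying flow conservation at every vertex other than s and t (the total flow entering equals the total flow leaving), f(a) ∈ {0, 2} for every restricted arc a, f(a) ≤ 1 for every non-restricted arc a, and Σ f(s, v_i) = 6k, where the sum is over all arcs leaving s. -/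
open scoped Classical

/-- Vertex set of the Subset-Even-Flow network built from a cubic graph `G`:
the source `s`, the sink `t`, the bottom vertices `v_i` (`v ∈ V`, `i ∈ Fin 3`),
the top vertices `(v, u_j)` (encoded as `(v, j)` where `u_j` is the `j`-th neighbour of
`v`), and one vertex `e_{uw}` per edge of `G`. -/
abbrev FlowVx (V : Type*) (G : SimpleGraph V) : Type _ :=
  Unit ⊕ Unit ⊕ (V × Fin 3) ⊕ (V × Fin 3) ⊕ G.edgeSet

/-- The source `s`. -/
def flowS {V : Type*} {G : SimpleGraph V} : FlowVx V G := Sum.inl ()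

/-- The sink `t`. -/
def flowT {V : Type*} {G : SimpleGraph V} : FlowVx V G := Sum.inr (Sum.inl ())

/-- A bottom vertex `v_i`. -/
def flowBot {V : Type*} {G : SimpleGraph V} (z : V × Fin 3) : FlowVx V G :=
  Sum.inr (Sum.inr (Sum.inl z))

/-- A top vertex `(v, u_j)`. -/
def flowTop {V : Type*} {G : SimpleGraph V} (z : V × Fin 3) : FlowVx V G :=
  Sum.inr (Sum.inr (Sum.inr (Sum.inl z)))

/-- An edge vertex `e_{uw}`. -/
def flowEdge {V : Type*} {G : SimpleGraph V} (e : G.edgeSet) : FlowVx V G :=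
  Sum.inr (Sum.inr (Sum.inr (Sum.inr e)))

/-- The arcs of the network: `(s, v_i)`; `(v_i, (v,u_j))` for `i ≠ j`;
`((v,u_j), e_{v,u_j})`; and `(e, t)` for every edge vertex `e`.
Here `nbr v j` is the `j`-th neighbour of `v`. -/
def flowArc {V : Type*} (G : SimpleGraph V) (nbr : V → Fin 3 → V) :
    FlowVx V G → FlowVx V G → Prop := fun x y =>
  match x, y with
  | Sum.inl _, Sum.inr (Sum.inr (Sum.inl _)) => True
  | Sum.inr (Sum.inr (Sum.inl (v, i))), Sum.inr (Sum.inr (Sum.inr (Sum.inl (v', j)))) =>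
      v = v' ∧ i ≠ j
  | Sum.inr (Sum.inr (Sum.inr (Sum.inl (v, j)))), Sum.inr (Sum.inr (Sum.inr (Sum.inr e))) =>
      (e : Sym2 V) = s(v, nbr v j)
  | Sum.inr (Sum.inr (Sum.inr (Sum.inr _))), Sum.inr (Sum.inl _) => True
  | _, _ => False

/-- Restricted arcs: those leaving `s`, entering an edge vertex, or leaving an edge
vertex. -/
def flowRestricted {V : Type*} (G : SimpleGraph V) :
    FlowVx V G → FlowVx V G → Prop := fun x y =>
  match x, y with
  | Sum.inl _, _ => True
  | _, Sum.inr (Sum.inr (Sum.inr (Sum.inr _))) => True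
  | Sum.inr (Sum.inr (Sum.inr (Sum.inr _))), _ => True
  | _, _ => False

theorem gadget_arith (a01 a02 a10 a12 a20 a21 b0 b1 b2 c0 c1 c2 : ℚ)
    (h01 : a01 ≤ 1) (h02 : a02 ≤ 1) (h10 : a10 ≤ 1) (h12 : a12 ≤ 1) (h20 : a20 ≤ 1)
    (h21 : a21 ≤ 1) (g01 : 0 ≤ a01) (g02 : 0 ≤ a02) (g10 : 0 ≤ a10) (g12 : 0 ≤ a12)
    (g20 : 0 ≤ a20) (g21 : 0 ≤ a21)
    (hb0 : b0 = 0 ∨ b0 = 2) (hb1 : b1 = 0 ∨ b1 = 2) (hb2 : b2 = 0 ∨ b2 = 2)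
    (hc0 : c0 = 0 ∨ c0 = 2) (hc1 : c1 = 0 ∨ c1 = 2) (hc2 : c2 = 0 ∨ c2 = 2)
    (e0 : b0 = a01 + a02) (e1 : b1 = a10 + a12) (e2 : b2 = a20 + a21)
    (d0 : a10 + a20 = c0) (d1 : a01 + a21 = c1) (d2 : a02 + a12 = c2) :
    b1 = b0 ∧ b2 = b0 ∧ c0 = b0 ∧ c1 = b0 ∧ c2 = b0 := by
  rcases hb0 with hb0 | hb0 <;> rcases hb1 with hb1 | hb1 <;> rcases hb2 with hb2 | hb2 <;>
  rcases hc0 with hc0 | hc0 <;> rcases hc1 with hc1 | hc1 <;> rcases hc2 with hc2 | hc2 <;>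
  first
  | (exfalso; linarith)
  | (refine ⟨?_, ?_, ?_, ?_, ?_⟩ <;> linarith)

theorem sum_flowTop {V : Type*} [Fintype V] (G : SimpleGraph V) [Fintype G.edgeSet] (v : V)
    (g : FlowVx V G → ℚ) (h : ∀ x, (∀ j, flowTop (v, j) ≠ x) → g x = 0) :
    ∑ x, g x = ∑ j, g (flowTop (v, j)) := by
  symm
  refine Fintype.sum_of_injective (fun j => flowTop (v, j)) ?_ _ _ ?_ (fun _ => rfl)
  · intro i j hij
    simpa [flowTop] using hij
  · intro x hx
    exact h x (fun j hj => hx ⟨j, hj⟩)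

theorem sum_flowBot {V : Type*} [Fintype V] (G : SimpleGraph V) [Fintype G.edgeSet] (v : V)
    (g : FlowVx V G → ℚ) (h : ∀ x, (∀ j, flowBot (v, j) ≠ x) → g x = 0) :
    ∑ x, g x = ∑ j, g (flowBot (v, j)) := by
  symm
  refine Fintype.sum_of_injective (fun j => flowBot (v, j)) ?_ _ _ ?_ (fun _ => rfl)
  · intro i j hij
    simpa [flowBot] using hij
  · intro x hx
    exact h x (fun j hj => hx ⟨j, hj⟩)

/-- The flow built from a vertex set. -/
noncomputable def setFlow {V : Type*} (G : SimpleGraph V) (nbr : V → Fin 3 → V) (S : Finset V) :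
    FlowVx V G → FlowVx V G → ℚ := fun x y =>
  match x, y with
  | Sum.inl _, Sum.inr (Sum.inr (Sum.inl z)) => if z.1 ∈ S then 2 else 0
  | Sum.inr (Sum.inr (Sum.inl z)), Sum.inr (Sum.inr (Sum.inr (Sum.inl z'))) =>
      if z.1 = z'.1 ∧ z.2 ≠ z'.2 ∧ z.1 ∈ S then 1 else 0
  | Sum.inr (Sum.inr (Sum.inr (Sum.inl z))), Sum.inr (Sum.inr (Sum.inr (Sum.inr e))) =>
      if (e : Sym2 V) = s(z.1, nbr z.1 z.2) ∧ z.1 ∈ S then 2 else 0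
  | Sum.inr (Sum.inr (Sum.inr (Sum.inr e))), Sum.inr (Sum.inl _) =>
      if ∃ v ∈ S, v ∈ (e : Sym2 V) then 2 else 0
  | _, _ => 0

/-- NP-hardness gadget correctness (Subset Even Flow): a cubic graph `G` (with an
enumeration `nbr v` of the three neighbours of each vertex `v`) has an independent set of
size `k` iff the constructed network admits a nonnegative rational flow `f` that conserves
flow at every vertex other than `s` and `t`, takes values in `{0,2}` on restricted arcs,
is at most `1` on non-restricted arcs, and sends a total of `6k` out of `s`. -/
theorem independentSet_iff_subsetEvenFlow {V : Type*} [Fintype V] [DecidableEq V]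
    (G : SimpleGraph V) [DecidableRel G.Adj]
    (hcubic : ∀ v : V, G.degree v = 3) (k : ℕ)
    (nbr : V → Fin 3 → V)
    (hnbr : ∀ v, Function.Injective (nbr v) ∧ ∀ u, G.Adj v u ↔ ∃ j, nbr v j = u) :
    (∃ S : Finset V, S.card = k ∧ ∀ u ∈ S, ∀ v ∈ S, ¬ G.Adj u v) ↔
    (∃ f : FlowVx V G → FlowVx V G → ℚ,
      (∀ x y, ¬ flowArc G nbr x y → f x y = 0) ∧
      (∀ x y, flowArc G nbr x y → 0 ≤ f x y) ∧
      (∀ x y, flowArc G nbr x y → flowRestricted G x y → (f x y = 0 ∨ f x y = 2)) ∧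
      (∀ x y, flowArc G nbr x y → ¬ flowRestricted G x y → f x y ≤ 1) ∧
      (∀ x : FlowVx V G, x ≠ flowS → x ≠ flowT → (∑ y, f y x) = (∑ y, f x y)) ∧
      (∑ z : V × Fin 3, f flowS (flowBot z)) = 6 * k) := by
  have hadj : ∀ v j, G.Adj v (nbr v j) := fun v j => ((hnbr v).2 _).2 ⟨j, rfl⟩
  constructor
  · rintro ⟨S, hk, hind⟩
    refine ⟨setFlow G nbr S, ?_, ?_, ?_, ?_, ?_, ?_⟩
    · rintro (_ | _ | ⟨v, i⟩ | ⟨v, i⟩ | e) (_ | _ | ⟨v', j⟩ | ⟨v', j⟩ | e') <;>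
        simp +contextual [flowArc, setFlow]
    · rintro (_ | _ | ⟨v, i⟩ | ⟨v, i⟩ | e) (_ | _ | ⟨v', j⟩ | ⟨v', j⟩ | e') <;>
        simp only [flowArc, setFlow] <;> intros <;> first | positivity | (split_ifs <;> norm_num)
    · rintro (_ | _ | ⟨v, i⟩ | ⟨v, i⟩ | e) (_ | _ | ⟨v', j⟩ | ⟨v', j⟩ | e') <;>
        simp only [flowArc, flowRestricted, setFlow] <;> intros <;>
        first | contradiction | (split_ifs <;> simp)
    · rintro (_ | _ | ⟨v, i⟩ | ⟨v, i⟩ | e) (_ | _ | ⟨v', j⟩ | ⟨v', j⟩ | e') <;>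
        simp only [flowArc, flowRestricted, setFlow] <;> intros <;>
        first | contradiction | (exfalso; tauto) | (split_ifs <;> norm_num)
    · rintro (_ | _ | ⟨v, i⟩ | ⟨v, i⟩ | e) hs ht
      · exact absurd rfl hs
      · exact absurd rfl ht
      · rw [Fintype.sum_eq_single (a := flowS), sum_flowTop G v]
        · fin_cases i <;> by_cases hv : v ∈ S <;>
            simp [setFlow, flowTop, flowS, hv, Fin.sum_univ_three] <;> norm_num
        · rintro (_ | _ | ⟨v', j⟩ | ⟨v', j⟩ | e) hx <;> simp only [setFlow]
          rw [if_neg]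
          rintro ⟨h1, -⟩
          exact hx j (by rw [h1]; rfl)
        · rintro (_ | _ | ⟨v', j⟩ | ⟨v', j⟩ | e) hx <;>
            first | exact absurd rfl hx | simp only [setFlow]
      · rw [Fintype.sum_eq_single (a := flowEdge (⟨s(v, nbr v i), hadj v i⟩ : G.edgeSet))
          (f := fun y => setFlow G nbr S (Sum.inr (Sum.inr (Sum.inr (Sum.inl (v, i))))) y),
          sum_flowBot G v]
        · fin_cases i <;> by_cases hv : v ∈ S <;>
            simp [setFlow, flowBot, flowEdge, hv, Fin.sum_univ_three] <;> norm_num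
        · rintro (_ | _ | ⟨v', j⟩ | ⟨v', j⟩ | e) hx <;> simp only [setFlow]
          rw [if_neg]
          rintro ⟨h1, -⟩
          exact hx j (by rw [h1]; rfl)
        · rintro (_ | _ | ⟨v', j⟩ | ⟨v', j⟩ | e) hx <;> simp only [setFlow]
          rw [if_neg]
          rintro ⟨h, -⟩
          exact hx (by simp only [flowEdge, ← h])
      · simp only [Fintype.sum_sum_type, setFlow]
        simp only [Finset.sum_const_zero, zero_add, add_zero, Fintype.sum_unique]
        split_ifs with h
        · obtain ⟨v, hv, hve⟩ := h
          obtain ⟨e, he⟩ := e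
          obtain ⟨w, rfl⟩ := hve
          have hvw : G.Adj v w := he
          obtain ⟨j, rfl⟩ := ((hnbr v).2 w).1 hvw
          rw [Fintype.sum_eq_single (a := (v, j))]
          · simp [hv]
          · rintro ⟨x, i⟩ hx
            rw [if_neg]
            rintro ⟨h1, h2⟩
            simp only [Sym2.eq_iff] at h1
            rcases h1 with ⟨h1, h3⟩ | ⟨h1, h3⟩
            · subst h1
              exact hx (by rw [(hnbr v).1 h3])
            · simp only at h2
              rw [← h3] at h2
              exact hind _ hv _ h2 hvw
        · apply Finset.sum_eq_zero
          intro z _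
          rw [if_neg]
          rintro ⟨h1, h2⟩
          exact h ⟨z.1, h2, by rw [h1]; simp⟩
    · simp only [flowS, flowBot, setFlow, Fintype.sum_prod_type]
      rw [Fintype.sum_congr _ (fun v => if v ∈ S then (6:ℚ) else 0)]
      · rw [← Finset.sum_filter, Finset.sum_const]
        simp [hk]
        ring
      · intro v
        by_cases hv : v ∈ S <;> simp [hv] <;> norm_num
  · rintro ⟨f, h0, hnn, hr, hle, hcons, htot⟩
    have hbot : ∀ v i, f flowS (flowBot (v, i)) = ∑ j, f (flowBot (v, i)) (flowTop (v, j)) := by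
      intro v i
      have h := hcons (flowBot (v, i)) (by simp [flowBot, flowS]) (by simp [flowBot, flowT])
      rw [Fintype.sum_eq_single (a := flowS)] at h
      · rw [h]
        apply sum_flowTop
        rintro (_ | _ | ⟨v', j⟩ | ⟨v', j⟩ | e) hx <;> refine h0 _ _ ?_ <;>
          simp only [flowBot, flowArc, not_false_eq_true]
        rintro ⟨rfl, -⟩
        exact hx j rfl
      · rintro (_ | _ | ⟨v, i⟩ | ⟨v, i⟩ | e) hx <;>
          first | exact absurd rfl hx | exact h0 _ _ (by simp [flowBot, flowArc])
    have htop : ∀ v j, ∑ i, f (flowBot (v, i)) (flowTop (v, j)) =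
        f (flowTop (v, j)) (flowEdge ⟨s(v, nbr v j), hadj v j⟩) := by
      intro v j
      have h := hcons (flowTop (v, j)) (by simp [flowTop, flowS]) (by simp [flowTop, flowT])
      rw [Fintype.sum_eq_single (a := flowEdge ⟨s(v, nbr v j), hadj v j⟩)
        (f := fun y => f (flowTop (v, j)) y)] at h
      · rw [← h]
        symm
        apply sum_flowBot
        rintro (_ | _ | ⟨v', j⟩ | ⟨v', j⟩ | e) hx <;> refine h0 _ _ ?_ <;>
          simp only [flowTop, flowArc, not_false_eq_true]
        rintro ⟨rfl, -⟩
        exact hx j rfl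
      · rintro (_ | _ | ⟨v, i⟩ | ⟨v, i⟩ | e) hx <;>
          refine h0 _ _ ?_ <;> simp only [flowTop, flowArc, not_false_eq_true]
        intro h
        exact hx (by simp only [flowEdge, ← h])
    have hdiag : ∀ v i, f (flowBot (v, i)) (flowTop (v, i)) = 0 := fun v i =>
      h0 _ _ (by simp [flowBot, flowTop, flowArc])
    have hkey : ∀ v, (∀ i, f flowS (flowBot (v, i)) = f flowS (flowBot (v, 0))) ∧
        ∀ j, f (flowTop (v, j)) (flowEdge ⟨s(v, nbr v j), hadj v j⟩) =
          f flowS (flowBot (v, 0)) := by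
      intro v
      have hA : ∀ i j : Fin 3, i ≠ j → flowArc G nbr (flowBot (v, i)) (flowTop (v, j)) := by
        intro i j hij
        simp [flowBot, flowTop, flowArc, hij]
      have hle' : ∀ i j : Fin 3, i ≠ j → f (flowBot (v, i)) (flowTop (v, j)) ≤ 1 :=
        fun i j hij => hle _ _ (hA i j hij) (by simp [flowBot, flowTop, flowRestricted])
      have hnn' : ∀ i j : Fin 3, i ≠ j → 0 ≤ f (flowBot (v, i)) (flowTop (v, j)) :=
        fun i j hij => hnn _ _ (hA i j hij)
      have hb : ∀ i, f flowS (flowBot (v, i)) = 0 ∨ f flowS (flowBot (v, i)) = 2 :=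
        fun i => hr _ _ (by simp [flowS, flowBot, flowArc]) (by simp [flowS, flowRestricted])
      have hc : ∀ j, f (flowTop (v, j)) (flowEdge ⟨s(v, nbr v j), hadj v j⟩) = 0 ∨
          f (flowTop (v, j)) (flowEdge ⟨s(v, nbr v j), hadj v j⟩) = 2 :=
        fun i => hr _ _ (by simp [flowTop, flowEdge, flowArc])
          (by simp [flowTop, flowEdge, flowRestricted])
      have e0 := hbot v 0
      have e1 := hbot v 1
      have e2 := hbot v 2
      have d0 := htop v 0
      have d1 := htop v 1
      have d2 := htop v 2
      simp only [Fin.sum_univ_three, hdiag, zero_add, add_zero] at e0 e1 e2 d0 d1 d2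
      obtain ⟨r1, r2, r3, r4, r5⟩ := gadget_arith _ _ _ _ _ _ _ _ _ _ _ _
        (hle' 0 1 (by decide)) (hle' 0 2 (by decide)) (hle' 1 0 (by decide))
        (hle' 1 2 (by decide)) (hle' 2 0 (by decide)) (hle' 2 1 (by decide))
        (hnn' 0 1 (by decide)) (hnn' 0 2 (by decide)) (hnn' 1 0 (by decide))
        (hnn' 1 2 (by decide)) (hnn' 2 0 (by decide)) (hnn' 2 1 (by decide))
        (hb 0) (hb 1) (hb 2) (hc 0) (hc 1) (hc 2) e0 e1 e2 d0 d1 d2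
      constructor
      · intro i
        fin_cases i
        · rfl
        · exact r1
        · exact r2
      · intro i
        fin_cases i
        · exact r3
        · exact r4
        · exact r5
    refine ⟨Finset.univ.filter (fun v => f flowS (flowBot (v, 0)) = 2), ?_, ?_⟩
    · have hv : ∀ v, ∑ i : Fin 3, f flowS (flowBot (v, i)) =
          if f flowS (flowBot (v, 0)) = 2 then 6 else 0 := by
        intro v
        rw [Fintype.sum_congr _ _ (hkey v).1]
        have := hr flowS (flowBot (v, 0)) (by simp [flowS, flowBot, flowArc])
          (by simp [flowS, flowRestricted])
        rcases this with h | h <;> simp [h] <;> norm_num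
      rw [Fintype.sum_prod_type, Fintype.sum_congr _ _ hv, ← Finset.sum_filter,
        Finset.sum_const, nsmul_eq_mul] at htot
      have : ((Finset.univ.filter (fun v => f flowS (flowBot (v, 0)) = 2)).card : ℚ) = k := by
        linarith
      exact_mod_cast this
    · intro u hu v hv huv
      simp only [Finset.mem_filter, Finset.mem_univ, true_and] at hu hv
      obtain ⟨j, hj⟩ := ((hnbr u).2 v).1 huv
      obtain ⟨i, hi⟩ := ((hnbr v).2 u).1 huv.symm
      have hcu := ((hkey u).2 j).trans hu
      have hcv := ((hkey v).2 i).trans hv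
      have hee : (⟨s(v, nbr v i), hadj v i⟩ : G.edgeSet) = ⟨s(u, nbr u j), hadj u j⟩ := by
        apply Subtype.ext
        simp only [hi, hj]
        exact Sym2.eq_swap
      rw [hee] at hcv
      generalize (⟨s(u, nbr u j), hadj u j⟩ : G.edgeSet) = e at hcu hcv
      have hnn2 : ∀ x y, 0 ≤ f x y := by
        intro x y
        by_cases h : flowArc G nbr x y
        · exact hnn _ _ h
        · exact (h0 _ _ h).ge
      have h := hcons (flowEdge e) (by simp [flowEdge, flowS]) (by simp [flowEdge, flowT])
      rw [Fintype.sum_eq_single (a := flowT) (f := fun y => f (flowEdge e) y)] at h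
      · have h4 := Finset.sum_le_univ_sum_of_nonneg (f := fun y => f y (flowEdge e))
          (s := {flowTop (u, j), flowTop (v, i)}) (fun y => hnn2 _ _)
        rw [Finset.sum_pair, hcu, hcv, h] at h4
        · have := hr (flowEdge e) flowT (by simp [flowEdge, flowT, flowArc])
            (by simp [flowEdge, flowT, flowRestricted])
          rcases this with h | h <;> rw [h] at h4 <;> norm_num at h4
        · intro hh
          simp only [flowTop, Sum.inr.injEq, Sum.inl.injEq, Prod.mk.injEq] at hh
          exact huv.ne hh.1
      · rintro (_ | _ | ⟨v, i⟩ | ⟨v, i⟩ | e) hx <;>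
          first | exact absurd rfl hx | exact h0 _ _ (by simp [flowEdge, flowArc])
end
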